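/- Let Γ and Γ₀ be rectifiable Jordan curves through a common point λ₀, positively oriented, bounding domains Ω and Ω₀ with (clos Ω) \ {λ₀} ⊂ Ω₀. Suppose there are parameters t_{0n} ↓ 0, t_{1n} ↑ 1 and rectifiable connecting paths γ_{kn} in (clos Ω₀) \ Ω from Γ(t_{0n}) to Γ₀(t_{0n}) and from Γ₀(t_{1n}) to Γ(t_{1n}) whose lengths tend to 0, with interiors in Ω₀ \ clos Ω and pairwise disjoint. Let U be an open set with (clos Ω₀) \ {λ₀} ⊂ U and F : U → L(H) analytic with sup over (clos Ω₀) \ ({λ₀} ∪ Ω) of ‖F(z)‖ finite. Then ∫_Γ F(z) dz = ∫_{Γ₀} F(z) dz. -/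

import Mathlib

open scoped Real
open MeasureTheory Filter

variable {H : Type*} [NormedAddCommGroup H] [NormedSpace ℂ H] [CompleteSpace H]

/-- The commutant of an operator `T`. -/
def commutant (T : H →L[ℂ] H) : Set (H →L[ℂ] H) := {A | A * T = T * A}

/-- The double commutant of an operator `T`. -/
def bicommutant (T : H →L[ℂ] H) : Set (H →L[ℂ] H) :=
  {A | ∀ B ∈ commutant T, A * B = B * A}

/-- A (closed) subspace invariant under every operator commuting with `T`. -/
def IsHyperinvariant (T : H →L[ℂ] H) (M : Submodule ℂ H) : Prop :=
  IsClosed (M : Set H) ∧ ∀ A ∈ commutant T, ∀ x ∈ M, A x ∈ M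

namespace CD
set_option linter.unusedSectionVars false
set_option linter.unnecessarySimpa false
section Pompeiu
open Set Topology Complex

variable {E : Type*} [NormedAddCommGroup E] [NormedSpace ℂ E] [CompleteSpace E]

noncomputable def dbar (ψ : ℂ → E) (w : ℂ) : E :=
  (1/2 : ℂ) • (fderiv ℝ ψ w 1 + I • fderiv ℝ ψ w I)

noncomputable def ee (θ : ℝ) : ℂ := Real.cos θ + Real.sin θ * I

lemma ee_cont : Continuous ee := by unfold ee; fun_prop

lemma ee_norm (θ : ℝ) : ‖ee θ‖ = 1 := by
  have := Complex.norm_exp_ofReal_mul_I θ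
  rw [Complex.exp_mul_I] at this
  simpa [ee] using this

lemma ee_deriv (θ : ℝ) : HasDerivAt ee (I * ee θ) θ := by
  have h1 : HasDerivAt (fun θ : ℝ => ((Real.cos θ : ℝ) : ℂ)) ((-Real.sin θ : ℝ) : ℂ) θ :=
    (Real.hasDerivAt_cos θ).ofReal_comp
  have h2 : HasDerivAt (fun θ : ℝ => ((Real.sin θ : ℝ) : ℂ)) ((Real.cos θ : ℝ) : ℂ) θ :=
    (Real.hasDerivAt_sin θ).ofReal_comp
  have := h1.add (h2.mul_const I)
  refine this.congr_deriv ?_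
  unfold ee
  push_cast
  linear_combination (- (Complex.sin θ)) * I_mul_I

lemma dbar_cont {ψ : ℂ → E} (hψ : ContDiff ℝ 1 ψ) : Continuous (dbar ψ) := by
  have := hψ.continuous_fderiv (by norm_num)
  unfold dbar
  fun_prop

lemma dbar_supp {ψ : ℂ → E} (hc : HasCompactSupport ψ) : HasCompactSupport (dbar ψ) := by
  have h1 := hc.fderiv (𝕜 := ℝ)
  refine h1.mono ?_
  intro w hw
  simp only [Function.mem_support, ne_eq] at hw ⊢
  intro h0
  apply hw
  simp [dbar, h0]

lemma pomp0 {ψ : ℂ → E} (hψ : ContDiff ℝ 1 ψ) (hc : HasCompactSupport ψ) :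
    ∫ w, w⁻¹ • dbar ψ w = -(π : ℂ) • ψ 0 := by
  have hcd := hψ.continuous_fderiv (by norm_num)
  have hdiff : Differentiable ℝ ψ := hψ.differentiable (by norm_num)
  obtain ⟨R, hR⟩ : ∃ R : ℝ, 0 < R ∧ ∀ w : ℂ, R < ‖w‖ → fderiv ℝ ψ w = 0 ∧ ψ w = 0 := by
    obtain ⟨R, hR⟩ := hc.isCompact.isBounded.subset_closedBall 0
    refine ⟨max R 1, by positivity, fun w hw => ?_⟩
    have hw' : w ∉ tsupport ψ := fun h => by
      have := hR h
      simp at this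
      linarith [le_max_left R 1]
    exact ⟨by
      by_contra h
      exact hw' (support_fderiv_subset ℝ h), image_eq_zero_of_notMem_tsupport hw'⟩
  obtain ⟨hR0, hR⟩ := hR
  rw [← Complex.integral_comp_polarCoord_symm]
  let f1 : ℝ × ℝ → E := fun p => fderiv ℝ ψ (p.1 * ee p.2) (ee p.2)
  let f2 : ℝ × ℝ → E := fun p => fderiv ℝ ψ (p.1 * ee p.2) (I * ee p.2)
  have hec := ee_cont
  have c1 : Continuous f1 := by
    refine (hcd.comp ?_).clm_apply ?_ <;> fun_prop
  have c2 : Continuous f2 := by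
    refine (hcd.comp ?_).clm_apply ?_ <;> fun_prop
  have key : ∀ f : ℝ × ℝ → E, Continuous f → (∀ p : ℝ × ℝ, R < p.1 → f p = 0) →
      IntegrableOn f (Ioi (0:ℝ) ×ˢ Ioo (-π) π) := by
    intro f hf h0
    have h1 : IntegrableOn f (Icc (0:ℝ) R ×ˢ Icc (-π) π) :=
      hf.continuousOn.integrableOn_compact (isCompact_Icc.prod isCompact_Icc)
    refine h1.of_forall_sdiff_eq_zero (measurableSet_Ioi.prod measurableSet_Ioo) ?_
    rintro ⟨r, θ⟩ ⟨⟨h1, h2⟩, h3⟩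
    apply h0
    by_contra h
    exact h3 ⟨⟨le_of_lt h1, not_lt.1 h⟩, ⟨h2.1.le, h2.2.le⟩⟩
  have z1 : ∀ p : ℝ × ℝ, R < p.1 → f1 p = 0 := by
    intro p hp
    have : fderiv ℝ ψ (p.1 * ee p.2) = 0 := (hR _ (by
      rw [norm_mul, ee_norm]; simpa using lt_of_lt_of_le hp (le_abs_self _))).1
    simp [f1, this]
  have z2 : ∀ p : ℝ × ℝ, R < p.1 → f2 p = 0 := by
    intro p hp
    have : fderiv ℝ ψ (p.1 * ee p.2) = 0 := (hR _ (by
      rw [norm_mul, ee_norm]; simpa using lt_of_lt_of_le hp (le_abs_self _))).1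
    simp [f2, this]
  have i1 := key f1 c1 z1
  have i2 := key f2 c2 z2
  have hEq : ∫ p in polarCoord.target, p.1 • ((Complex.polarCoord.symm p)⁻¹ •
      dbar ψ (Complex.polarCoord.symm p)) =
      ∫ p in Ioi (0:ℝ) ×ˢ Ioo (-π) π, ((1/2:ℂ) • f1 p + (I/2) • f2 p) := by
    refine setIntegral_congr_fun (measurableSet_Ioi.prod measurableSet_Ioo) ?_
    rintro ⟨r, θ⟩ ⟨h1, -⟩
    simp only [mem_Ioi] at h1
    have hr : (r : ℂ) ≠ 0 := by exact_mod_cast h1.ne'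
    have he : ee θ ≠ 0 := by
      intro h
      have := ee_norm θ
      simp [h] at this
    have hps : Complex.polarCoord.symm (r, θ) = r * ee θ := by simp [ee]
    simp only [hps, f1, f2, dbar]
    set D := fderiv ℝ ψ (r * ee θ)
    have e1 : D (ee θ) = (Real.cos θ : ℂ) • D 1 + (Real.sin θ : ℂ) • D I := by
      have : ee θ = (Real.cos θ) • (1:ℂ) + (Real.sin θ) • I := by simp [ee]
      rw [this, map_add, map_smul, map_smul]
      simp only [← Complex.coe_smul]
    have e2 : D (I * ee θ) = (-Real.sin θ : ℂ) • D 1 + (Real.cos θ : ℂ) • D I := by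
      have : I * ee θ = (-Real.sin θ) • (1:ℂ) + (Real.cos θ) • I := by
        simp [ee]
        linear_combination (Complex.sin θ) * I_mul_I
      rw [this, map_add, map_smul, map_smul]
      simp only [← Complex.coe_smul, ofReal_neg]
    have einv : (ee θ)⁻¹ = Real.cos θ - Real.sin θ * I := by
      refine inv_eq_of_mul_eq_one_right ?_
      unfold ee
      have := Complex.sin_sq_add_cos_sq θ
      push_cast
      linear_combination this - (Complex.sin θ)^2 * I_mul_I
    rw [e1, e2, ← Complex.coe_smul, smul_smul, mul_inv, ← mul_assoc, mul_inv_cancel₀ hr, one_mul,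
      einv]
    generalize ((Real.sin θ : ℝ) : ℂ) = sn
    generalize ((Real.cos θ : ℝ) : ℂ) = cs
    match_scalars
    · ring
    · linear_combination (-(1/2) * sn) * I_mul_I
  have hadd : ∫ p in Ioi (0:ℝ) ×ˢ Ioo (-π) π, ((1/2:ℂ) • f1 p + (I/2) • f2 p) =
      (1/2:ℂ) • (∫ p in Ioi (0:ℝ) ×ˢ Ioo (-π) π, f1 p) +
      (I/2) • ∫ p in Ioi (0:ℝ) ×ˢ Ioo (-π) π, f2 p := by
    rw [← integral_smul, ← integral_smul]
    exact integral_add (i1.smul (1/2:ℂ)) (i2.smul (I/2))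
  rw [hEq, hadd]
  have I2 : ∫ p in Ioi (0:ℝ) ×ˢ Ioo (-π) π, f2 p = 0 := by
    rw [Measure.volume_eq_prod, setIntegral_prod _ i2]
    apply setIntegral_eq_zero_of_forall_eq_zero
    intro r hr
    simp only [mem_Ioi] at hr
    have h1 : ∀ θ ∈ uIcc (-π) π, HasDerivAt (fun θ : ℝ => r⁻¹ • ψ (r * ee θ)) (f2 (r, θ)) θ := by
      intro θ _
      have h1 : HasDerivAt (fun θ : ℝ => (r : ℂ) * ee θ) (r * (I * ee θ)) θ :=
        (ee_deriv θ).const_mul _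
      have h2 := ((hdiff (r * ee θ)).hasFDerivAt.comp_hasDerivAt θ h1).const_smul r⁻¹
      refine h2.congr_deriv ?_
      have : (r : ℂ) * (I * ee θ) = r • (I * ee θ) := by simp
      rw [this, map_smul, smul_smul, inv_mul_cancel₀ hr.ne', one_smul]
    have h2 := intervalIntegral.integral_eq_sub_of_hasDerivAt h1
      ((c2.comp (by fun_prop : Continuous fun θ : ℝ => (r, θ))).intervalIntegrable _ _)
    rw [intervalIntegral.integral_of_le (by linarith [Real.pi_pos]), integral_Ioc_eq_integral_Ioo]
      at h2
    rw [h2]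
    simp [ee]
  have I1 : ∫ p in Ioi (0:ℝ) ×ˢ Ioo (-π) π, f1 p = (-2 * π : ℂ) • ψ 0 := by
    have i1' : Integrable f1 ((volume.restrict (Ioi (0:ℝ))).prod
        (volume.restrict (Ioo (-π) π))) := by
      rw [Measure.prod_restrict]; exact i1
    rw [Measure.volume_eq_prod, ← Measure.prod_restrict, integral_prod_symm _ i1']
    have : ∀ θ : ℝ, ∫ r in Ioi (0:ℝ), f1 (r, θ) = - ψ 0 := by
      intro θ
      have hd : ∀ r ∈ Ici (0:ℝ), HasDerivAt (fun r : ℝ => ψ (r * ee θ)) (f1 (r, θ)) r := by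
        intro r _
        have h1 : HasDerivAt (fun r : ℝ => (r : ℂ) * ee θ) (ee θ) r := by
          simpa using (Complex.ofRealCLM.hasDerivAt (x := r)).mul_const (ee θ)
        exact (hdiff (r * ee θ)).hasFDerivAt.comp_hasDerivAt r h1
      have hint : IntegrableOn (fun r => f1 (r, θ)) (Ioi 0) := by
        have h1 : IntegrableOn (fun r => f1 (r, θ)) (Icc (0:ℝ) R) :=
          (c1.comp (by fun_prop : Continuous fun r : ℝ => (r, θ))).continuousOn.integrableOn_compact
            isCompact_Icc
        refine h1.of_forall_sdiff_eq_zero measurableSet_Ioi ?_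
        rintro r ⟨h1, h3⟩
        apply z1
        by_contra h
        exact h3 ⟨le_of_lt h1, not_lt.1 h⟩
      have ht : Tendsto (fun r : ℝ => ψ (r * ee θ)) atTop (𝓝 0) := by
        refine tendsto_const_nhds.congr' ?_
        filter_upwards [eventually_gt_atTop R] with r hr
        refine ((hR _ ?_).2).symm
        rw [norm_mul, ee_norm]; simpa using lt_of_lt_of_le hr (le_abs_self _)
      have := integral_Ioi_of_hasDerivAt_of_tendsto' hd hint ht
      simpa using this
    simp only [this]
    have hp := Real.pi_pos
    rw [integral_const]
    simp only [measureReal_restrict_apply_univ, Real.volume_real_Ioo_of_le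
      (by linarith : -π ≤ π)]
    rw [← Complex.coe_smul]
    push_cast
    module
  rw [I1, I2]
  module

lemma pomp {ψ : ℂ → E} (hψ : ContDiff ℝ 1 ψ) (hc : HasCompactSupport ψ) (z : ℂ) :
    ∫ w, (z - w)⁻¹ • dbar ψ w = (π : ℂ) • ψ z := by
  have h1 : ContDiff ℝ 1 (fun w => ψ (w + z)) := hψ.comp (contDiff_id.add contDiff_const)
  have h2 : HasCompactSupport (fun w => ψ (w + z)) :=
    hc.comp_homeomorph (Homeomorph.addRight z)
  have h3 := pomp0 h1 h2
  have h4 : ∀ w, dbar (fun w => ψ (w + z)) w = dbar ψ (w + z) := by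
    intro w
    simp only [dbar]
    rw [fderiv_comp_add_right]
  simp only [h4, zero_add] at h3
  rw [← integral_add_right_eq_self _ z]
  have h5 : ∀ w : ℂ, (z - (w + z))⁻¹ • dbar ψ (w + z) = - (w⁻¹ • dbar ψ (w + z)) := by
    intro w
    rw [← neg_smul, ← inv_neg]
    congr 2
    ring
  simp only [h5, integral_neg, h3]
  module

end Pompeiu
end CD

set_option linter.unusedSectionVars false

namespace CD
section Stokes
open Set Topology Complex

variable {E : Type*} [NormedAddCommGroup E] [NormedSpace ℂ E] [CompleteSpace E]

lemma inv_norm_int : IntegrableOn (fun w : ℂ => ‖w‖⁻¹) (Metric.ball 0 1) := by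
  have := (integrableOn_fun_norm_addHaar (volume : Measure ℂ) (f := fun y : ℝ => y⁻¹) (r := 1)).2
  apply this
  have h : IntegrableOn (fun _ : ℝ => (1:ℝ)) (Ioo 0 1) := by simp
  refine h.congr_fun ?_ measurableSet_Ioo
  intro y hy
  have : y ≠ 0 := hy.1.ne'
  simp [this]

lemma ker_int {φ : ℂ → E} (hφ : Continuous φ) (hc : HasCompactSupport φ) :
    ∃ C : ℝ, 0 ≤ C ∧ ∀ z : ℂ, Integrable (fun w => (z - w)⁻¹ • φ w) ∧
      ∫ w, ‖(z - w)⁻¹ • φ w‖ ≤ C := by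
  obtain ⟨M, hM⟩ := hc.exists_bound_of_continuous hφ
  have hM0 : 0 ≤ M := (norm_nonneg _).trans (hM 0)
  let k : ℂ → ℝ := (Metric.ball 0 1).indicator (fun w : ℂ => ‖w‖⁻¹)
  have hk : Integrable k := inv_norm_int.integrable_indicator measurableSet_ball
  have hφi : Integrable φ := hφ.integrable_of_hasCompactSupport hc
  have hb : ∀ z w : ℂ, ‖(z - w)⁻¹ • φ w‖ ≤ M * k (z - w) + ‖φ w‖ := by
    intro z w
    rw [norm_smul, norm_inv]
    by_cases h : z - w ∈ Metric.ball (0:ℂ) 1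
    · simp only [k, indicator_of_mem h]
      have := mul_le_mul_of_nonneg_left (hM w) (by positivity : 0 ≤ ‖z - w‖⁻¹)
      nlinarith [norm_nonneg (φ w)]
    · simp only [k, indicator_of_notMem h]
      have h1 : 1 ≤ ‖z - w‖ := by simpa using h
      have : ‖z - w‖⁻¹ ≤ 1 := inv_le_one_of_one_le₀ h1
      nlinarith [norm_nonneg (φ w)]
  have hi : ∀ z : ℂ, Integrable (fun w => M * k (z - w) + ‖φ w‖) := fun z =>
    ((hk.comp_sub_left z).const_mul M).add hφi.norm
  refine ⟨M * (∫ w, k w) + ∫ w, ‖φ w‖, ?_, fun z => ?_⟩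
  · have : 0 ≤ ∫ w, k w := integral_nonneg fun w => indicator_nonneg (fun _ _ => by positivity) _
    have : 0 ≤ ∫ w, ‖φ w‖ := integral_nonneg fun w => by positivity
    positivity
  have h1 : Integrable (fun w => (z - w)⁻¹ • φ w) := by
    refine (hi z).mono' ?_ (Eventually.of_forall (hb z))
    refine AEStronglyMeasurable.smul ?_ hφ.aestronglyMeasurable
    exact (Measurable.inv (by fun_prop)).aestronglyMeasurable
  refine ⟨h1, ?_⟩
  refine (integral_mono h1.norm (hi z) (hb z)).trans ?_
  have := integral_add ((hk.comp_sub_left z).const_mul M) hφi.norm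
  rw [this, integral_const_mul, integral_sub_left_eq_self k]

/-- Cauchy transform -/
noncomputable def cau (ν : Measure ℝ) (z g : ℝ → ℂ) (w : ℂ) : ℂ := ∫ u, g u / (z u - w) ∂ν

lemma stokes (ν : Measure ℝ) [SFinite ν] {z g : ℝ → ℂ} (hz : Measurable z) (hg : Integrable g ν)
    {ψ : ℂ → E} (hψ : ContDiff ℝ 1 ψ) (hc : HasCompactSupport ψ) :
    (π : ℂ) • ∫ u, g u • ψ (z u) ∂ν = ∫ w, cau ν z g w • dbar ψ w := by
  have hd := dbar_cont hψ
  have hdc := dbar_supp hc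
  obtain ⟨C, hC0, hC⟩ := ker_int hd hdc
  let f : ℝ × ℂ → E := fun p => g p.1 • ((z p.1 - p.2)⁻¹ • dbar ψ p.2)
  have hf : AEStronglyMeasurable f (ν.prod volume) := by
    refine AEStronglyMeasurable.smul hg.aestronglyMeasurable.comp_fst ?_
    refine AEStronglyMeasurable.smul ?_ (hd.comp continuous_snd).aestronglyMeasurable
    exact (Measurable.inv (by fun_prop)).aestronglyMeasurable
  have hint : Integrable f (ν.prod volume) := by
    rw [integrable_prod_iff hf]
    refine ⟨Eventually.of_forall fun u => ((hC (z u)).1).smul (g u), ?_⟩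
    refine (hg.norm.mul_const C).mono' hf.norm.integral_prod_right' ?_
    refine Eventually.of_forall fun u => ?_
    simp only [f, norm_smul (g u), integral_const_mul]
    rw [Real.norm_of_nonneg (mul_nonneg (norm_nonneg _)
      (integral_nonneg fun _ => norm_nonneg _))]
    exact mul_le_mul_of_nonneg_left (hC (z u)).2 (norm_nonneg _)
  have h1 : ∫ u, (∫ w, f (u, w)) ∂ν = (π : ℂ) • ∫ u, g u • ψ (z u) ∂ν := by
    rw [← integral_smul]
    congr 1
    ext u
    simp only [f, integral_smul, pomp hψ hc]
    rw [smul_comm]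
  rw [← h1, integral_integral_swap hint]
  congr 1
  ext w
  simp only [f, smul_smul, cau]
  rw [← integral_smul_const]
  rfl
end Stokes
end CD

set_option linter.unusedSectionVars false

namespace CD
section Curves
open Set Topology Complex

variable {E : Type*} [NormedAddCommGroup E] [NormedSpace ℂ E] [CompleteSpace E]

noncomputable abbrev nuI : Measure ℝ := volume.restrict (Ioc (0:ℝ) 1)

structure LJ (z : ℝ → ℂ) : Prop where
  lip : ∃ K, LipschitzWith K z
  closed : z 0 = z 1
  inj : InjOn z (Ico 0 1)
  clamp : ∀ u, z u ∈ z '' Icc 0 1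

lemma LJ.cont {z : ℝ → ℂ} (h : LJ z) : Continuous z := h.lip.choose_spec.continuous

lemma LJ.compact {z : ℝ → ℂ} (h : LJ z) : IsCompact (z '' Icc 0 1) :=
  isCompact_Icc.image h.cont

lemma LJ.area {z : ℝ → ℂ} (h : LJ z) : volume (z '' Icc (0:ℝ) 1) = 0 := by
  obtain ⟨K, hK⟩ := h.lip
  have h1 : dimH (z '' Icc (0:ℝ) 1) ≤ 1 := by
    refine (hK.dimH_image_le _).trans ?_
    refine (dimH_mono (subset_univ _)).trans ?_
    rw [Real.dimH_univ]
  have h2 : Measure.hausdorffMeasure 2 (z '' Icc (0:ℝ) 1) = 0 := by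
    have := hausdorffMeasure_of_dimH_lt (d := 2) (lt_of_le_of_lt h1 (by norm_num))
    simpa using this
  have h3 : (Measure.hausdorffMeasure (Module.finrank ℝ ℂ) : Measure ℂ) (z '' Icc (0:ℝ) 1) = 0 := by
    simpa using h2
  exact (Measure.absolutelyContinuous_isAddHaarMeasure volume
    (Measure.hausdorffMeasure (Module.finrank ℝ ℂ) : Measure ℂ)) h3

lemma ftc {f : ℝ → ℂ} {K : NNReal} (hf : LipschitzWith K f) (a b : ℝ) :
    ∫ t in a..b, deriv f t = f b - f a := by
  have hre : LipschitzWith (1 * K) (fun t => (f t).re) :=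
    (LipschitzWith.mk_one fun x y => by
      rw [Real.dist_eq, dist_eq_norm, ← sub_re]; exact abs_re_le_norm _).comp hf
  have him : LipschitzWith (1 * K) (fun t => (f t).im) :=
    (LipschitzWith.mk_one fun x y => by
      rw [Real.dist_eq, dist_eq_norm, ← sub_im]; exact abs_im_le_norm _).comp hf
  have h1 := (hre.lipschitzOnWith (s := uIcc a b)).absolutelyContinuousOnInterval.integral_deriv_eq_sub
  have h2 := (him.lipschitzOnWith (s := uIcc a b)).absolutelyContinuousOnInterval.integral_deriv_eq_sub
  have hint : IntervalIntegrable (deriv f) volume a b := by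
    refine (intervalIntegrable_const (c := (K:ℝ))).mono_fun
      (measurable_deriv f).aestronglyMeasurable ?_
    refine Eventually.of_forall fun t => ?_
    simpa using norm_deriv_le_of_lipschitz hf
  have hd := hf.ae_differentiableAt_real
  apply Complex.ext
  · have : (∫ t in a..b, deriv f t).re = ∫ t in a..b, (deriv f t).re :=
      (Complex.reCLM.intervalIntegral_comp_comm hint).symm
    rw [this, sub_re, ← h1]
    refine intervalIntegral.integral_congr_ae ?_
    filter_upwards [hd] with t ht _
    exact ((Complex.reCLM.hasFDerivAt.comp_hasDerivAt t ht.hasDerivAt).deriv).symm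
  · have : (∫ t in a..b, deriv f t).im = ∫ t in a..b, (deriv f t).im :=
      (Complex.imCLM.intervalIntegral_comp_comm hint).symm
    rw [this, sub_im, ← h2]
    refine intervalIntegral.integral_congr_ae ?_
    filter_upwards [hd] with t ht _
    exact ((Complex.imCLM.hasFDerivAt.comp_hasDerivAt t ht.hasDerivAt).deriv).symm

lemma uniq {z g : ℝ → ℂ} (h : LJ z) (hg : Integrable g nuI)
    (hz : ∀ᵐ w, cau nuI z g w = 0) : g =ᵐ[nuI] 0 := by
  have hψ0 : ∀ ψ : ℂ → ℂ, ContDiff ℝ 1 ψ → HasCompactSupport ψ → ∫ u, g u * ψ (z u) ∂nuI = 0 := by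
    intro ψ h1 h2
    have := stokes nuI h.cont.measurable hg h1 h2
    have h0 : ∫ w, cau nuI z g w • dbar ψ w = 0 := by
      apply integral_eq_zero_of_ae
      filter_upwards [hz] with w hw
      simp [hw]
    rw [h0, smul_eq_zero] at this
    exact this.resolve_left (by exact_mod_cast Real.pi_ne_zero)
  apply ae_eq_zero_of_forall_setIntegral_isCompact_eq_zero hg
  intro C hC
  have hCK : IsClosed (z '' (C ∩ Icc 0 1)) := ((hC.inter_right isClosed_Icc).image h.cont).isClosed
  obtain ⟨f, hfs, hfd, hfr⟩ := hCK.isOpen_compl.exists_contDiff_support_eq (n := 1)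
  have hfr' : ∀ w, f w ∈ Icc (0:ℝ) 1 := fun w => hfr (mem_range_self w)
  obtain ⟨R, hR⟩ := h.compact.isBounded.subset_closedBall (0:ℂ)
  let χ : ContDiffBump (0:ℂ) := ⟨max R 1, max R 1 + 1, by positivity, by linarith⟩
  have hχ : ∀ u, χ (z u) = 1 := by
    intro u
    apply χ.one_of_mem_closedBall
    exact Metric.closedBall_subset_closedBall (le_max_left _ _) (hR (h.clamp u))
  have hlim : Tendsto (fun n : ℕ => ∫ u, g u * (((1 - f (z u)) ^ n * χ (z u) : ℝ) : ℂ) ∂nuI) atTop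
      (𝓝 (∫ u, C.indicator g u ∂nuI)) := by
    refine tendsto_integral_of_dominated_convergence (fun u => ‖g u‖) ?_ hg.norm ?_ ?_
    · intro n
      refine hg.aestronglyMeasurable.mul (Continuous.aestronglyMeasurable ?_)
      refine continuous_ofReal.comp ?_
      exact ((continuous_const.sub (hfd.continuous.comp h.cont)).pow n).mul
        (χ.continuous.comp h.cont)
    · intro n
      refine Eventually.of_forall fun u => ?_
      rw [norm_mul, hχ, mul_one, norm_real, norm_pow, Real.norm_eq_abs]
      have h1 := hfr' (z u)
      have : |1 - f (z u)| ≤ 1 := by rw [abs_le]; constructor <;> linarith [h1.1, h1.2]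
      exact mul_le_of_le_one_right (norm_nonneg _) (pow_le_one₀ (abs_nonneg _) this)
    · have : ∀ᵐ u ∂nuI, u ≠ 1 := by
        apply ae_restrict_of_ae
        simp [ae_iff]
      filter_upwards [this, ae_restrict_mem measurableSet_Ioc] with u hu1 hu
      have h1 := hfr' (z u)
      by_cases huC : u ∈ C
      · have : f (z u) = 0 := by
          by_contra hne
          have : z u ∈ (z '' (C ∩ Icc 0 1))ᶜ := hfs ▸ (Function.mem_support.2 hne)
          exact this ⟨u, ⟨huC, hu.1.le, hu.2⟩, rfl⟩
        simp [this, hχ, huC]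
      · have : f (z u) ≠ 0 := by
          rw [← Function.mem_support, hfs]
          rintro ⟨c, ⟨hc, hc0, hc1⟩, hcu⟩
          have hus : u ∈ Ico (0:ℝ) 1 := ⟨hu.1.le, lt_of_le_of_ne hu.2 hu1⟩
          rcases hc1.lt_or_eq with hlt | heq
          · exact huC (h.inj ⟨hc0, hlt⟩ hus hcu ▸ hc)
          · have := h.inj ⟨le_refl _, by norm_num⟩ hus (by rw [h.closed, ← heq, hcu] : z 0 = z u)
            exact hu.1.ne this
        have hpos : 0 < f (z u) := lt_of_le_of_ne h1.1 this.symm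
        have := tendsto_pow_atTop_nhds_zero_of_lt_one (by linarith [h1.2] : 0 ≤ 1 - f (z u))
          (by linarith)
        rw [indicator_of_notMem huC]
        have h2 : Tendsto (fun n : ℕ => g u * (((1 - f (z u)) ^ n : ℝ) : ℂ)) atTop
            (𝓝 (g u * ((0 : ℝ) : ℂ))) :=
          ((continuous_ofReal.tendsto 0).comp this).const_mul (g u)
        simpa [hχ] using h2
  have hzero : ∀ n : ℕ, ∫ u, g u * (((1 - f (z u)) ^ n * χ (z u) : ℝ) : ℂ) ∂nuI = 0 := by
    intro n
    refine hψ0 (fun w => (((1 - f w) ^ n * χ w : ℝ) : ℂ)) ?_ ?_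
    · refine Complex.ofRealCLM.contDiff.comp ?_
      exact ((contDiff_const.sub hfd).pow n).mul χ.contDiff
    · refine χ.hasCompactSupport.mono ?_
      intro w hw hw0
      simp [hw0] at hw
  simp only [hzero] at hlim
  rw [integral_indicator hC.measurableSet] at hlim
  exact (tendsto_nhds_unique hlim tendsto_const_nhds)

lemma cau_deriv {ν : Measure ℝ} {z g : ℝ → ℂ} {K : Set ℂ} (hK : IsClosed K) (hz : Measurable z)
    (hzK : ∀ u, z u ∈ K) (hg : Integrable g ν) {w : ℂ} (hw : w ∉ K) :
    HasDerivAt (cau ν z g) (∫ u, g u / (z u - w) ^ 2 ∂ν) w := by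
  obtain ⟨ε, hε, hb⟩ := Metric.isOpen_iff.1 hK.isOpen_compl w hw
  have hε2 : 0 < ε / 2 := by positivity
  have hlow : ∀ u, ∀ x ∈ Metric.ball w (ε/2), ε / 2 ≤ ‖z u - x‖ := by
    intro u x hx
    by_contra hlt
    push Not at hlt
    have : z u ∈ Metric.ball w ε := by
      rw [Metric.mem_ball, dist_eq_norm] at hx ⊢
      calc ‖z u - w‖ = ‖(z u - x) + (x - w)‖ := by ring_nf
        _ ≤ _ := norm_add_le _ _
        _ < ε := by linarith
    exact hb this (hzK u)
  have hne : ∀ u, ∀ x ∈ Metric.ball w (ε/2), z u - x ≠ 0 := fun u x hx h0 => by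
    have := hlow u x hx
    rw [h0, norm_zero] at this
    linarith
  have hwb : w ∈ Metric.ball w (ε/2) := Metric.mem_ball_self hε2
  have hmeas : ∀ (x : ℂ) (n : ℕ), AEStronglyMeasurable (fun u => g u / (z u - x) ^ n) ν := by
    intro x n
    simp only [div_eq_mul_inv]
    exact hg.aestronglyMeasurable.mul (Measurable.aestronglyMeasurable (by fun_prop))
  refine (hasDerivAt_integral_of_dominated_loc_of_deriv_le (F := fun x u => g u / (z u - x))
    (F' := fun x u => g u / (z u - x) ^ 2) (bound := fun u => ‖g u‖ * (4 / ε ^ 2))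
    (Metric.ball_mem_nhds w hε2) ?_ ?_ ?_ ?_ ?_ ?_).2
  · exact Eventually.of_forall fun x => by simpa using hmeas x 1
  · refine (hg.norm.mul_const (2/ε)).mono' (by simpa using hmeas w 1) ?_
    refine Eventually.of_forall fun u => ?_
    rw [norm_div, div_eq_mul_inv]
    gcongr
    rw [inv_le_comm₀ (lt_of_lt_of_le hε2 (hlow u w hwb)) (by positivity)]
    simpa using hlow u w hwb
  · exact hmeas w 2
  · refine Eventually.of_forall fun u x hx => ?_
    rw [norm_div, norm_pow, div_eq_mul_inv]
    gcongr
    have := hlow u x hx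
    have hpos : 0 < ‖z u - x‖ := hε2.trans_le this
    rw [inv_le_comm₀ (by positivity) (by positivity)]
    calc (4 / ε ^ 2)⁻¹ = (ε/2)^2 := by field_simp; norm_num
      _ ≤ _ := by gcongr
  · exact hg.norm.mul_const _
  · refine Eventually.of_forall fun u x hx => ?_
    have h1 : HasDerivAt (fun x => z u - x) (-1) x := (hasDerivAt_id x).const_sub _
    have h2 := (h1.inv (hne u x hx)).const_mul (g u)
    refine h2.congr_deriv ?_
    ring

end Curves
end CD

set_option linter.unusedSectionVars false

namespace CD
section Winding
open Set Topology Complex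

lemma int_const {X : Type*} [TopologicalSpace X] {S : Set X} (hS : IsPreconnected S) {f : X → ℂ}
    (hf : ContinuousOn f S) (hn : ∀ x ∈ S, ∃ n : ℤ, f x = n) {x y : X} (hx : x ∈ S) (hy : y ∈ S) :
    f x = f y := by
  have hg : ContinuousOn (fun x => (f x).re) S := continuous_re.comp_continuousOn hf
  have hd : IsDiscrete (range (Int.cast : ℤ → ℝ)) := by
    rw [isDiscrete_iff_discreteTopology]
    exact Int.isClosedEmbedding_coe_real.isEmbedding.toHomeomorph.symm.isEmbedding.discreteTopology
  have := hS.constant_of_mapsTo hd hg (fun x hx => by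
    obtain ⟨n, h⟩ := hn x hx
    exact ⟨n, by simp [h]⟩) hx hy
  obtain ⟨n, h1⟩ := hn x hx
  obtain ⟨m, h2⟩ := hn y hy
  simp only [h1, h2, intCast_re] at this
  rw [h1, h2]
  exact_mod_cast this

lemma lip_const {f : ℝ → ℂ} {K : NNReal} {a b : ℝ} (hf : LipschitzOnWith K f (uIcc a b))
    (hd : ∀ᵐ x, x ∈ uIcc a b → HasDerivAt f 0 x) : f b = f a := by
  have hre : LipschitzOnWith (1 * K) (fun t => (f t).re) (uIcc a b) :=
    (LipschitzWith.mk_one fun x y => by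
      rw [Real.dist_eq, dist_eq_norm, ← sub_re]; exact abs_re_le_norm _).comp_lipschitzOnWith hf
  have him : LipschitzOnWith (1 * K) (fun t => (f t).im) (uIcc a b) :=
    (LipschitzWith.mk_one fun x y => by
      rw [Real.dist_eq, dist_eq_norm, ← sub_im]; exact abs_im_le_norm _).comp_lipschitzOnWith hf
  have h1 := hre.absolutelyContinuousOnInterval.integral_deriv_eq_sub
  have h2 := him.absolutelyContinuousOnInterval.integral_deriv_eq_sub
  have e1 : ∫ x in a..b, deriv (fun t => (f t).re) x = 0 := by
    apply intervalIntegral.integral_zero_ae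
    filter_upwards [hd] with x hx hx2
    exact (Complex.reCLM.hasFDerivAt.comp_hasDerivAt x (hx (uIoc_subset_uIcc hx2))).deriv
  have e2 : ∫ x in a..b, deriv (fun t => (f t).im) x = 0 := by
    apply intervalIntegral.integral_zero_ae
    filter_upwards [hd] with x hx hx2
    exact (Complex.imCLM.hasFDerivAt.comp_hasDerivAt x (hx (uIoc_subset_uIcc hx2))).deriv
  apply Complex.ext <;> linarith

/-- log along the curve -/
noncomputable def lam (z : ℝ → ℂ) (w : ℂ) (t : ℝ) : ℂ := ∫ u in (0:ℝ)..t, deriv z u / (z u - w)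

lemma LJ.low {z : ℝ → ℂ} (h : LJ z) {w : ℂ} (hw : w ∉ z '' Icc 0 1) :
    ∃ δ > 0, ∀ u, δ ≤ ‖z u - w‖ := by
  obtain ⟨ε, hε, hb⟩ := Metric.isOpen_iff.1 h.compact.isClosed.isOpen_compl w hw
  refine ⟨ε, hε, fun u => ?_⟩
  by_contra hlt
  push Not at hlt
  exact hb (by rwa [Metric.mem_ball, dist_eq_norm]) (h.clamp u)

lemma LJ.ne {z : ℝ → ℂ} (h : LJ z) {w : ℂ} (hw : w ∉ z '' Icc 0 1) (u : ℝ) : z u - w ≠ 0 := by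
  intro h0
  rw [sub_eq_zero] at h0
  exact hw (h0 ▸ h.clamp u)

lemma LJ.kbd {z : ℝ → ℂ} (h : LJ z) {w : ℂ} (hw : w ∉ z '' Icc 0 1) :
    ∃ C : NNReal, ∀ u, ‖deriv z u / (z u - w)‖ ≤ C := by
  obtain ⟨K, hK⟩ := h.lip
  obtain ⟨δ, hδ, hl⟩ := h.low hw
  refine ⟨⟨K / δ, by positivity⟩, fun u => ?_⟩
  rw [norm_div]
  exact div_le_div₀ K.2 (norm_deriv_le_of_lipschitz hK) hδ (hl u)

lemma LJ.kmeas {z : ℝ → ℂ} (h : LJ z) (w : ℂ) : Measurable fun u => deriv z u / (z u - w) :=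
  (measurable_deriv z).div (h.cont.measurable.sub_const w)

lemma LJ.kint {z : ℝ → ℂ} (h : LJ z) {w : ℂ} (hw : w ∉ z '' Icc 0 1) (a b : ℝ) :
    IntervalIntegrable (fun u => deriv z u / (z u - w)) volume a b := by
  obtain ⟨C, hC⟩ := h.kbd hw
  refine (intervalIntegrable_const (c := (C:ℝ))).mono_fun (h.kmeas w).aestronglyMeasurable ?_
  refine Eventually.of_forall fun t => ?_
  simpa using hC t

lemma LJ.lam_lip {z : ℝ → ℂ} (h : LJ z) {w : ℂ} (hw : w ∉ z '' Icc 0 1) :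
    ∃ C, LipschitzWith C (lam z w) := by
  obtain ⟨C, hC⟩ := h.kbd hw
  refine ⟨C, LipschitzWith.of_dist_le_mul fun x y => ?_⟩
  rw [dist_comm, dist_eq_norm, lam, lam, intervalIntegral.integral_interval_sub_left
    (h.kint hw _ _) (h.kint hw _ _), dist_comm, Real.dist_eq]
  exact intervalIntegral.norm_integral_le_of_norm_le_const fun u _ => hC u

lemma LJ.lam_exp {z : ℝ → ℂ} (h : LJ z) {w : ℂ} (hw : w ∉ z '' Icc 0 1) {t : ℝ}
    (ht : t ∈ Icc (0:ℝ) 1) : z t - w = (z 0 - w) * exp (lam z w t) := by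
  obtain ⟨K, hK⟩ := h.lip
  obtain ⟨C, hC⟩ := h.lam_lip hw
  obtain ⟨M, hM⟩ := (isCompact_Icc (a := (0:ℝ)) (b := 1)).exists_bound_of_continuousOn
    hC.continuous.continuousOn
  obtain ⟨L, hL⟩ := (Complex.contDiff_exp (𝕜 := ℝ) (n := 1)).contDiffOn.exists_lipschitzOnWith
    (by norm_num) (convex_closedBall (0:ℂ) M) (isCompact_closedBall (0:ℂ) M)
  have hE : LipschitzOnWith (L * C) (fun t => exp (- lam z w t)) (Icc 0 1) :=
    hL.comp (g := exp) (f := fun t => - lam z w t) hC.neg.lipschitzOnWith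
      (fun t ht => by simpa using hM t ht)
  have hac := ((hK.lipschitzOnWith (s := Icc (0:ℝ) 1)).sub
    (LipschitzWith.const w).lipschitzOnWith)
  obtain ⟨B1, hB1⟩ := (isCompact_Icc (a := (0:ℝ)) (b := 1)).exists_bound_of_continuousOn
    hac.continuousOn
  obtain ⟨B2, hB2⟩ := (isCompact_Icc (a := (0:ℝ)) (b := 1)).exists_bound_of_continuousOn
    hE.continuousOn
  have hB10 : 0 ≤ B1 := (norm_nonneg _).trans (hB1 0 (by simp))
  have hB20 : 0 ≤ B2 := (norm_nonneg _).trans (hB2 0 (by simp))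
  lift B1 to NNReal using hB10
  lift B2 to NNReal using hB20
  have hprod : LipschitzOnWith (B1 * (L * C) + B2 * (K + 0))
      (fun t => (z t - w) * exp (- lam z w t)) (Icc 0 1) := by
    refine LipschitzOnWith.of_dist_le_mul fun x hx y hy => ?_
    have h1 := hac.dist_le_mul x hx y hy
    have h2 := hE.dist_le_mul x hx y hy
    have h3 := hB1 x hx
    have h4 := hB2 y hy
    rw [dist_eq_norm] at h1 h2 ⊢
    push_cast at h1 h2 ⊢
    have e : (z x - w) * exp (- lam z w x) - (z y - w) * exp (- lam z w y) =
      (z x - w) * (exp (- lam z w x) - exp (- lam z w y)) +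
        exp (- lam z w y) * ((z x - w) - (z y - w)) := by ring
    rw [e]
    refine (norm_add_le _ _).trans ?_
    rw [norm_mul, norm_mul]
    have a1 := mul_le_mul h3 h2 (norm_nonneg _) B1.2
    have a2 := mul_le_mul h4 h1 (norm_nonneg _) B2.2
    calc _ ≤ _ := add_le_add a1 a2
      _ = _ := by ring
  have hder : ∀ᵐ x, HasDerivAt (fun t => (z t - w) * exp (- lam z w t)) 0 x := by
    have hloc : LocallyIntegrable (fun u => deriv z u / (z u - w)) volume := by
      obtain ⟨C, hC⟩ := h.kbd hw
      refine (locallyIntegrable_const (C:ℝ)).mono (h.kmeas w).aestronglyMeasurable ?_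
      exact Eventually.of_forall fun u => by simpa using hC u
    filter_upwards [hK.ae_differentiableAt_real, LocallyIntegrable.ae_hasDerivAt_integral hloc] with x h1 h2
    have h3 := (h1.hasDerivAt.sub_const w).mul ((h2 0).neg.cexp)
    refine h3.congr_deriv ?_
    have := h.ne hw x
    field_simp
    simp
  have hsub : uIcc 0 t ⊆ Icc (0:ℝ) 1 := by
    rw [uIcc_of_le ht.1]; exact Icc_subset_Icc le_rfl ht.2
  have := lip_const (hprod.mono hsub) (hder.mono fun x hx _ => hx)
  simp only [lam, intervalIntegral.integral_same, neg_zero, exp_zero, mul_one] at this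
  rw [← this, lam, mul_assoc, ← exp_add]
  simp

lemma lam_one (z : ℝ → ℂ) (w : ℂ) : lam z w 1 = cau nuI z (deriv z) w := by
  rw [lam, cau, intervalIntegral.integral_of_le zero_le_one]

/-- winding number -/
noncomputable def wn (z : ℝ → ℂ) (w : ℂ) : ℂ := cau nuI z (deriv z) w / (2 * π * I)

lemma tpi : (2 * π * I : ℂ) ≠ 0 := by
  simp [Real.pi_ne_zero]

lemma LJ.wn_int {z : ℝ → ℂ} (h : LJ z) {w : ℂ} (hw : w ∉ z '' Icc 0 1) : ∃ n : ℤ, wn z w = n := by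
  have h1 := h.lam_exp hw (t := 1) (by simp)
  rw [← h.closed] at h1
  have h2 : exp (lam z w 1) = 1 := by
    have := h.ne hw 0
    field_simp at h1
    exact h1.symm
  rw [lam_one] at h2
  obtain ⟨n, hn⟩ := exp_eq_one_iff.1 h2
  exact ⟨n, by rw [wn, hn]; field_simp [tpi]⟩

lemma LJ.dint {z : ℝ → ℂ} (h : LJ z) : Integrable (deriv z) nuI := by
  obtain ⟨K, hK⟩ := h.lip
  refine (integrable_const (K:ℝ)).mono' (measurable_deriv z).aestronglyMeasurable ?_
  exact Eventually.of_forall fun u => norm_deriv_le_of_lipschitz hK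

lemma LJ.wn_cont {z : ℝ → ℂ} (h : LJ z) : ContinuousOn (wn z) (z '' Icc 0 1)ᶜ := by
  intro w hw
  exact ((cau_deriv h.compact.isClosed h.cont.measurable h.clamp
    h.dint hw).continuousAt.div_const _).continuousWithinAt

lemma LJ.wn_const {z : ℝ → ℂ} (h : LJ z) {S : Set ℂ} (hS : IsPreconnected S)
    (hSK : S ⊆ (z '' Icc 0 1)ᶜ) {x y : ℂ} (hx : x ∈ S) (hy : y ∈ S) : wn z x = wn z y :=
  int_const hS (h.wn_cont.mono hSK) (fun x hx => h.wn_int (hSK hx)) hx hy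

lemma LJ.wn_far {z : ℝ → ℂ} (h : LJ z) : ∃ R : ℝ, ∀ w : ℂ, R ≤ ‖w‖ → wn z w = 0 := by
  obtain ⟨K, hK⟩ := h.lip
  obtain ⟨R, hR⟩ := h.compact.isBounded.subset_closedBall (0:ℂ)
  refine ⟨R + K + 1, fun w hw => ?_⟩
  have hlow : ∀ u, K + 1 ≤ ‖z u - w‖ := by
    intro u
    have h1 : ‖z u‖ ≤ R := by simpa using hR (h.clamp u)
    have h2 := norm_sub_norm_le w (z u)
    rw [norm_sub_rev] at h2
    linarith
  have hK0 : (0:ℝ) ≤ K := K.2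
  have hwK : w ∉ z '' Icc 0 1 := by
    rintro ⟨u, -, rfl⟩
    have := hlow u
    simp at this
    linarith
  obtain ⟨n, hn⟩ := h.wn_int hwK
  have h1 : ‖cau nuI z (deriv z) w‖ ≤ 1 := by
    have : ∀ u, ‖deriv z u / (z u - w)‖ ≤ 1 := by
      intro u
      rw [norm_div]
      have := hlow u
      refine div_le_one_of_le₀ ?_ (norm_nonneg _)
      linarith [norm_deriv_le_of_lipschitz (x₀ := u) hK]
    refine (norm_integral_le_of_norm_le_const (Eventually.of_forall this)).trans ?_
    simp
  have h2 : ‖wn z w‖ < 1 := by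
    rw [wn, norm_div]
    have : ‖(2 * π * I : ℂ)‖ = 2 * π := by simp [abs_of_pos Real.pi_pos]
    rw [this, div_lt_one (by positivity)]
    linarith [Real.pi_gt_three]
  rw [hn] at h2 ⊢
  simp only [norm_intCast] at h2
  have : |n| < 1 := by exact_mod_cast h2
  simp [Int.abs_lt_one_iff.1 this]

lemma clog {X : Type*} [TopologicalSpace X] [LocallyPathConnectedSpace X] [SimplyConnectedSpace X]
    {g : X → ℂ} (hg : Continuous g) (h0 : ∀ x, g x ≠ 0) :
    ∃ f : X → ℂ, Continuous f ∧ ∀ x, exp (f x) = g x := by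
  obtain ⟨f, hf, he⟩ := Complex.exists_continuousOn_eqOn_exp_comp (X := X) (U := univ)
    (by
      have : SimplyConnectedSpace (univ : Set X) :=
        (Homeomorph.Set.univ X).toHomotopyEquiv.simplyConnectedSpace
      exact this) isOpen_univ hg.continuousOn (by
      rintro ⟨x, -, hx⟩; exact h0 x hx)
  exact ⟨f, continuousOn_univ.1 hf, fun x => he (mem_univ x)⟩

lemma jcore {D : Set ℂ} (hD : IsOpen D) (hb : Bornology.IsBounded D) {w : ℂ} (hw : w ∈ D) (k : ℤ)
    {h F : ℂ → ℂ} (hh : ContinuousOn h (closure D)) (h0 : ∀ x ∈ closure D, h x ≠ 0)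
    (hF : Continuous F) (he : ∀ x ∈ frontier D, (x - w) ^ k = exp (F x) * h x) : k = 0 := by
  classical
  let G : ℂ → ℂ := D.piecewise (fun x => exp (F x) * h x) (fun x => (x - w) ^ k)
  have hne : ∀ x ∉ D, x - w ≠ 0 := fun x hx h => hx (by rw [sub_eq_zero] at h; rwa [h])
  have hG : Continuous G := by
    refine continuous_piecewise (fun x hx => (he x hx).symm) ?_ ?_
    · exact (continuous_exp.comp hF).continuousOn.mul hh
    · rw [hD.isClosed_compl.closure_eq]
      intro x hx
      exact ((continuousAt_id.sub continuousAt_const).zpow₀ k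
        (Or.inl (hne x hx))).continuousWithinAt
  have hG0 : ∀ x, G x ≠ 0 := by
    intro x
    by_cases hx : x ∈ D
    · simp only [G, piecewise_eq_of_mem _ _ _ hx]
      exact mul_ne_zero (exp_ne_zero _) (h0 x (subset_closure hx))
    · simp only [G, piecewise_eq_of_notMem _ _ _ hx]
      exact zpow_ne_zero _ (hne x hx)
  obtain ⟨f, hf, hfe⟩ := clog hG hG0
  obtain ⟨R, hR⟩ := hb.subset_closedBall w
  let r : ℝ := max R 1 + 1
  have hr0 : 0 < r := by positivity
  have hrR : R < r := lt_of_le_of_lt (le_max_left _ _) (lt_add_one _)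
  let p : ℝ → ℂ := fun θ => w + r * exp (θ * I)
  have hpD : ∀ θ, p θ ∉ D := by
    intro θ hθ
    have := hR hθ
    simp only [p, Metric.mem_closedBall, dist_eq_norm, add_sub_cancel_left, norm_mul,
      norm_exp_ofReal_mul_I, mul_one, norm_real, Real.norm_eq_abs, abs_of_pos hr0] at this
    linarith
  let c : ℝ → ℂ := fun θ => (f (p θ) - k * (θ * I) - f (p 0)) / (2 * π * I)
  have hc : Continuous c := by
    have hp : Continuous p := by fun_prop
    have := hf.comp hp
    simp only [c]
    exact ((this.sub (by fun_prop)).sub continuous_const).div_const _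
  have hGp : ∀ θ : ℝ, exp (f (p θ)) = (r : ℂ) ^ k * exp (k * (θ * I)) := by
    intro θ
    rw [hfe, exp_int_mul, ← mul_zpow]
    simp only [G, piecewise_eq_of_notMem _ _ _ (hpD θ), p, add_sub_cancel_left]
  have hci : ∀ θ ∈ univ, ∃ n : ℤ, c θ = n := by
    intro θ _
    have hr1 : (r : ℂ) ^ k ≠ 0 := zpow_ne_zero _ (by exact_mod_cast hr0.ne')
    have : exp (f (p θ) - k * (θ * I) - f (p 0)) = 1 := by
      rw [exp_sub, exp_sub, hGp, hGp]
      have := exp_ne_zero (k * (θ * I))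
      simp only [ofReal_zero, zero_mul, mul_zero, exp_zero, mul_one]
      rw [mul_div_assoc, div_self this, mul_one, div_self hr1]
    obtain ⟨n, hn⟩ := exp_eq_one_iff.1 this
    exact ⟨n, by simp only [c]; rw [hn]; field_simp [tpi]⟩
  have h1 := int_const isPreconnected_univ hc.continuousOn hci (mem_univ (0:ℝ)) (mem_univ (2 * π))
  have hpp : p (2 * π) = p 0 := by simp [p]
  simp only [c, hpp] at h1
  have h2 := (div_left_inj' tpi).1 h1
  have h3 : (k : ℂ) * (2 * π * I) = 0 := by
    push_cast at h2
    linear_combination h2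
  have := (mul_eq_zero.1 h3).resolve_right tpi
  exact_mod_cast this

lemma LJ.descend {z : ℝ → ℂ} (h : LJ z) {L : ℝ → ℂ} (hL : Continuous L) (h01 : L 0 = L 1) :
    ∃ F : ℂ → ℂ, Continuous F ∧ ∀ t ∈ Icc (0:ℝ) 1, F (z t) = L t := by
  let K := z '' Icc (0:ℝ) 1
  let q : Icc (0:ℝ) 1 → K := fun t => ⟨z t, t, t.2, rfl⟩
  have hq : Continuous q := (h.cont.comp continuous_subtype_val).subtype_mk _
  have hqs : Function.Surjective q := by
    rintro ⟨x, t, ht, rfl⟩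
    exact ⟨⟨t, ht⟩, rfl⟩
  have hqq : IsQuotientMap q := hq.isClosedMap.isQuotientMap hq hqs
  have hw : ∀ a b : Icc (0:ℝ) 1, q a = q b → L a = L b := by
    rintro ⟨a, ha⟩ ⟨b, hb⟩ hab
    have hab : z a = z b := congrArg Subtype.val hab
    simp only
    have key : ∀ b ∈ Icc (0:ℝ) 1, z 1 = z b → L 1 = L b := by
      intro b hb h1
      rcases hb.2.lt_or_eq with h2 | h2
      · have := h.inj ⟨le_rfl, zero_lt_one⟩ ⟨hb.1, h2⟩ (h.closed.trans h1)
        rw [← this, h01]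
      · rw [h2]
    rcases ha.2.lt_or_eq with h1 | h1
    · rcases hb.2.lt_or_eq with h2 | h2
      · rw [h.inj ⟨ha.1, h1⟩ ⟨hb.1, h2⟩ hab]
      · subst h2
        exact (key a ha hab.symm).symm
    · subst h1
      exact key b hb hab
  let f : C(K, ℂ) := ⟨fun x => L (hqs x).choose, by
    rw [hqq.continuous_iff]
    have : (fun x => L (hqs x).choose) ∘ q = fun t : Icc (0:ℝ) 1 => L t := by
      ext t
      exact hw _ _ (hqs (q t)).choose_spec
    rw [this]
    exact hL.comp continuous_subtype_val⟩
  obtain ⟨g, hg⟩ := f.exists_extension' h.compact.isClosed.isClosedEmbedding_subtypeVal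
  refine ⟨g, g.continuous, fun t ht => ?_⟩
  have h1 := congrFun hg (q ⟨t, ht⟩)
  simp only [Function.comp] at h1
  rw [show z t = ((q ⟨t, ht⟩ : K) : ℂ) from rfl, h1]
  exact hw _ _ (hqs (q ⟨t, ht⟩)).choose_spec

lemma LJ.lam_zero (z : ℝ → ℂ) (w : ℂ) : lam z w 0 = 0 := by simp [lam]

lemma LJ.wn_ne {z : ℝ → ℂ} (h : LJ z) {D : Set ℂ} (hD : IsOpen D) (hb : Bornology.IsBounded D)
    (hfr : frontier D ⊆ z '' Icc 0 1) {w : ℂ} (hw : w ∈ D) (hwK : w ∉ z '' Icc 0 1) :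
    wn z w ≠ 0 := by
  intro h0
  obtain ⟨C, hC⟩ := h.lam_lip hwK
  have hl1 : lam z w 1 = 0 := by
    rw [lam_one]
    simpa [wn, Real.pi_ne_zero] using h0
  obtain ⟨F, hF, hFe⟩ := h.descend (L := fun t => lam z w t + log (z 0 - w))
    (hC.continuous.add continuous_const) (by rw [hl1, LJ.lam_zero])
  have := jcore hD hb hw 1 (h := fun _ => 1) continuousOn_const (by simp) hF (by
    intro x hx
    obtain ⟨t, ht, rfl⟩ := hfr hx
    rw [hFe t ht, exp_add, exp_log (h.ne hwK 0), zpow_one, mul_one, h.lam_exp hwK ht, mul_comm])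
  exact one_ne_zero this

lemma LJ.no_two {z : ℝ → ℂ} (h : LJ z) {D₁ D₂ : Set ℂ} (hD₁ : IsOpen D₁) (hD₂ : IsOpen D₂)
    (hb₁ : Bornology.IsBounded D₁) (hb₂ : Bornology.IsBounded D₂)
    (hf₁ : frontier D₁ ⊆ z '' Icc 0 1) (hf₂ : frontier D₂ ⊆ z '' Icc 0 1)
    (hk₁ : Disjoint D₁ (z '' Icc 0 1)) (hk₂ : Disjoint D₂ (z '' Icc 0 1))
    (hd : Disjoint D₁ D₂) {w₁ w₂ : ℂ} (hw₁ : w₁ ∈ D₁) (hw₂ : w₂ ∈ D₂) : False := by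
  have k₁ := hk₁.notMem_of_mem_left hw₁
  have k₂ := hk₂.notMem_of_mem_left hw₂
  obtain ⟨n₁, hn₁⟩ := h.wn_int k₁
  obtain ⟨n₂, hn₂⟩ := h.wn_int k₂
  have hne := h.wn_ne hD₂ hb₂ hf₂ hw₂ k₂
  obtain ⟨C₁, hC₁⟩ := h.lam_lip k₁
  obtain ⟨C₂, hC₂⟩ := h.lam_lip k₂
  have hl₁ : lam z w₁ 1 = n₁ * (2 * π * I) := by
    rw [lam_one, ← hn₁, wn, div_mul_cancel₀ _ tpi]
  have hl₂ : lam z w₂ 1 = n₂ * (2 * π * I) := by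
    rw [lam_one, ← hn₂, wn, div_mul_cancel₀ _ tpi]
  obtain ⟨F, hF, hFe⟩ := h.descend (L := fun t => n₂ * (lam z w₁ t + log (z 0 - w₁)) -
      n₁ * (lam z w₂ t + log (z 0 - w₂)))
    (by have := hC₁.continuous; have := hC₂.continuous; fun_prop)
    (by rw [hl₁, hl₂, LJ.lam_zero, LJ.lam_zero]; ring)
  have hcl : ∀ x ∈ closure D₁, x - w₂ ≠ 0 := by
    intro x hx h0
    rw [sub_eq_zero] at h0
    rw [h0] at hx
    exact (hd.closure_left hD₂).notMem_of_mem_left hx hw₂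
  have := jcore hD₁ hb₁ hw₁ n₂ (h := fun x => (x - w₂) ^ n₁) (fun x hx =>
    ((continuousAt_id.sub continuousAt_const).zpow₀ n₁ (Or.inl (hcl x hx))).continuousWithinAt)
    (fun x hx => zpow_ne_zero _ (hcl x hx)) hF (by
    intro x hx
    obtain ⟨t, ht, rfl⟩ := hf₁ hx
    have e₁ : exp (lam z w₁ t + log (z 0 - w₁)) = z t - w₁ := by
      rw [exp_add, exp_log (h.ne k₁ 0), h.lam_exp k₁ ht, mul_comm]
    have e₂ : exp (lam z w₂ t + log (z 0 - w₂)) = z t - w₂ := by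
      rw [exp_add, exp_log (h.ne k₂ 0), h.lam_exp k₂ ht, mul_comm]
    have := zpow_ne_zero n₁ (h.ne k₂ t)
    rw [hFe t ht, exp_sub, exp_int_mul, exp_int_mul, e₁, e₂]
    field_simp)
  rw [hn₂, this] at hne
  simp at hne

end Winding
end CD

set_option linter.unusedSectionVars false

namespace CD
section Q
open Set Topology Complex Polynomial

lemma poly_bd {z : ℝ → ℂ} (hzb : ∃ R, ∀ u, ‖z u‖ ≤ R) (p : ℂ[X]) : ∃ C, ∀ u, ‖p.eval (z u)‖ ≤ C := by
  obtain ⟨R, hR⟩ := hzb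
  obtain ⟨C, hC⟩ := (isCompact_closedBall (0:ℂ) R).exists_bound_of_continuousOn
    p.continuous.continuousOn
  exact ⟨C, fun u => hC _ (by simpa using hR u)⟩

lemma poly_mem {ν : Measure ℝ} [IsFiniteMeasure ν] {z : ℝ → ℂ} (hz : Continuous z)
    (hzb : ∃ R, ∀ u, ‖z u‖ ≤ R) (p : ℂ[X]) : MemLp (fun u => p.eval (z u)) 2 ν := by
  obtain ⟨C, hC⟩ := poly_bd hzb p
  exact MemLp.of_bound (p.continuous.comp hz).aestronglyMeasurable C (Eventually.of_forall hC)

lemma lemQ (ν : Measure ℝ) [IsFiniteMeasure ν] {z : ℝ → ℂ} (hz : Continuous z)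
    (hzb : ∃ R, ∀ u, ‖z u‖ ≤ R) (w : ℂ) :
    (∃ p : ℕ → ℂ[X], (∀ n, (p n).eval w = 0) ∧ ∀ h : ℝ → ℂ, Measurable h → (∃ C, ∀ u, ‖h u‖ ≤ C) →
      Tendsto (fun n => ∫ u, (p n).eval (z u) * h u ∂ν) atTop (𝓝 (∫ u, h u ∂ν))) ∨
    (∃ ρ : ℝ → ℝ, (∀ u, 0 ≤ ρ u) ∧ Integrable ρ ν ∧
      ∀ p : ℂ[X], ∫ u, p.eval (z u) * ρ u ∂ν = p.eval w) := by
  let T : ℂ[X] →ₗ[ℂ] Lp ℂ 2 ν :=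
    { toFun := fun p => (poly_mem hz hzb p).toLp _
      map_add' := fun p q => by
        rw [← MemLp.toLp_add]; congr 1; ext u; simp
      map_smul' := fun c p => by
        rw [RingHom.id_apply, ← MemLp.toLp_const_smul]; congr 1; ext u; simp }
  have hT : ∀ p, T p =ᵐ[ν] fun u => p.eval (z u) := fun p => MemLp.coeFn_toLp (poly_mem hz hzb p)
  let S : Submodule ℂ (Lp ℂ 2 ν) := (LinearMap.ker (Polynomial.leval w)).map T
  have hS : ∀ x, x ∈ S ↔ ∃ p : ℂ[X], p.eval w = 0 ∧ T p = x := by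
    intro x
    simp [S, Submodule.mem_map, Polynomial.leval]
  let M := S.topologicalClosure
  have hMc : IsClosed (M : Set (Lp ℂ 2 ν)) := S.isClosed_topologicalClosure
  have : CompleteSpace M := hMc.completeSpace_coe
  by_cases h1 : T 1 ∈ M
  · left
    have h2 : T 1 ∈ closure (S : Set (Lp ℂ 2 ν)) := h1
    obtain ⟨x, hxS, hx⟩ := mem_closure_iff_seq_limit.1 h2
    choose p hp0 hpx using fun n => (hS (x n)).1 (hxS n)
    refine ⟨p, hp0, fun h hm ⟨C, hC⟩ => ?_⟩
    have hmem : MemLp (fun u => (starRingEnd ℂ) (h u)) 2 ν :=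
      MemLp.of_bound (continuous_conj.measurable.comp hm).aestronglyMeasurable C
        (Eventually.of_forall fun u => by simpa using hC u)
    have e : ∀ p, inner ℂ (hmem.toLp _) (T p) = ∫ u, p.eval (z u) * h u ∂ν := by
      intro p
      rw [L2.inner_def]
      apply integral_congr_ae
      filter_upwards [hT p, hmem.coeFn_toLp] with u h1 h2
      rw [h1, h2]
      simp
    have := ((continuous_const (y := hmem.toLp _)).inner (𝕜 := ℂ) continuous_id).tendsto (T 1) |>.comp hx
    simp only [Function.comp_def, id, ← hpx, e] at this
    simpa using this
  · right
    let k : Lp ℂ 2 ν := T 1 - M.starProjection (T 1)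
    have hPM : M.starProjection (T 1) ∈ M := Submodule.starProjection_apply_mem M (T 1)
    have hk0 : k ≠ 0 := by
      intro h
      rw [sub_eq_zero] at h
      exact h1 (h ▸ hPM)
    have hkM : ∀ x ∈ M, inner ℂ k x = 0 := by
      intro x hx
      have := Submodule.sub_starProjection_mem_orthogonal (K := M) (T 1)
      exact Submodule.inner_left_of_mem_orthogonal hx this
    have hn : 0 < ‖k‖ ^ 2 := by have := norm_pos_iff.2 hk0; positivity
    have hnorm : ∫ u, ‖k u‖ ^ 2 ∂ν = ‖k‖ ^ 2 := by
      have := L2.integral_inner_eq_sq_eLpNorm (𝕜 := ℂ) k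
      have h2 : (inner ℂ k k : ℂ) = ((‖k‖ ^ 2 : ℝ) : ℂ) := by
        rw [inner_self_eq_norm_sq_to_K]; push_cast; rfl
      rw [L2.inner_def] at h2
      have h3 : ∀ u, (inner ℂ (k u) (k u) : ℂ) = ((‖k u‖ ^ 2 : ℝ) : ℂ) := fun u => by
        rw [inner_self_eq_norm_sq_to_K]; push_cast; rfl
      simp only [h3] at h2
      rw [integral_complex_ofReal] at h2
      exact_mod_cast h2
    have hki : Integrable (fun u => ‖k u‖ ^ 2) ν := (Lp.memLp k).integrable_norm_pow (by norm_num)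
    have key : ∀ q : ℂ[X], q.eval w = 0 → ∫ u, q.eval (z u) * ((‖k u‖ ^ 2 : ℝ) : ℂ) ∂ν = 0 := by
      intro q hq
      obtain ⟨C, hC⟩ := poly_bd hzb q
      have hm : MemLp (fun u => (starRingEnd ℂ) (q.eval (z u)) * k u) 2 ν := by
        refine MemLp.of_le_mul (c := C) (Lp.memLp k) ?_ ?_
        · exact ((continuous_conj.comp (q.continuous.comp hz)).aestronglyMeasurable).mul
            (Lp.aestronglyMeasurable k)
        · refine Eventually.of_forall fun u => ?_
          rw [norm_mul, RCLike.norm_conj]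
          exact mul_le_mul_of_nonneg_right (hC u) (norm_nonneg _)
      have hcl : ∀ x ∈ M, inner ℂ (hm.toLp _) (T 1 - x) = 0 := by
        intro x hx
        have hc : IsClosed {x : Lp ℂ 2 ν | inner ℂ (hm.toLp _) (T 1 - x) = 0} :=
          isClosed_eq (continuous_const.inner (continuous_const.sub continuous_id)) continuous_const
        have hsub : (S : Set (Lp ℂ 2 ν)) ⊆ {x : Lp ℂ 2 ν | inner ℂ (hm.toLp _) (T 1 - x) = 0} := by
          intro x hx
          obtain ⟨r, hr, rfl⟩ := (hS x).1 hx
          have h4 : T (q * (1 - r)) ∈ M :=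
            S.le_topologicalClosure ((hS _).2 ⟨q * (1 - r), by simp [hq], rfl⟩)
          have h5 := hkM _ h4
          change inner ℂ _ (T 1 - T r) = 0
          rw [← map_sub]
          rw [← h5, L2.inner_def, L2.inner_def]
          apply integral_congr_ae
          filter_upwards [hT (1 - r), hT (q * (1 - r)), hm.coeFn_toLp] with u h1 h2 h3
          rw [h1, h2, h3]
          simp
          ring
        exact closure_minimal hsub hc hx
      have := hcl _ hPM
      rw [L2.inner_def] at this
      rw [← this]
      apply integral_congr_ae
      filter_upwards [hm.coeFn_toLp] with u h3
      change _ = inner ℂ _ (k u)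
      rw [h3]
      have h6 : ((‖k u‖ ^ 2 : ℝ) : ℂ) = (starRingEnd ℂ) (k u) * k u := by
        rw [conj_mul']; push_cast; rfl
      rw [h6]
      simp
      ring
    refine ⟨fun u => ‖k u‖ ^ 2 / ‖k‖ ^ 2, fun u => by positivity, hki.div_const _, fun p => ?_⟩
    have h7 := key (p - C (p.eval w)) (by simp)
    have hint : Integrable (fun u => p.eval (z u) * ((‖k u‖ ^ 2 : ℝ) : ℂ)) ν := by
      obtain ⟨C, hC⟩ := poly_bd hzb p
      exact hki.ofReal.bdd_mul (c := C) (p.continuous.comp hz).aestronglyMeasurable (Eventually.of_forall hC)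
    simp only [eval_sub, eval_C, sub_mul] at h7
    rw [integral_sub hint (Integrable.const_mul (f := fun u => ((‖k u‖ ^ 2 : ℝ) : ℂ)) hki.ofReal _), integral_const_mul, integral_complex_ofReal, hnorm,
      sub_eq_zero] at h7
    have h8 : ∀ u, p.eval (z u) * ((‖k u‖ ^ 2 / ‖k‖ ^ 2 : ℝ) : ℂ) =
        p.eval (z u) * ((‖k u‖ ^ 2 : ℝ) : ℂ) / ((‖k‖ ^ 2 : ℝ) : ℂ) := by
      intro u; push_cast; ring
    simp only [h8]
    rw [integral_div, h7, mul_div_cancel_right₀]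
    exact_mod_cast hn.ne'

end Q
end CD

set_option linter.unusedSectionVars false

namespace CD
section JA
open Set Topology Complex

lemma LJ.jconn {z : ℝ → ℂ} (h : LJ z) {D : Set ℂ} (hD : IsOpen D) (hb : Bornology.IsBounded D)
    (hfr : frontier D ⊆ z '' Icc 0 1) (hk : Disjoint D (z '' Icc 0 1)) : IsPreconnected D := by
  intro u v hu hv huv ⟨x, hxD, hxu⟩ ⟨y, hyD, hyv⟩
  by_contra hne
  have hemp : ∀ x, x ∈ D → x ∈ u → x ∈ v → False := fun x h1 h2 h3 => hne ⟨x, h1, h2, h3⟩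
  have fr : ∀ u v : Set ℂ, IsOpen v → D ⊆ u ∪ v → (∀ x, x ∈ D → x ∈ u → x ∈ v → False) →
      IsOpen u → frontier (D ∩ u) ⊆ z '' Icc 0 1 := by
    intro u v hv huv hemp hu p hp
    rw [(hD.inter hu).frontier_eq] at hp
    apply hfr
    rw [hD.frontier_eq]
    refine ⟨closure_mono inter_subset_left hp.1, fun hpD => ?_⟩
    have hpv : p ∈ v := (huv hpD).resolve_left fun h => hp.2 ⟨hpD, h⟩
    obtain ⟨q, hq1, hq2⟩ := mem_closure_iff.1 hp.1 (D ∩ v) (hD.inter hv) ⟨hpD, hpv⟩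
    exact hemp q hq1.1 hq2.2 hq1.2
  refine h.no_two (hD.inter hu) (hD.inter hv) (hb.subset inter_subset_left)
    (hb.subset inter_subset_left) (fr u v hv huv hemp hu)
    (fr v u hu (union_comm u v ▸ huv) (fun x h1 h2 h3 => hemp x h1 h3 h2) hv)
    (hk.mono_left inter_subset_left) (hk.mono_left inter_subset_left) ?_ ⟨hxD, hxu⟩ ⟨hyD, hyv⟩
  rw [Set.disjoint_left]
  exact fun x h1 h2 => hemp x h1.1 h1.2 h2.2

lemma LJ.wn_ext {z : ℝ → ℂ} (h : LJ z) {Om : Set ℂ} (ho : IsOpen Om) (hb : Bornology.IsBounded Om)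
    (hfr : frontier Om = z '' Icc 0 1) (hne : Om.Nonempty) {w : ℂ} (hw : w ∉ closure Om) :
    wn z w = 0 := by
  by_contra hw0
  have hfs : frontier Om ⊆ closure Om := frontier_subset_closure
  have hdk : Disjoint Om (z '' Icc 0 1) := by
    rw [← hfr, ho.frontier_eq]; exact disjoint_sdiff_right
  let E : Set ℂ := {w | w ∉ closure Om ∧ wn z w ≠ 0}
  have hEK : ∀ w, w ∉ closure Om → w ∉ z '' Icc 0 1 := fun w h1 h2 => h1 (hfs (hfr ▸ h2))
  have hcat : ∀ w, w ∉ z '' Icc 0 1 → ContinuousAt (wn z) w := fun w hw =>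
    h.wn_cont.continuousAt (h.compact.isClosed.isOpen_compl.mem_nhds hw)
  have hEo : IsOpen E := by
    rw [isOpen_iff_mem_nhds]
    intro x hx
    filter_upwards [isClosed_closure.isOpen_compl.mem_nhds hx.1,
      (hcat x (hEK x hx.1)).eventually_ne hx.2] with y h1 h2
    exact ⟨h1, h2⟩
  obtain ⟨R, hR⟩ := h.wn_far
  have hEb : Bornology.IsBounded E := by
    refine (Metric.isBounded_ball (x := (0:ℂ)) (r := R)).subset fun x hx => ?_
    by_contra hlt
    exact hx.2 (hR x (by simpa using hlt))
  have hEf : frontier E ⊆ z '' Icc 0 1 := by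
    intro p hp
    by_contra hpK
    rw [hEo.frontier_eq] at hp
    have hpO : p ∉ Om := by
      intro hpO
      obtain ⟨q, hq1, hq2⟩ := mem_closure_iff.1 hp.1 Om ho hpO
      exact hq2.1 (subset_closure hq1)
    have hpc : p ∉ closure Om := by
      intro hc
      apply hpK
      rw [← hfr, ho.frontier_eq]
      exact ⟨hc, hpO⟩
    have hp0 : wn z p = 0 := by
      by_contra h0
      exact hp.2 ⟨hpc, h0⟩
    obtain ⟨ε, hε, hball⟩ := Metric.isOpen_iff.1 h.compact.isClosed.isOpen_compl p hpK
    obtain ⟨q, hq1, hq2⟩ := mem_closure_iff.1 hp.1 _ Metric.isOpen_ball (Metric.mem_ball_self hε)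
    apply hq2.2
    rw [← hp0]
    exact h.wn_const (convex_ball p ε).isPreconnected hball hq1 (Metric.mem_ball_self hε)
  obtain ⟨x, hx⟩ := hne
  refine h.no_two ho hEo hb hEb hfr.subset hEf hdk ?_ ?_ hx (w₂ := w) ⟨hw, hw0⟩
  · rw [Set.disjoint_left]; exact fun x hx => hEK x hx.1
  · rw [Set.disjoint_left]; exact fun x hx hx2 => hx2.1 (subset_closure hx)

lemma punct {S : Set ℂ} (ho : IsOpen S) (hS : IsPreconnected S) {a : ℂ} (ha : a ∈ S) :
    IsPreconnected (S \ {a}) := by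
  obtain ⟨ε, hε, hball⟩ := Metric.isOpen_iff.1 ho a ha
  have hP : IsPreconnected (Metric.ball a ε \ {a}) := by
    have e : Metric.ball a ε \ {a} = (fun x => a + exp x) '' {x : ℂ | x.re < Real.log ε} := by
      ext w
      simp only [mem_diff, Metric.mem_ball, mem_singleton_iff, mem_image, mem_ofPred_eq]
      constructor
      · rintro ⟨h1, h2⟩
        have h3 : w - a ≠ 0 := sub_ne_zero.2 h2
        refine ⟨log (w - a), ?_, by rw [exp_log h3]; ring⟩
        rw [log_re]
        exact Real.log_lt_log (norm_pos_iff.2 h3) (by rwa [dist_eq_norm] at h1)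
      · rintro ⟨x, hx, rfl⟩
        refine ⟨?_, by simp⟩
        rw [dist_self_add_left, norm_exp]
        exact (Real.lt_log_iff_exp_lt hε).1 hx
    rw [e]
    exact (convex_halfSpace_re_lt _).isPreconnected.image _ (by fun_prop)
  have aux : ∀ u v : Set ℂ, IsOpen u → IsOpen v → S \ {a} ⊆ u ∪ v → (S \ {a} ∩ u).Nonempty →
      (S \ {a} ∩ v).Nonempty → (∀ x ∈ S \ {a}, x ∈ u → x ∈ v → False) →
      Metric.ball a ε \ {a} ⊆ u → False := by
    intro u v hu hv huv ⟨x, hx, hxu⟩ ⟨y, hy, hyv⟩ hemp hPu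
    obtain ⟨q, hqS, hq1, hq2⟩ := hS (u ∪ Metric.ball a ε) (v ∩ {a}ᶜ) (hu.union Metric.isOpen_ball)
      (hv.inter isOpen_compl_singleton) (by
        intro p hp
        by_cases hpa : p = a
        · left; right; rw [hpa]; exact Metric.mem_ball_self hε
        · rcases huv ⟨hp, hpa⟩ with h | h
          · exact Or.inl (Or.inl h)
          · exact Or.inr ⟨h, hpa⟩) ⟨x, hx.1, Or.inl hxu⟩ ⟨y, hy.1, hyv, hy.2⟩
    rcases hq1 with h | h
    · exact hemp q ⟨hqS, hq2.2⟩ h hq2.1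
    · exact hemp q ⟨hqS, hq2.2⟩ (hPu ⟨h, hq2.2⟩) hq2.1
  intro u v hu hv huv h1 h2
  by_contra hne
  have hemp : ∀ x ∈ S \ {a}, x ∈ u → x ∈ v → False := fun x h1 h2 h3 => hne ⟨x, h1, h2, h3⟩
  have hPS : Metric.ball a ε \ {a} ⊆ S \ {a} := diff_subset_diff_left hball
  by_cases hx : ((Metric.ball a ε \ {a}) ∩ u).Nonempty
  · by_cases hy : ((Metric.ball a ε \ {a}) ∩ v).Nonempty
    · obtain ⟨q, hq, h3, h4⟩ := hP u v hu hv (hPS.trans huv) hx hy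
      exact hemp q (hPS hq) h3 h4
    · refine aux u v hu hv huv h1 h2 hemp fun p hp => ?_
      exact (huv (hPS hp)).resolve_right fun h => hy ⟨p, hp, h⟩
  · refine aux v u hv hu (union_comm u v ▸ huv) h2 h1 (fun x a b c => hemp x a c b) fun p hp => ?_
    exact (huv (hPS hp)).resolve_left fun h => hx ⟨p, hp, h⟩

/-- abstract situation after inversion -/
structure AS (z : ℝ → ℂ) (W D : Set ℂ) : Prop where
  lj : LJ z
  Wo : IsOpen W
  Do : IsOpen D
  Wc : IsPreconnected W
  Wfar : ∃ R, ∀ w, R ≤ ‖w‖ → w ∈ W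
  cover : ∀ w, w ∈ W ∨ w ∈ D ∨ w ∈ z '' Icc 0 1
  WD : Disjoint W D
  WK : Disjoint W (z '' Icc 0 1)
  DK : Disjoint D (z '' Icc 0 1)
  KW : z '' Icc 0 1 ⊆ closure W
  D0 : (0:ℂ) ∈ D

lemma AS.Db {z : ℝ → ℂ} {W D : Set ℂ} (h : AS z W D) : Bornology.IsBounded D := by
  obtain ⟨R, hR⟩ := h.Wfar
  refine (Metric.isBounded_ball (x := (0:ℂ)) (r := R)).subset fun x hx => ?_
  by_contra hlt
  exact Set.disjoint_left.1 h.WD (hR x (by simpa using hlt)) hx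

lemma AS.Dfr {z : ℝ → ℂ} {W D : Set ℂ} (h : AS z W D) : frontier D ⊆ z '' Icc 0 1 := by
  intro p hp
  rw [h.Do.frontier_eq] at hp
  rcases h.cover p with h1 | h1 | h1
  · obtain ⟨q, hq1, hq2⟩ := mem_closure_iff.1 hp.1 W h.Wo h1
    exact (Set.disjoint_left.1 h.WD hq1 hq2).elim
  · exact (hp.2 h1).elim
  · exact h1

lemma AS.Dc {z : ℝ → ℂ} {W D : Set ℂ} (h : AS z W D) : IsPreconnected D :=
  h.lj.jconn h.Do h.Db h.Dfr h.DK

lemma AS.wn_ne {z : ℝ → ℂ} {W D : Set ℂ} (h : AS z W D) {w : ℂ} (hw : w ∈ D) : wn z w ≠ 0 :=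
  h.lj.wn_ne h.Do h.Db h.Dfr hw (Set.disjoint_left.1 h.DK hw)

lemma LJ.inv {z : ℝ → ℂ} (h : LJ z) {a : ℂ} (ha : a ∉ z '' Icc 0 1) : LJ fun u => (z u - a)⁻¹ := by
  obtain ⟨K, hK⟩ := h.lip
  obtain ⟨δ, hδ, hl⟩ := h.low ha
  refine ⟨⟨K * (⟨δ, hδ.le⟩⁻¹ * ⟨δ, hδ.le⟩⁻¹), LipschitzWith.of_dist_le_mul fun x y => ?_⟩, ?_, ?_, ?_⟩
  · have hx := h.ne ha x
    have hy := h.ne ha y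
    have e : (z x - a)⁻¹ - (z y - a)⁻¹ = (z y - z x) * ((z x - a)⁻¹ * (z y - a)⁻¹) := by
      field_simp; ring
    rw [dist_eq_norm, e, norm_mul, norm_mul, norm_inv, norm_inv, ← dist_eq_norm]
    have h1 := hK.dist_le_mul y x
    have h2 : ∀ x, ‖z x - a‖⁻¹ ≤ δ⁻¹ := fun x => inv_anti₀ hδ (hl x)
    calc dist (z y) (z x) * (‖z x - a‖⁻¹ * ‖z y - a‖⁻¹) ≤ (K * dist y x) * (δ⁻¹ * δ⁻¹) := by
          exact mul_le_mul h1 (mul_le_mul (h2 x) (h2 y) (by positivity) (by positivity))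
            (by positivity) (by positivity)
      _ = _ := by
          rw [dist_comm y x, NNReal.coe_mul, NNReal.coe_mul]
          change _ = (K:ℝ) * (δ⁻¹ * δ⁻¹) * dist x y
          ring
  · simp only [h.closed]
  · intro x hx y hy hxy
    simp only [inv_inj, sub_left_inj] at hxy
    exact h.inj hx hy hxy
  · intro u
    obtain ⟨t, ht, e⟩ := h.clamp u
    exact ⟨t, ht, by simp only [e]⟩

lemma LJ.inv_as {z : ℝ → ℂ} (h : LJ z) {Om : Set ℂ} (ho : IsOpen Om) (hb : Bornology.IsBounded Om)
    (hfr : frontier Om = z '' Icc 0 1) {a : ℂ} (ha : a ∈ Om) :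
    ∃ W D, AS (fun u => (z u - a)⁻¹) W D := by
  have hdk : Disjoint Om (z '' Icc 0 1) := by
    rw [← hfr, ho.frontier_eq]; exact disjoint_sdiff_right
  have haK : a ∉ z '' Icc 0 1 := Set.disjoint_left.1 hdk ha
  have hcl : ∀ x, x ∈ closure Om ↔ x ∈ Om ∨ x ∈ z '' Icc 0 1 := by
    intro x
    rw [← hfr, closure_eq_self_union_frontier]; rfl
  have hOc : IsPreconnected Om := h.jconn ho hb hfr.subset hdk
  have hK' : ∀ w, w ∈ (fun u => (z u - a)⁻¹) '' Icc 0 1 ↔ w ≠ 0 ∧ a + w⁻¹ ∈ z '' Icc 0 1 := by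
    intro w
    constructor
    · rintro ⟨t, ht, rfl⟩
      exact ⟨inv_ne_zero (h.ne haK t), t, ht, by simp⟩
    · rintro ⟨h0, t, ht, e⟩
      exact ⟨t, ht, by simp [e]⟩
  have hop : ∀ S : Set ℂ, IsOpen S → IsOpen {w : ℂ | w ≠ 0 ∧ a + w⁻¹ ∈ S} := by
    intro S hS
    rw [isOpen_iff_mem_nhds]
    intro x hx
    have : ContinuousAt (fun w : ℂ => a + w⁻¹) x := (continuousAt_inv₀ hx.1).const_add a
    filter_upwards [isOpen_ne.mem_nhds hx.1, this (hS.mem_nhds hx.2)] with y h1 h2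
    exact ⟨h1, h2⟩
  obtain ⟨R, hR⟩ := hb.closure.subset_ball a
  obtain ⟨ε, hε, hball⟩ := Metric.isOpen_iff.1 ho a ha
  have hRp : 0 < R := by
    have := hR (subset_closure ha)
    simpa using this
  have hWim : {w : ℂ | w ≠ 0 ∧ a + w⁻¹ ∈ Om} = (fun x => (x - a)⁻¹) '' (Om \ {a}) := by
    ext w
    constructor
    · rintro ⟨h0, hw⟩
      exact ⟨a + w⁻¹, ⟨hw, by simpa using h0⟩, by simp⟩
    · rintro ⟨x, ⟨hx, hxa⟩, rfl⟩
      exact ⟨inv_ne_zero (sub_ne_zero.2 hxa), by simpa using hx⟩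
  refine ⟨{w | w ≠ 0 ∧ a + w⁻¹ ∈ Om}, {w | w = 0 ∨ a + w⁻¹ ∉ closure Om}, h.inv haK, hop _ ho, ?_, ?_,
    ⟨2 / ε, fun w hw => ?_⟩, ?_, ?_, ?_, ?_, ?_, Or.inl rfl⟩
  · have e : {w : ℂ | w = 0 ∨ a + w⁻¹ ∉ closure Om} =
        Metric.ball 0 R⁻¹ ∪ {w | w ≠ 0 ∧ a + w⁻¹ ∈ (closure Om)ᶜ} := by
      ext w
      simp only [mem_ofPred_eq, mem_union, Metric.mem_ball, dist_zero_right, mem_compl_iff]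
      constructor
      · rintro (rfl | hw)
        · left; simpa using hRp
        · by_cases h0 : w = 0
          · left; simpa [h0] using hRp
          · exact Or.inr ⟨h0, hw⟩
      · rintro (hw | hw)
        · by_cases h0 : w = 0
          · exact Or.inl h0
          · right
            intro hc
            have := hR hc
            simp at this
            have h1 := norm_pos_iff.2 h0
            have := (inv_lt_inv₀ (inv_pos.2 hRp) h1).2 hw
            simp at this
            linarith
        · exact Or.inr hw.2
    rw [e]
    exact Metric.isOpen_ball.union (hop _ isClosed_closure.isOpen_compl)
  · rw [hWim]
    refine IsPreconnected.image ?_ _ ?_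
    · exact punct ho hOc ha
    · intro x hx
      exact ((continuousAt_id.sub continuousAt_const).inv₀ (sub_ne_zero.2 hx.2)).continuousWithinAt
  · have hw0 : 0 < ‖w‖ := lt_of_lt_of_le (by positivity) hw
    refine ⟨norm_pos_iff.1 hw0, hball ?_⟩
    simp only [Metric.mem_ball, dist_self_add_left, norm_inv]
    rw [inv_lt_comm₀ hw0 hε]
    refine lt_of_lt_of_le ?_ hw
    rw [inv_eq_one_div]
    gcongr; norm_num
  · intro w
    rw [hK']
    by_cases h0 : w = 0
    · exact Or.inr (Or.inl (Or.inl h0))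
    · by_cases hc : a + w⁻¹ ∈ closure Om
      · rcases (hcl _).1 hc with h1 | h1
        · exact Or.inl ⟨h0, h1⟩
        · exact Or.inr (Or.inr ⟨h0, h1⟩)
      · exact Or.inr (Or.inl (Or.inr hc))
  · rw [Set.disjoint_left]
    rintro w ⟨h0, h1⟩ (h2 | h2)
    · exact h0 h2
    · exact h2 (subset_closure h1)
  · rw [Set.disjoint_left]
    rintro w ⟨h0, h1⟩ h2
    exact Set.disjoint_left.1 hdk h1 ((hK' w).1 h2).2
  · rw [Set.disjoint_left]
    rintro w (h1 | h1) h2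
    · exact ((hK' w).1 h2).1 h1
    · exact h1 ((hcl _).2 (Or.inr ((hK' w).1 h2).2))
  · rintro _ ⟨t, ht, rfl⟩
    rw [hWim]
    have h1 : z t ∈ closure (Om \ {a}) := by
      rw [mem_closure_iff]
      intro o hoo hzo
      have hza : z t ≠ a := fun e => haK ⟨t, ht, e⟩
      obtain ⟨q, hq1, hq2⟩ := mem_closure_iff.1 ((hcl _).2 (Or.inr ⟨t, ht, rfl⟩)) (o ∩ {a}ᶜ)
        (hoo.inter isOpen_compl_singleton) ⟨hzo, hza⟩
      exact ⟨q, hq1.1, hq2, hq1.2⟩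
    have h2 : ContinuousAt (fun x : ℂ => (x - a)⁻¹) (z t) :=
      (continuousAt_id.sub continuousAt_const).inv₀ (h.ne haK t)
    exact h2.continuousWithinAt.mem_closure_image h1

end JA
end CD

set_option linter.unusedSectionVars false

namespace CD
section RMs
open Set Topology Complex Polynomial

lemma far {ν : Measure ℝ} {z g : ℝ → ℂ} (hz : Continuous z) {R : ℝ} (hzb : ∀ u, ‖z u‖ ≤ R)
    (hg : Integrable g ν) {w c : ℂ} (hw : ‖w‖ ≤ R)
    (hm : ∀ p : ℂ[X], ∫ u, p.eval (z u) * g u ∂ν = c * p.eval w) {w' : ℂ} (hw' : R < ‖w'‖) :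
    cau ν z g w' = c / (w - w') := by
  have hR : 0 ≤ R := (norm_nonneg w).trans hw
  have hw0 : 0 < ‖w'‖ := lt_of_le_of_lt hR hw'
  have hw0' : w' ≠ 0 := norm_pos_iff.1 hw0
  let p : ℕ → ℂ[X] := fun N => ∑ n ∈ Finset.range N, C (-(w' ^ (n + 1))⁻¹) * X ^ n
  have hsub : ∀ x : ℂ, ‖x‖ ≤ R → x - w' ≠ 0 := fun x hx h => by
    rw [sub_eq_zero] at h; rw [h] at hx; linarith
  have hp : ∀ N, ∀ x : ℂ, ‖x‖ ≤ R → (p N).eval x = (x - w')⁻¹ - (x / w') ^ N * (x - w')⁻¹ := by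
    intro N x hx
    have h1 := hsub x hx
    simp only [p, eval_finsetSum, eval_mul, eval_C, eval_pow, eval_X]
    induction N with
    | zero => simp
    | succ n ih =>
      rw [Finset.sum_range_succ, ih, div_pow, div_pow]
      field_simp
      ring
  have hlim : ∀ x : ℂ, ‖x‖ ≤ R → Tendsto (fun N => (p N).eval x) atTop (𝓝 (x - w')⁻¹) := by
    intro x hx
    simp only [hp _ x hx]
    have : Tendsto (fun N : ℕ => (x / w') ^ N) atTop (𝓝 0) := by
      apply tendsto_pow_atTop_nhds_zero_of_norm_lt_one
      rw [norm_div, div_lt_one hw0]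
      linarith
    simpa using tendsto_const_nhds.sub (this.mul_const (x - w')⁻¹)
  have hT : Tendsto (fun N => ∫ u, (p N).eval (z u) * g u ∂ν) atTop (𝓝 (cau ν z g w')) := by
    refine tendsto_integral_of_dominated_convergence (fun u => 2 * (‖w'‖ - R)⁻¹ * ‖g u‖)
      (fun N => ((p N).continuous.comp hz).aestronglyMeasurable.mul hg.1) (hg.norm.const_mul _) ?_ ?_
    · intro N
      refine Eventually.of_forall fun u => ?_
      rw [norm_mul]
      gcongr
      rw [hp _ _ (hzb u)]
      have h2 : ‖(z u - w')⁻¹‖ ≤ (‖w'‖ - R)⁻¹ := by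
        rw [norm_inv]
        apply inv_anti₀ (by linarith)
        have := norm_sub_norm_le w' (z u)
        rw [norm_sub_rev] at this
        linarith [hzb u]
      have h3 : ‖(z u / w') ^ N‖ ≤ 1 := by
        rw [norm_pow, norm_div]
        apply pow_le_one₀ (by positivity)
        rw [div_le_one hw0]
        linarith [hzb u]
      calc _ ≤ ‖(z u - w')⁻¹‖ + ‖(z u / w') ^ N * (z u - w')⁻¹‖ := norm_sub_le _ _
        _ ≤ (‖w'‖ - R)⁻¹ + 1 * (‖w'‖ - R)⁻¹ := by
          rw [norm_mul]
          gcongr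
        _ = _ := by ring
    · refine Eventually.of_forall fun u => ?_
      have := (hlim _ (hzb u)).mul_const (g u)
      rwa [inv_mul_eq_div] at this
  simp only [hm] at hT
  have := (hlim w hw).const_mul c
  rw [← div_eq_mul_inv] at this
  exact tendsto_nhds_unique hT this

/-- representing measure of `w` -/
structure RM (z : ℝ → ℂ) (w : ℂ) (μ : Measure ℝ) : Prop where
  fin : IsFiniteMeasure μ
  ac : μ ≪ nuI
  rep : ∀ p : ℂ[X], ∫ u, p.eval (z u) ∂μ = p.eval w

lemma LJ.bdd {z : ℝ → ℂ} (h : LJ z) : ∃ R, ∀ u, ‖z u‖ ≤ R := by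
  obtain ⟨R, hR⟩ := h.compact.isBounded.subset_closedBall (0:ℂ)
  exact ⟨R, fun u => by simpa using hR (h.clamp u)⟩

lemma cau_an {ν : Measure ℝ} {z g : ℝ → ℂ} (h : LJ z) (hg : Integrable g ν) {S : Set ℂ} (hS : IsOpen S)
    (hSK : Disjoint S (z '' Icc 0 1)) : AnalyticOnNhd ℂ (cau ν z g) S := by
  refine DifferentiableOn.analyticOnNhd (fun w hw => ?_) hS
  exact (cau_deriv h.compact.isClosed h.cont.measurable h.clamp hg
    (Set.disjoint_left.1 hSK hw)).differentiableAt.differentiableWithinAt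

lemma AS.cau_W {z : ℝ → ℂ} {W D : Set ℂ} (h : AS z W D) {ν : Measure ℝ} {g : ℝ → ℂ}
    (hg : Integrable g ν) {w c : ℂ} (hw : w ∈ D)
    (hm : ∀ p : ℂ[X], ∫ u, p.eval (z u) * g u ∂ν = c * p.eval w) {w' : ℂ} (hw' : w' ∈ W) :
    cau ν z g w' = c / (w - w') := by
  obtain ⟨R1, hR1⟩ := h.lj.bdd
  obtain ⟨R2, hR2⟩ := h.Wfar
  let R := max R1 (max R2 ‖w‖)
  have hfar : ∀ y : ℂ, R < ‖y‖ → cau ν z g y = c / (w - y) := fun y hy =>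
    far h.lj.cont (R := R) (fun u => (hR1 u).trans (le_max_left _ _)) hg (w := w) (c := c)
    ((le_max_right _ _).trans (le_max_right _ _)) hm hy
  let x : ℂ := ((R + 1 : ℝ) : ℂ)
  have hR0 : 0 ≤ R := (norm_nonneg w).trans ((le_max_right _ _).trans (le_max_right _ _))
  have hx : R < ‖x‖ := by
    simp only [x]
    rw [norm_real, Real.norm_of_nonneg (by linarith)]; linarith
  have hxW : x ∈ W := hR2 x (((le_max_left _ _).trans (le_max_right _ _)).trans hx.le)
  have hne : ∀ y ∈ W, w - y ≠ 0 := fun y hy e => by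
    rw [sub_eq_zero] at e
    exact Set.disjoint_left.1 h.WD hy (e ▸ hw)
  have han : AnalyticOnNhd ℂ (fun y => c / (w - y)) W := by
    refine DifferentiableOn.analyticOnNhd (fun y hy => ?_) h.Wo
    have := hne y hy
    exact ((differentiableAt_const c).div (by fun_prop) this).differentiableWithinAt
  refine (cau_an h.lj hg h.Wo h.WK).eqOn_of_preconnected_of_eventuallyEq han h.Wc hxW ?_ hw'
  have : ∀ᶠ y in 𝓝 x, R < ‖y‖ := continuous_norm.continuousAt.eventually (lt_mem_nhds hx)
  filter_upwards [this] with y hy using hfar y hy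

/-- `T c v = Re (c v)` -/
noncomputable def TT : ℂ →L[ℝ] (ℂ →L[ℝ] ℝ) :=
  (ContinuousLinearMap.compL ℝ ℂ ℂ ℝ reCLM).comp (ContinuousLinearMap.mul ℝ ℂ)

lemma TT_apply (c v : ℂ) : TT c v = (c * v).re := rfl

lemma log_fd {a w : ℂ} (h : a - w ≠ 0) :
    HasFDerivAt (fun w => Real.log ‖a - w‖) (TT (-(a - w)⁻¹)) w := by
  have h1 : HasDerivAt (fun x => log ((a - x) / (a - w))) (-(a - w)⁻¹) w := by
    have h2 : HasDerivAt (fun x => (a - x) / (a - w)) (-1 / (a - w)) w :=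
      ((hasDerivAt_id w).const_sub a).div_const (a - w)
    have := h2.clog (by rw [div_self h]; exact one_mem_slitPlane)
    rw [div_self h] at this
    convert this using 1
    field_simp
  have h3 : HasFDerivAt (fun x => (log ((a - x) / (a - w))).re) (TT (-(a - w)⁻¹)) w := by
    have := reCLM.hasFDerivAt.comp w (h1.hasFDerivAt.restrictScalars ℝ)
    have e : TT (-(a - w)⁻¹) = reCLM ∘SL ContinuousLinearMap.restrictScalars ℝ
        (ContinuousLinearMap.toSpanSingleton ℂ (-(a - w)⁻¹)) := by
      apply ContinuousLinearMap.ext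
      intro v
      rw [TT_apply]
      simp [mul_comm]
    rw [e]
    exact this
  have h4 := h3.add_const (Real.log ‖a - w‖)
  refine h4.congr_of_eventuallyEq ?_
  have h5 : ∀ᶠ x in 𝓝 w, a - x ≠ 0 := (continuousAt_const.sub continuousAt_id).eventually_ne h
  filter_upwards [h5] with x hx
  rw [log_re, norm_div, Real.log_div (norm_ne_zero_iff.2 hx) (norm_ne_zero_iff.2 h)]
  ring

lemma LJ.pot_fd {z : ℝ → ℂ} (h : LJ z) (μ : Measure ℝ) [IsFiniteMeasure μ] {w : ℂ}
    (hw : w ∉ z '' Icc 0 1) :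
    HasFDerivAt (fun w => ∫ u, Real.log ‖z u - w‖ ∂μ) (TT (-cau μ z 1 w)) w := by
  obtain ⟨δ, hδ, hl⟩ := h.low hw
  obtain ⟨R, hR⟩ := h.bdd
  have hlow : ∀ u, ∀ x ∈ Metric.ball w (δ / 2), δ / 2 ≤ ‖z u - x‖ := by
    intro u x hx
    have h1 := hl u
    have h2 : ‖z u - w‖ ≤ ‖z u - x‖ + ‖x - w‖ := norm_sub_le_norm_sub_add_norm_sub _ _ _
    rw [Metric.mem_ball, dist_eq_norm] at hx
    linarith
  have hi : Integrable (fun u => (z u - w)⁻¹) μ := by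
    refine (integrable_const (δ⁻¹)).mono' (by
      exact (h.cont.measurable.sub_const w).inv.aestronglyMeasurable) ?_
    refine Eventually.of_forall fun u => ?_
    rw [norm_inv]
    exact inv_anti₀ hδ (hl u)
  have key := hasFDerivAt_integral_of_dominated_of_fderiv_le (μ := μ) (𝕜 := ℝ)
    (F := fun w u => Real.log ‖z u - w‖) (F' := fun w u => TT (-(z u - w)⁻¹)) (x₀ := w)
    (s := Metric.ball w (δ / 2))
    (bound := fun _ => ‖TT‖ * (δ / 2)⁻¹) (Metric.ball_mem_nhds w (by positivity)) ?_ ?_ ?_ ?_ ?_ ?_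
  · have h1 : ∫ u, TT (-(z u - w)⁻¹) ∂μ = TT (∫ u, -(z u - w)⁻¹ ∂μ) :=
      ContinuousLinearMap.integral_comp_comm TT hi.neg
    rw [h1, integral_neg] at key
    have h2 : cau μ z 1 w = ∫ u, (z u - w)⁻¹ ∂μ := by simp [cau]
    rw [h2]
    exact key
  · refine Eventually.of_forall fun x => ?_
    exact (Real.measurable_log.comp (h.cont.measurable.sub_const x).norm).aestronglyMeasurable
  · obtain ⟨C, hC⟩ := (isCompact_Icc (a := δ) (b := R + ‖w‖)).exists_bound_of_continuousOn
      (f := Real.log) (Real.continuousOn_log.mono fun x hx => (hδ.trans_le hx.1).ne')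
    refine (integrable_const C).mono' (by
      exact (Real.measurable_log.comp (h.cont.measurable.sub_const w).norm).aestronglyMeasurable) ?_
    refine Eventually.of_forall fun u => hC _ ⟨hl u, ?_⟩
    exact (norm_sub_le _ _).trans (by gcongr; exact hR u)
  · exact TT.continuous.comp_aestronglyMeasurable hi.neg.1
  · refine Eventually.of_forall fun u x hx => ?_
    refine (TT.le_opNorm _).trans ?_
    gcongr
    rw [norm_neg, norm_inv]
    exact inv_anti₀ (by positivity) (hlow u x hx)
  · exact integrable_const _
  · refine Eventually.of_forall fun u x hx => log_fd ?_
    have := hlow u x hx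
    intro h0
    rw [h0, norm_zero] at this
    linarith

lemma RM.mass {z : ℝ → ℂ} {w : ℂ} {μ : Measure ℝ} (hμ : RM z w μ) : μ.real univ = 1 := by
  have := hμ.rep 1
  simp at this
  exact_mod_cast this

lemma RM.pot_W {z : ℝ → ℂ} {W D : Set ℂ} (h : AS z W D) {w : ℂ} (hw : w ∈ D) {μ : Measure ℝ}
    (hμ : RM z w μ) {w' : ℂ} (hw' : w' ∈ W) :
    ∫ u, Real.log ‖z u - w'‖ ∂μ = Real.log ‖w - w'‖ := by
  have := hμ.fin
  have hone : Integrable (1 : ℝ → ℂ) μ := integrable_const (1:ℂ)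
  have hcau : ∀ y ∈ W, cau μ z 1 y = (w - y)⁻¹ := fun y hy => by
    rw [h.cau_W hone hw (c := 1) (fun p => by simpa using hμ.rep p) hy, one_div]
  have hne : ∀ y ∈ W, w - y ≠ 0 := fun y hy e => by
    rw [sub_eq_zero] at e
    exact Set.disjoint_left.1 h.WD hy (e ▸ hw)
  let Λ : ℂ → ℝ := fun y => (∫ u, Real.log ‖z u - y‖ ∂μ) - Real.log ‖w - y‖
  have hd : ∀ y ∈ W, HasFDerivAt Λ (0 : ℂ →L[ℝ] ℝ) y := by
    intro y hy
    have h1 := (h.lj.pot_fd μ (Set.disjoint_left.1 h.WK hy)).sub (log_fd (hne y hy))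
    rw [hcau y hy, sub_self] at h1
    exact h1
  obtain ⟨a, ha⟩ := h.Wo.exists_is_const_of_fderiv_eq_zero h.Wc
    (fun y hy => (hd y hy).differentiableAt.differentiableWithinAt) (fun y hy => (hd y hy).fderiv)
  obtain ⟨R1, hR1⟩ := h.lj.bdd
  obtain ⟨R2, hR2⟩ := h.Wfar
  have hlim : Tendsto (fun n : ℕ => Λ (n : ℂ)) atTop (𝓝 0) := by
    let R := max R1 ‖w‖
    have hbd : ∀ n : ℕ, R < n → ‖Λ n‖ ≤ 2 * R / (n - R) := by
      intro n hn
      have hR0 : 0 ≤ R := (norm_nonneg w).trans (le_max_right _ _)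
      have hnn : (0:ℝ) < n := lt_of_le_of_lt hR0 hn
      have hb : ∀ x : ℂ, ‖x‖ ≤ R → Real.log (n - R) ≤ Real.log ‖x - n‖ ∧
          Real.log ‖x - n‖ ≤ Real.log (n + R) := by
        intro x hx
        have h1 : n - R ≤ ‖x - n‖ := by
          have := norm_sub_norm_le (n:ℂ) x
          rw [norm_sub_rev, Complex.norm_natCast] at this
          linarith
        have h2 : ‖x - n‖ ≤ n + R := by
          have := norm_sub_le x (n:ℂ)
          rw [Complex.norm_natCast] at this
          linarith
        exact ⟨Real.log_le_log (by linarith) h1, Real.log_le_log (by linarith) h2⟩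
      have hzR : ∀ u, ‖z u‖ ≤ R := fun u => (hR1 u).trans (le_max_left _ _)
      have hint : Integrable (fun u => Real.log ‖z u - n‖) μ := by
        refine (integrable_const (max |Real.log (n - R)| |Real.log (n + R)|)).mono' (by
          exact (Real.measurable_log.comp (h.lj.cont.measurable.sub_const _).norm).aestronglyMeasurable) ?_
        refine Eventually.of_forall fun u => ?_
        have := hb _ (hzR u)
        exact abs_le_max_abs_abs this.1 this.2
      have i1 := integral_mono (integrable_const _) hint (fun u => (hb _ (hzR u)).1)
      have i2 := integral_mono hint (integrable_const _) (fun u => (hb _ (hzR u)).2)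
      rw [integral_const, hμ.mass, one_smul] at i1 i2
      have i3 := hb w (le_max_right _ _)
      have i4 : Real.log (n + R) - Real.log (n - R) ≤ 2 * R / (n - R) := by
        rw [← Real.log_div (by linarith) (by linarith)]
        refine (Real.log_le_sub_one_of_pos (div_pos (by linarith) (by linarith))).trans (le_of_eq ?_)
        have : (n:ℝ) - R ≠ 0 := by linarith
        field_simp
        ring
      rw [Real.norm_eq_abs, abs_le]
      constructor <;> simp only [Λ] <;> linarith [i3.1, i3.2]
    refine squeeze_zero_norm' (a := fun n : ℕ => 2 * R / (n - R)) ?_ ?_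
    · filter_upwards [(tendsto_natCast_atTop_atTop (R := ℝ)).eventually_gt_atTop R] with n hn
      exact hbd n hn
    · refine Tendsto.div_atTop tendsto_const_nhds ?_
      exact tendsto_atTop_add_const_right _ _ tendsto_natCast_atTop_atTop
  have hev : ∀ᶠ n : ℕ in atTop, Λ (n : ℂ) = a := by
    filter_upwards [(tendsto_natCast_atTop_atTop (R := ℝ)).eventually_ge_atTop R2] with n hn
    exact ha _ (hR2 _ (by simpa using hn))
  have ha0 : a = 0 := tendsto_nhds_unique (tendsto_const_nhds.congr' (hev.mono fun n hn => hn.symm)) hlim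
  have := ha w' hw'
  rw [ha0] at this
  exact sub_eq_zero.1 this

end RMs
end CD

set_option linter.unusedSectionVars false

namespace CD
section Carl
open Set Topology Complex

open Classical in
/-- one-dimensional logarithmic error -/
noncomputable def EE (x t : ℝ) : ENNReal :=
  if x = t then ⊤ else ENNReal.ofReal (Real.log x - Real.log (x - t))

lemma EE_meas : Measurable (fun p : ℝ × ℝ => EE p.1 p.2) := by
  unfold EE
  refine Measurable.ite (measurableSet_eq_fun measurable_fst measurable_snd) measurable_const ?_
  exact ((Real.measurable_log.comp measurable_fst).sub
    (Real.measurable_log.comp (measurable_fst.sub measurable_snd))).ennreal_ofReal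

lemma EE_ae (x : ℝ) : (fun t => EE x t) =ᵐ[volume] fun t => ENNReal.ofReal (Real.log x - Real.log (x - t)) := by
  have : ∀ᵐ t : ℝ, t ≠ x := by simp [ae_iff, measure_singleton]
  filter_upwards [this] with t ht
  simp [EE, ht.symm]

lemma EE_G1 {x : ℝ} (hx : 0 < x) (r : ℝ) : ∫⁻ t in Ioc 0 r, EE x t ≤ ENNReal.ofReal (2 * x) := by
  have h0 : ∫⁻ t in Ioi (2 * x), EE x t = 0 := by
    rw [setLIntegral_congr_fun measurableSet_Ioi (g := fun _ => 0)]
    · simp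
    · intro t ht
      simp only [mem_Ioi] at ht
      have h1 : x ≠ t := by linarith
      simp only [EE, h1, if_false]
      rw [ENNReal.ofReal_eq_zero, sub_nonpos, ← Real.log_abs (x - t)]
      apply Real.log_le_log hx
      rw [abs_sub_comm]
      exact le_trans (by linarith) (le_abs_self _)
  have h1 : ∫⁻ t in Ioc 0 (2 * x), EE x t = ENNReal.ofReal (2 * x) := by
    rw [lintegral_congr_ae (ae_restrict_of_ae (EE_ae x))]
    have hint : IntervalIntegrable (fun t => Real.log x - Real.log (x - t)) volume 0 (2 * x) := by
      refine intervalIntegrable_const.sub ?_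
      have := (intervalIntegral.intervalIntegrable_log' (a := x) (b := -x)).comp_sub_left x
      have e : x - -x = 2 * x := by ring
      rwa [sub_self, e] at this
    rw [← ofReal_integral_eq_lintegral_ofReal]
    · rw [← intervalIntegral.integral_of_le (by linarith), intervalIntegral.integral_sub intervalIntegrable_const]
      · rw [intervalIntegral.integral_comp_sub_left (fun t => Real.log t) x, integral_log]
        congr 1
        have e : x - 2 * x = - x := by ring
        rw [e, Real.log_neg_eq_log]
        simp
        ring
      · have := (intervalIntegral.intervalIntegrable_log' (a := x) (b := -x)).comp_sub_left x
        have e : x - -x = 2 * x := by ring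
        rwa [sub_self, e] at this
    · exact (intervalIntegrable_iff_integrableOn_Ioc_of_le (by linarith)).1 hint
    · have : ∀ᵐ t : ℝ, t ≠ x := by simp [ae_iff, measure_singleton]
      filter_upwards [ae_restrict_mem measurableSet_Ioc, ae_restrict_of_ae this] with t ht htx
      simp only [Pi.zero_apply, sub_nonneg]
      rw [← Real.log_abs (x - t)]
      apply Real.log_le_log (abs_pos.2 (sub_ne_zero.2 htx.symm))
      rw [abs_le]; constructor <;> linarith [ht.1, ht.2]
  calc ∫⁻ t in Ioc 0 r, EE x t ≤ ∫⁻ t in Ioc 0 (2 * x) ∪ Ioi (2 * x), EE x t := by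
        apply lintegral_mono_set
        intro t ht
        rcases le_or_gt t (2 * x) with h | h
        · exact Or.inl ⟨ht.1, h⟩
        · exact Or.inr h
    _ ≤ _ := lintegral_union_le _ _ _
    _ = _ := by rw [h0, h1, add_zero]

lemma EE_G2 {x r : ℝ} (hr : 0 < r) (hx : 2 * r ≤ x) :
    ∫⁻ t in Ioc 0 r, EE x t ≤ ENNReal.ofReal (2 * r / x) * ENNReal.ofReal r := by
  calc ∫⁻ t in Ioc 0 r, EE x t ≤ ∫⁻ t in Ioc 0 r, ENNReal.ofReal (2 * r / x) := by
        apply setLIntegral_mono measurable_const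
        intro t ht
        have h1 : x ≠ t := by linarith [ht.2]
        simp only [EE, h1, if_false]
        apply ENNReal.ofReal_le_ofReal
        have hxp : 0 < x := by linarith
        have hxt : 0 < x - t := by linarith [ht.2]
        rw [← Real.log_div hxp.ne' hxt.ne']
        refine (Real.log_le_sub_one_of_pos (by positivity)).trans ?_
        have e : x / (x - t) - 1 = t / (x - t) := by field_simp; ring
        rw [e, div_le_div_iff₀ hxt hxp]
        nlinarith [ht.1, ht.2]
    _ = _ := by simp

lemma EE_G3 {x r : ℝ} (hr : 0 < r) (hx : 0 < x) :
    ∫⁻ t in Ioc 0 r, EE x t ≤ 4 * ENNReal.ofReal r := by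
  have e4 : (4:ENNReal) = ENNReal.ofReal 4 := by simp
  rcases le_total x (2 * r) with h | h
  · refine (EE_G1 hx r).trans ?_
    rw [e4, ← ENNReal.ofReal_mul (by norm_num)]
    exact ENNReal.ofReal_le_ofReal (by linarith)
  · refine (EE_G2 hr h).trans ?_
    gcongr
    rw [e4]
    apply ENNReal.ofReal_le_ofReal
    rw [div_le_iff₀ hx]; linarith

lemma carl (μ : Measure ℝ) [IsFiniteMeasure μ] {x : ℝ → ℝ} (hx : Measurable x)
    (hpos : ∀ᵐ u ∂μ, 0 < x u) {ε : ENNReal} (hε : 0 < ε) {r₀ : ℝ} (hr₀ : 0 < r₀) :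
    ∃ t ∈ Ioc 0 r₀, ∫⁻ u, EE (x u) t ∂μ < ε := by
  by_contra hcon
  push Not at hcon
  let r : ℕ → ℝ := fun n => r₀ / (n + 1)
  have hr : ∀ n, 0 < r n := fun n => by positivity
  have hrlim : Tendsto r atTop (𝓝 0) := by
    have := tendsto_one_div_add_atTop_nhds_zero_nat (𝕜 := ℝ)
    simpa [r, div_eq_mul_inv] using this.const_mul r₀
  have hrle : ∀ n, r n ≤ r₀ := fun n => by
    apply div_le_self hr₀.le
    have : (0:ℝ) ≤ n := by positivity
    linarith
  let g : ℕ → ℝ → ENNReal := fun n u => (∫⁻ t in Ioc 0 (r n), EE (x u) t) / ENNReal.ofReal (r n)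
  have hmeas : ∀ n, Measurable (fun u => ∫⁻ t in Ioc 0 (r n), EE (x u) t) := fun n => by
    have : Measurable (fun p : ℝ × ℝ => EE (x p.1) p.2) :=
      EE_meas.comp ((hx.comp measurable_fst).prodMk measurable_snd)
    exact this.lintegral_prod_right'
  have hr0 : ∀ n, ENNReal.ofReal (r n) ≠ 0 := fun n => by simpa using hr n
  have hlim : Tendsto (fun n => ∫⁻ u, g n u ∂μ) atTop (𝓝 (∫⁻ u, 0 ∂μ)) := by
    refine tendsto_lintegral_of_dominated_convergence (fun _ => 4) (fun n => (hmeas n).div_const _) ?_ ?_ ?_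
    · intro n
      filter_upwards [hpos] with u hu
      exact ENNReal.div_le_of_le_mul (EE_G3 (hr n) hu)
    · simp [lintegral_const]
      exact ENNReal.mul_ne_top (by simp) (measure_ne_top _ _)
    · filter_upwards [hpos] with u hu
      have h1 : Tendsto (fun n => ENNReal.ofReal (2 * r n / x u)) atTop (𝓝 0) := by
        have : Tendsto (fun n => 2 * r n / x u) atTop (𝓝 0) := by
          simpa using (hrlim.const_mul 2).div_const (x u)
        have h9 := (ENNReal.continuous_ofReal.tendsto 0).comp this
        rw [ENNReal.ofReal_zero] at h9
        exact h9
      refine tendsto_of_tendsto_of_tendsto_of_le_of_le' tendsto_const_nhds h1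
        (Eventually.of_forall fun n => zero_le) ?_
      have h2 : ∀ᶠ n in atTop, r n < x u / 2 := hrlim.eventually (gt_mem_nhds (by linarith))
      filter_upwards [h2] with n hn
      exact ENNReal.div_le_of_le_mul (EE_G2 (hr n) (by linarith))
  have hge : ∀ n, ε ≤ ∫⁻ u, g n u ∂μ := by
    intro n
    have e1 : ∫⁻ u, g n u ∂μ = (∫⁻ u, (∫⁻ t in Ioc 0 (r n), EE (x u) t) ∂μ) / ENNReal.ofReal (r n) := by
      simp only [g, div_eq_mul_inv]
      rw [lintegral_mul_const _ (hmeas n)]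
    rw [e1, ENNReal.le_div_iff_mul_le (Or.inl (hr0 n)) (Or.inl ENNReal.ofReal_ne_top)]
    rw [lintegral_lintegral_swap]
    · calc ε * ENNReal.ofReal (r n) = ∫⁻ t in Ioc 0 (r n), ε := by simp
        _ ≤ _ := by
          refine setLIntegral_mono' measurableSet_Ioc fun t ht => hcon t ⟨ht.1, ht.2.trans (hrle n)⟩
    · exact (EE_meas.comp ((hx.comp measurable_fst).prodMk measurable_snd)).aemeasurable
  have := ge_of_tendsto hlim (Eventually.of_forall hge)
  simp at this
  exact hε.ne' this

lemma AS.sphere {z : ℝ → ℂ} {W D : Set ℂ} (h : AS z W D) {w : ℂ} (hw : w ∈ z '' Icc 0 1) {t : ℝ}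
    (ht : 0 < t) : ∃ y ∈ W, ‖y - w‖ = t := by
  obtain ⟨R, hR⟩ := h.Wfar
  obtain ⟨a, ha1, ha2⟩ := mem_closure_iff.1 (h.KW hw) _ Metric.isOpen_ball (Metric.mem_ball_self ht)
  rw [Metric.mem_ball, dist_eq_norm] at ha1
  let b : ℂ := ((|R| + ‖w‖ + t : ℝ) : ℂ)
  have hb0 : ‖b‖ = |R| + ‖w‖ + t := by
    simp only [b]
    rw [norm_real, Real.norm_of_nonneg (by positivity)]
  have hb : b ∈ W := hR _ (by rw [hb0]; linarith [le_abs_self R, norm_nonneg w])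
  have hbt : t ≤ ‖b - w‖ := by
    have := norm_sub_norm_le b w
    have := abs_nonneg R
    linarith
  have := (h.Wc.image (fun y => ‖y - w‖) (by fun_prop)).ordConnected.out ⟨a, ha2, rfl⟩ ⟨b, hb, rfl⟩
    ⟨ha1.le, hbt⟩
  obtain ⟨y, hy, e⟩ := this
  exact ⟨y, hy, e⟩

lemma LJ.fib {z : ℝ → ℂ} (h : LJ z) (w : ℂ) : ∀ᵐ u ∂nuI, z u ≠ w := by
  have hs : (z ⁻¹' {w} ∩ Ico 0 1).Subsingleton := fun x hx y hy =>
    h.inj hx.2 hy.2 (by rw [hx.1, hy.1])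
  have h1 : volume (z ⁻¹' {w} ∩ Ico 0 1 ∪ {1}) = 0 :=
    (hs.finite.union (finite_singleton 1)).measure_zero _
  rw [ae_restrict_iff' measurableSet_Ioc]
  rw [measure_eq_zero_iff_ae_notMem] at h1
  filter_upwards [h1] with u hu hu1 hz
  apply hu
  rcases eq_or_lt_of_le hu1.2 with h2 | h2
  · exact Or.inr h2
  · exact Or.inl ⟨hz, hu1.1.le, h2⟩

lemma RM.pot_K {z : ℝ → ℂ} {W D : Set ℂ} (h : AS z W D) {w : ℂ} (hw : w ∈ D) {μ : Measure ℝ}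
    (hμ : RM z w μ) {w₀ : ℂ} (hw₀ : w₀ ∈ z '' Icc 0 1) :
    Integrable (fun u => Real.log ‖z u - w₀‖) μ ∧
    ∫ u, Real.log ‖z u - w₀‖ ∂μ = Real.log ‖w - w₀‖ := by
  have := hμ.fin
  obtain ⟨R, hR⟩ := h.lj.bdd
  have hfib : ∀ᵐ u ∂μ, z u ≠ w₀ := hμ.ac.ae_le (h.lj.fib w₀)
  have hmz : ∀ y, Measurable (fun u => ‖z u - y‖) := fun y => (h.lj.cont.measurable.sub_const y).norm
  have hml : ∀ y, Measurable (fun u => Real.log ‖z u - y‖) := fun y => Real.measurable_log.comp (hmz y)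
  have hpos : ∀ᵐ u ∂μ, 0 < ‖z u - w₀‖ := by
    filter_upwards [hfib] with u hu using norm_pos_iff.2 (sub_ne_zero.2 hu)
  have hch : ∀ n : ℕ, ∃ t ∈ Ioc (0:ℝ) (1 / (n + 1)), ∫⁻ u, EE ‖z u - w₀‖ t ∂μ < ENNReal.ofReal (1 / (n + 1)) :=
    fun n => carl μ (hmz w₀) hpos (by simp; positivity) (by positivity)
  choose t ht hI using hch
  choose y hyW hyt using fun n => h.sphere hw₀ (ht n).1
  have htl : Tendsto t atTop (𝓝 0) := squeeze_zero (fun n => (ht n).1.le) (fun n => (ht n).2)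
    tendsto_one_div_add_atTop_nhds_zero_nat
  have hyl : Tendsto y atTop (𝓝 w₀) := by
    rw [tendsto_iff_norm_sub_tendsto_zero]
    simpa only [hyt] using htl
  have ht1 : ∀ n, t n ≤ 1 := fun n => (ht n).2.trans (by
    rw [div_le_one (by positivity)]; have : (0:ℝ) ≤ n := by positivity
    linarith)
  have hww : w - w₀ ≠ 0 := fun e => Set.disjoint_left.1 h.DK hw (sub_eq_zero.1 e ▸ hw₀)
  have hpot : ∀ n, ∫ u, Real.log ‖z u - y n‖ ∂μ = Real.log ‖w - y n‖ := fun n => hμ.pot_W h hw (hyW n)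
  have hlogl : Tendsto (fun n => Real.log ‖w - y n‖) atTop (𝓝 (Real.log ‖w - w₀‖)) :=
    ((tendsto_const_nhds.sub hyl).norm).log (norm_ne_zero_iff.2 hww)
  let C := Real.log (R + ‖w₀‖ + 1)
  have hR0 : 0 ≤ R := (norm_nonneg _).trans (hR 0)
  have hup : ∀ u v, ‖v - w₀‖ ≤ 1 → z u ≠ v → Real.log ‖z u - v‖ ≤ C := by
    intro u v hv hne
    apply Real.log_le_log (norm_pos_iff.2 (sub_ne_zero.2 hne))
    have h1 : ‖z u - v‖ ≤ ‖z u‖ + ‖v‖ := norm_sub_le _ _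
    have h2 : ‖v‖ ≤ ‖v - w₀‖ + ‖w₀‖ := by simpa using norm_add_le (v - w₀) w₀
    linarith [hR u]
  have hyK : ∀ n u, z u ≠ y n := fun n u e =>
    Set.disjoint_left.1 h.WK (hyW n) (e ▸ h.lj.clamp u)
  have hintn : ∀ n, Integrable (fun u => Real.log ‖z u - y n‖) μ := by
    intro n
    obtain ⟨δ, hδ, hl⟩ := h.lj.low (Set.disjoint_left.1 h.WK (hyW n))
    refine (integrable_const (max |Real.log δ| |C|)).mono' (hml _).aestronglyMeasurable ?_
    refine Eventually.of_forall fun u => ?_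
    exact abs_le_max_abs_abs (Real.log_le_log hδ (hl u)) (hup u _ (by rw [hyt]; exact ht1 n) (hyK n u))
  -- Fatou
  have hf : ∀ n, ∫⁻ u, ENNReal.ofReal (C - Real.log ‖z u - y n‖) ∂μ =
      ENNReal.ofReal (C - Real.log ‖w - y n‖) := by
    intro n
    rw [← ofReal_integral_eq_lintegral_ofReal
      (f := fun u => C - Real.log ‖z u - y n‖) ((integrable_const C).sub (hintn n))
      (Eventually.of_forall fun u => sub_nonneg.2 (hup u _ (by rw [hyt]; exact ht1 n) (hyK n u))),
      integral_sub (integrable_const C) (hintn n), hpot, integral_const, hμ.mass, one_smul]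
  have hfat : ∫⁻ u, ENNReal.ofReal (C - Real.log ‖z u - w₀‖) ∂μ ≤
      ENNReal.ofReal (C - Real.log ‖w - w₀‖) := by
    have h1 : ∫⁻ u, ENNReal.ofReal (C - Real.log ‖z u - w₀‖) ∂μ =
        ∫⁻ u, liminf (fun n => ENNReal.ofReal (C - Real.log ‖z u - y n‖)) atTop ∂μ := by
      apply lintegral_congr_ae
      filter_upwards [hfib] with u hu
      refine (Tendsto.liminf_eq ?_).symm
      refine (ENNReal.continuous_ofReal.tendsto _).comp (tendsto_const_nhds.sub ?_)
      exact ((tendsto_const_nhds.sub hyl).norm).log (norm_ne_zero_iff.2 (sub_ne_zero.2 hu))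
    rw [h1]
    refine (lintegral_liminf_le fun n => ((hml (y n)).const_sub C).ennreal_ofReal).trans ?_
    simp only [hf]
    refine le_of_eq (Tendsto.liminf_eq ?_)
    exact (ENNReal.continuous_ofReal.tendsto _).comp (tendsto_const_nhds.sub hlogl)
  have hnn : ∀ᵐ u ∂μ, 0 ≤ C - Real.log ‖z u - w₀‖ := by
    filter_upwards [hfib] with u hu using sub_nonneg.2 (hup u _ (by simp) hu)
  have hintC : Integrable (fun u => C - Real.log ‖z u - w₀‖) μ := by
    refine ⟨((hml w₀).const_sub C).aestronglyMeasurable, ?_⟩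
    rw [hasFiniteIntegral_iff_ofReal hnn]
    exact hfat.trans_lt ENNReal.ofReal_lt_top
  have hint : Integrable (fun u => Real.log ‖z u - w₀‖) μ := by
    have := (integrable_const (μ := μ) C).sub hintC
    refine this.congr (Eventually.of_forall fun u => ?_)
    simp
  refine ⟨hint, le_antisymm ?_ ?_⟩
  · have hle : ∀ n, (∫ u, Real.log ‖z u - w₀‖ ∂μ) - Real.log ‖w - y n‖ ≤ 1 / (n + 1) := by
      intro n
      rw [← hpot n, ← integral_sub hint (hintn n)]
      have h1 : ∫⁻ u, ENNReal.ofReal (Real.log ‖z u - w₀‖ - Real.log ‖z u - y n‖) ∂μ ≤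
          ENNReal.ofReal (1 / (n + 1)) := by
        refine le_trans (lintegral_mono_ae ?_) (hI n).le
        filter_upwards [hfib] with u hu
        unfold EE
        split_ifs with hc
        · exact le_top
        · apply ENNReal.ofReal_le_ofReal
          gcongr ?_ - ?_
          rw [← Real.log_abs]
          apply Real.log_le_log (abs_pos.2 (sub_ne_zero.2 hc))
          rw [← hyt n]
          have := abs_norm_sub_norm_le (z u - w₀) (y n - w₀)
          simpa using this
      rw [integral_eq_lintegral_pos_part_sub_lintegral_neg_part
        (f := fun u => Real.log ‖z u - w₀‖ - Real.log ‖z u - y n‖) (hint.sub (hintn n))]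
      have h2 := ENNReal.toReal_mono ENNReal.ofReal_ne_top h1
      rw [ENNReal.toReal_ofReal (by positivity)] at h2
      refine (sub_le_self _ ENNReal.toReal_nonneg).trans h2
    have hl2 : Tendsto (fun n : ℕ => (∫ u, Real.log ‖z u - w₀‖ ∂μ) - Real.log ‖w - y n‖) atTop
        (𝓝 ((∫ u, Real.log ‖z u - w₀‖ ∂μ) - Real.log ‖w - w₀‖)) := tendsto_const_nhds.sub hlogl
    have := le_of_tendsto_of_tendsto' hl2 tendsto_one_div_add_atTop_nhds_zero_nat hle
    linarith
  · have h3 := integral_sub (integrable_const (μ := μ) C) hint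
    rw [integral_const, hμ.mass, one_smul] at h3
    rw [← ofReal_integral_eq_lintegral_ofReal hintC hnn, h3] at hfat
    have h4 : 0 ≤ C - Real.log ‖w - w₀‖ := by
      refine ge_of_tendsto (tendsto_const_nhds.sub hlogl) (Eventually.of_forall fun n => ?_)
      rw [← hpot n]
      have := integral_mono (hintn n) (integrable_const C)
        (fun u => hup u _ (by rw [hyt]; exact ht1 n) (hyK n u))
      rw [integral_const, hμ.mass, one_smul] at this
      linarith
    have := (ENNReal.ofReal_le_ofReal_iff h4).1 hfat
    linarith

end Carl
end CD

set_option linter.unusedSectionVars false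

namespace CD
section ThmR
open Set Topology Complex Polynomial

lemma RM.sym {z : ℝ → ℂ} {W D : Set ℂ} (h : AS z W D) {w : ℂ} (hw : w ∈ D) {μ ν : Measure ℝ}
    (hμ : RM z 0 μ) (hν : RM z w ν) :
    ∫ u, Real.log ‖z u - w‖ ∂μ = ∫ v, Real.log ‖z v‖ ∂ν := by
  have := hμ.fin
  have := hν.fin
  obtain ⟨R, hR⟩ := h.lj.bdd
  have hR0 : 0 ≤ R := (norm_nonneg _).trans (hR 0)
  obtain ⟨δ, hδ, hl⟩ := h.lj.low (Set.disjoint_left.1 h.DK hw)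
  have h1 : ∀ u, Integrable (fun v => Real.log ‖z v - z u‖) ν ∧
      ∫ v, Real.log ‖z v - z u‖ ∂ν = Real.log ‖z u - w‖ := by
    intro u
    rw [norm_sub_rev (z u) w]
    exact hν.pot_K h hw (h.lj.clamp u)
  have h2 : ∀ v, ∫ u, Real.log ‖z v - z u‖ ∂μ = Real.log ‖z v‖ := by
    intro v
    have := (hμ.pot_K h h.D0 (h.lj.clamp v)).2
    simpa [norm_sub_rev] using this
  simp_rw [← h2]
  simp_rw [← (h1 _).2]
  apply integral_integral_swap
  have hm : AEStronglyMeasurable (Function.uncurry fun u v => Real.log ‖z v - z u‖) (μ.prod ν) := by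
    refine (Real.measurable_log.comp ?_).aestronglyMeasurable
    exact ((h.lj.cont.comp continuous_snd).sub (h.lj.cont.comp continuous_fst)).norm.measurable
  rw [integrable_prod_iff hm]
  refine ⟨Eventually.of_forall fun u => (h1 u).1, ?_⟩
  let C := Real.log (2 * R + 1)
  have hC : 0 ≤ C := Real.log_nonneg (by linarith)
  have hup : ∀ u v, Real.log ‖z v - z u‖ ≤ C := by
    intro u v
    rcases eq_or_ne (z v) (z u) with e | e
    · simpa [e] using hC
    · apply Real.log_le_log (norm_pos_iff.2 (sub_ne_zero.2 e))
      linarith [norm_sub_le (z v) (z u), hR u, hR v]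
  refine (integrable_const (2 * C - Real.log δ)).mono' hm.norm.integral_prod_right' ?_
  refine Eventually.of_forall fun u => ?_
  rw [Real.norm_of_nonneg (integral_nonneg fun _ => norm_nonneg _)]
  have h3 : ∫ v, ‖Real.log ‖z v - z u‖‖ ∂ν ≤ ∫ v, (2 * C - Real.log ‖z v - z u‖) ∂ν := by
    refine integral_mono (h1 u).1.norm ((integrable_const _).sub (h1 u).1) fun v => ?_
    have := hup u v
    simp only [Real.norm_eq_abs]
    rw [abs_le]
    constructor <;> linarith
  rw [integral_sub (integrable_const _) (h1 u).1, (h1 u).2, integral_const, hν.mass, one_smul] at h3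
  have := Real.log_le_log hδ (hl u)
  simp only [Function.uncurry]
  linarith

lemma LJ.ftc_comp {z : ℝ → ℂ} (h : LJ z) {f : ℂ → ℂ} (hf : Differentiable ℂ f) :
    ∫ u, deriv f (z u) * deriv z u ∂nuI = 0 := by
  obtain ⟨K, hK⟩ := h.lip
  obtain ⟨R, hR⟩ := h.bdd
  have hcd : Continuous (deriv f) := hf.contDiff.continuous_deriv (n := 1) le_rfl
  obtain ⟨C, hC⟩ := (isCompact_closedBall (0:ℂ) R).exists_bound_of_continuousOn hcd.continuousOn
  have hlip : LipschitzOnWith C.toNNReal f (Metric.closedBall 0 R) := by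
    refine (convex_closedBall 0 R).lipschitzOnWith_of_nnnorm_deriv_le (fun x _ => hf x) fun x hx => ?_
    rw [← NNReal.coe_le_coe, coe_nnnorm]
    exact (hC x hx).trans (Real.le_coe_toNNReal C)
  have hl2 : LipschitzWith (C.toNNReal * K) (f ∘ z) := by
    have := hlip.comp (s := univ) hK.lipschitzOnWith (fun u _ => by simpa using hR u)
    exact lipschitzOnWith_univ.1 this
  have := CD.ftc hl2 0 1
  simp only [Function.comp, h.closed, sub_self] at this
  rw [← this, intervalIntegral.integral_of_le zero_le_one]
  apply integral_congr_ae
  filter_upwards [ae_restrict_of_ae hK.ae_differentiableAt_real] with u hu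
  exact ((hf (z u)).hasDerivAt.comp u hu.hasDerivAt).deriv.symm

lemma LJ.poly_int {z : ℝ → ℂ} (h : LJ z) (p : ℂ[X]) : ∫ u, p.eval (z u) * deriv z u ∂nuI = 0 := by
  have hint : ∀ p : ℂ[X], Integrable (fun u => p.eval (z u) * deriv z u) nuI := by
    intro p
    obtain ⟨C, hC⟩ := poly_bd h.bdd p
    exact h.dint.bdd_mul (c := C) (p.continuous.comp h.cont).aestronglyMeasurable (Eventually.of_forall hC)
  induction p using Polynomial.induction_on' with
  | add p q hp hq =>
    simp only [eval_add, add_mul]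
    rw [integral_add (hint p) (hint q), hp, hq, add_zero]
  | monomial n a =>
    have := h.ftc_comp (f := fun x => a / (n + 1) * x ^ (n + 1)) (by fun_prop)
    rw [← this]
    congr 1
    ext u
    have hn : (n:ℂ) + 1 ≠ 0 := by exact_mod_cast n.succ_ne_zero
    simp
    field_simp
    simp

lemma LJ.poly_wn {z : ℝ → ℂ} (h : LJ z) {w : ℂ} (hw : w ∉ z '' Icc 0 1) (p : ℂ[X]) :
    ∫ u, p.eval (z u) * (deriv z u / (z u - w)) ∂nuI = (2 * π * I * wn z w) * p.eval w := by
  obtain ⟨q, hq⟩ : X - C w ∣ p - C (p.eval w) := by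
    rw [dvd_iff_isRoot]; simp
  have hp : ∀ x, p.eval x = p.eval w + (x - w) * q.eval x := by
    intro x
    have := congrArg (eval x) hq
    simp at this
    linear_combination this
  have e : ∀ u, p.eval (z u) * (deriv z u / (z u - w)) =
      p.eval w * (deriv z u / (z u - w)) + q.eval (z u) * deriv z u := by
    intro u
    have := h.ne hw u
    rw [hp (z u)]
    field_simp
  have hi1 : Integrable (fun u => deriv z u / (z u - w)) nuI := by
    have := h.kint hw 0 1
    exact (intervalIntegrable_iff_integrableOn_Ioc_of_le zero_le_one).1 this
  have hi2 : Integrable (fun u => q.eval (z u) * deriv z u) nuI := by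
    obtain ⟨C, hC⟩ := poly_bd h.bdd q
    exact h.dint.bdd_mul (c := C) (q.continuous.comp h.cont).aestronglyMeasurable (Eventually.of_forall hC)
  simp only [e]
  rw [integral_add (hi1.const_mul _) hi2, h.poly_int, integral_const_mul, add_zero, wn, cau,
    mul_div_cancel₀ _ tpi, mul_comm]

lemma LJ.rep_of {z : ℝ → ℂ} (h : LJ z) {w : ℂ} {A : Set ℝ} {g : ℝ → ℂ}
    (hg : Measurable g) (hgb : ∃ C, ∀ u, ‖g u‖ ≤ C) {c : ℂ} (hc : c ≠ 0)
    (hm : ∀ p : ℂ[X], ∫ u, p.eval (z u) * g u ∂(nuI.restrict A) = c * p.eval w) :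
    ∃ ρ : ℝ → ℝ, (∀ u, 0 ≤ ρ u) ∧ Integrable ρ (nuI.restrict A) ∧
      ∀ p : ℂ[X], ∫ u, p.eval (z u) * ρ u ∂(nuI.restrict A) = p.eval w := by
  rcases lemQ (nuI.restrict A) h.cont h.bdd w with ⟨p, hp0, hp⟩ | hr
  · exfalso
    have h1 := hp g hg hgb
    simp only [hm, hp0, mul_zero] at h1
    have h2 := hm 1
    simp only [eval_one, one_mul, mul_one] at h2
    rw [h2] at h1
    exact hc (tendsto_nhds_unique h1 tendsto_const_nhds)
  · exact hr

lemma wd_int {ν : Measure ℝ} {ρ : ℝ → ℝ} (h0 : ∀ u, 0 ≤ ρ u) (hi : Integrable ρ ν) (f : ℝ → ℂ) :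
    ∫ u, f u ∂(ν.withDensity fun u => ENNReal.ofReal (ρ u)) = ∫ u, f u * ρ u ∂ν := by
  rw [integral_withDensity_eq_integral_toReal_smul₀ hi.aemeasurable.ennreal_ofReal
    (Eventually.of_forall fun _ => ENNReal.ofReal_lt_top)]
  congr 1
  ext u
  rw [ENNReal.toReal_ofReal (h0 u), real_smul, mul_comm]

lemma rm_of {z : ℝ → ℂ} {w : ℂ} {A : Set ℝ} {ρ : ℝ → ℝ} (h0 : ∀ u, 0 ≤ ρ u)
    (hi : Integrable ρ (nuI.restrict A))
    (hm : ∀ p : ℂ[X], ∫ u, p.eval (z u) * ρ u ∂(nuI.restrict A) = p.eval w) :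
    RM z w ((nuI.restrict A).withDensity fun u => ENNReal.ofReal (ρ u)) := by
  refine ⟨?_, ?_, fun p => by rw [wd_int h0 hi, hm]⟩
  · exact isFiniteMeasure_withDensity_ofReal hi.2
  · exact (withDensity_absolutelyContinuous _ _).trans Measure.restrict_le_self.absolutelyContinuous

lemma AS.rm_full {z : ℝ → ℂ} {W D : Set ℂ} (h : AS z W D) {w : ℂ} (hw : w ∈ D) : ∃ μ, RM z w μ := by
  have hwK := Set.disjoint_left.1 h.DK hw
  obtain ⟨C, hC⟩ := h.lj.kbd hwK
  obtain ⟨ρ, h0, hi, hm⟩ := h.lj.rep_of (A := univ) (w := w) (h.lj.kmeas w) ⟨C, hC⟩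
    (mul_ne_zero tpi (h.wn_ne hw)) (fun p => by rw [Measure.restrict_univ]; exact h.lj.poly_wn hwK p)
  exact ⟨_, rm_of h0 hi hm⟩

lemma TT_inj {a b : ℂ} (h : TT a = TT b) : a = b := by
  have h1 := congrArg (fun f => f 1) h
  have h2 := congrArg (fun f => f I) h
  simp [TT_apply] at h1 h2
  exact Complex.ext h1 h2

lemma AS.ae {z : ℝ → ℂ} {W D : Set ℂ} (h : AS z W D) {g : ℝ → ℂ} (hg : Integrable g nuI)
    (hD : ∀ w ∈ D, cau nuI z g w = 0) (hW : ∀ w ∈ W, cau nuI z g w = 0) : g =ᵐ[nuI] 0 := by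
  apply uniq h.lj hg
  have := h.lj.area
  rw [measure_eq_zero_iff_ae_notMem] at this
  filter_upwards [this] with w hw
  rcases h.cover w with h1 | h1 | h1
  · exact hW w h1
  · exact hD w h1
  · exact (hw h1).elim

lemma AS.no_AB {z : ℝ → ℂ} {W D : Set ℂ} (h : AS z W D) {A : Set ℝ} (hA : MeasurableSet A)
    {ρ σ : ℝ → ℝ} (hρ0 : ∀ u, 0 ≤ ρ u) (hρ : Integrable ρ (nuI.restrict A))
    (hρm : ∀ p : ℂ[X], ∫ u, p.eval (z u) * ρ u ∂(nuI.restrict A) = p.eval 0)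
    (hσ0 : ∀ u, 0 ≤ σ u) (hσ : Integrable σ (nuI.restrict Aᶜ))
    (hσm : ∀ p : ℂ[X], ∫ u, p.eval (z u) * σ u ∂(nuI.restrict Aᶜ) = p.eval 0) : False := by
  have hμ := rm_of hρ0 hρ hρm
  have hν := rm_of hσ0 hσ hσm
  set μ := (nuI.restrict A).withDensity fun u => ENNReal.ofReal (ρ u) with hμd
  set ν := (nuI.restrict Aᶜ).withDensity fun u => ENNReal.ofReal (σ u) with hνd
  have := hμ.fin
  have := hν.fin
  have hoff : ∀ S : Set ℂ, IsOpen S → Disjoint S (z '' Icc 0 1) →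
      (∀ w ∈ S, ∫ u, Real.log ‖z u - w‖ ∂μ = ∫ u, Real.log ‖z u - w‖ ∂ν) →
      ∀ w ∈ S, cau μ z 1 w = cau ν z 1 w := by
    intro S hS hSK he w hw
    have h1 := h.lj.pot_fd μ (Set.disjoint_left.1 hSK hw)
    have h2 := h.lj.pot_fd ν (Set.disjoint_left.1 hSK hw)
    have h3 : (fun w => ∫ u, Real.log ‖z u - w‖ ∂μ) =ᶠ[𝓝 w] fun w => ∫ u, Real.log ‖z u - w‖ ∂ν := by
      filter_upwards [hS.mem_nhds hw] with x hx using he x hx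
    have h4 := (h2.congr_of_eventuallyEq h3).unique h1
    have := TT_inj h4
    rw [neg_inj] at this
    exact this.symm
  have hW := hoff W h.Wo h.WK fun w hw => by rw [hμ.pot_W h h.D0 hw, hν.pot_W h h.D0 hw]
  have hD := hoff D h.Do h.DK fun w hw => by
    obtain ⟨τ, hτ⟩ := h.rm_full hw
    rw [RM.sym h hw hμ hτ, RM.sym h hw hν hτ]
  let f : ℝ → ℂ := A.indicator fun u => (ρ u : ℂ)
  let g : ℝ → ℂ := Aᶜ.indicator fun u => (σ u : ℂ)
  have hf : Integrable f nuI := (integrable_indicator_iff hA).2 hρ.ofReal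
  have hg : Integrable g nuI := (integrable_indicator_iff hA.compl).2 hσ.ofReal
  have ind : ∀ (S : Set ℝ) (τ : ℝ → ℝ) (w : ℂ) (u : ℝ), S.indicator (fun u => (τ u : ℂ)) u / (z u - w) =
      S.indicator (fun u => 1 / (z u - w) * (τ u : ℂ)) u := by
    intro S τ w u
    by_cases hu : u ∈ S <;> simp [hu, div_eq_mul_inv, mul_comm]
  have hcf : ∀ w, cau nuI z f w = cau μ z 1 w := by
    intro w
    rw [cau, cau, hμd, wd_int hρ0 hρ]
    simp only [f, ind]
    rw [integral_indicator hA]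
    simp
  have hcg : ∀ w, cau nuI z g w = cau ν z 1 w := by
    intro w
    rw [cau, cau, hνd, wd_int hσ0 hσ]
    simp only [g, ind]
    rw [integral_indicator hA.compl]
    simp
  have hsub : ∀ w, w ∉ z '' Icc 0 1 → cau nuI z (f - g) w = cau nuI z f w - cau nuI z g w := by
    intro w hw
    obtain ⟨δ, hδ, hl⟩ := h.lj.low hw
    have hi : ∀ f : ℝ → ℂ, Integrable f nuI → Integrable (fun u => f u / (z u - w)) nuI := by
      intro f hf
      simp only [div_eq_mul_inv]
      refine hf.mul_bdd (c := δ⁻¹) ((h.lj.cont.measurable.sub_const w).inv.aestronglyMeasurable) ?_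
      refine Eventually.of_forall fun u => ?_
      rw [norm_inv]
      exact inv_anti₀ hδ (hl u)
    rw [cau, cau, cau, ← integral_sub (hi f hf) (hi g hg)]
    simp [sub_div]
  have hz := h.ae (hf.sub hg)
    (fun w hw => by rw [hsub w (Set.disjoint_left.1 h.DK hw), hcf, hcg, hD w hw, sub_self])
    (fun w hw => by rw [hsub w (Set.disjoint_left.1 h.WK hw), hcf, hcg, hW w hw, sub_self])
  have h1 := hρm 1
  simp only [eval_one, one_mul] at h1
  rw [← integral_indicator hA] at h1
  have h2 : f =ᵐ[nuI] 0 := by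
    filter_upwards [hz] with u hu
    by_cases hu1 : u ∈ A
    · have : g u = 0 := indicator_of_notMem (by simpa using hu1) _
      simpa [this] using hu
    · exact indicator_of_notMem hu1 _
  rw [integral_congr_ae h2] at h1
  simp at h1

end ThmR
end CD

set_option linter.unusedSectionVars false

namespace CD
section ThmR2
open Set Topology Complex Polynomial

lemma AS.thmR {z : ℝ → ℂ} {W D : Set ℂ} (h : AS z W D) {A : Set ℝ} (hA : MeasurableSet A) {c : ℂ}
    (hc : c ≠ 0)
    (hm : ∀ p : ℂ[X], ∫ u, p.eval (z u) * (deriv z u / z u) ∂(nuI.restrict A) = c * p.eval 0) :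
    Aᶜ.indicator (deriv z) =ᵐ[nuI] 0 := by
  have h0K := Set.disjoint_left.1 h.DK h.D0
  have hz0 : ∀ u, z u ≠ 0 := fun u => by simpa using h.lj.ne h0K u
  obtain ⟨δ, hδ, hl⟩ := h.lj.low h0K
  obtain ⟨C0, hC0⟩ := h.lj.kbd h0K
  have hkm := h.lj.kmeas 0
  have hpw := h.lj.poly_wn h0K
  simp only [sub_zero] at hl hC0 hkm hpw
  obtain ⟨K, hK⟩ := h.lj.lip
  have hdb : ∀ u, ‖deriv z u‖ ≤ K := fun u => norm_deriv_le_of_lipschitz hK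
  have hzib : ∀ u, ‖(z u)⁻¹‖ ≤ δ⁻¹ := fun u => by rw [norm_inv]; exact inv_anti₀ hδ (hl u)
  have hzic : Continuous fun u => (z u)⁻¹ := h.lj.cont.inv₀ hz0
  obtain ⟨ρ, hρ0, hρi, hρm⟩ := h.lj.rep_of (A := A) (w := 0) hkm ⟨C0, hC0⟩ hc hm
  rcases lemQ (nuI.restrict Aᶜ) h.lj.cont h.lj.bdd 0 with ⟨q, hq0, hq⟩ | ⟨σ, hσ0, hσi, hσm⟩
  swap
  · exact (h.no_AB hA hρ0 hρi hρm hσ0 hσi hσm).elim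
  set ν := nuI.restrict Aᶜ with hν
  have hint : ∀ p : ℂ[X], Integrable (fun u => p.eval (z u) * (deriv z u / z u)) nuI := by
    intro p
    obtain ⟨C, hC⟩ := poly_bd h.lj.bdd p
    refine Integrable.bdd_mul (c := C) ?_ (p.continuous.comp h.lj.cont).aestronglyMeasurable (Eventually.of_forall hC)
    exact (integrable_const (C0:ℝ)).mono' hkm.aestronglyMeasurable (Eventually.of_forall hC0)
  have hP0 : ∀ p : ℂ[X], ∫ u, p.eval (z u) * deriv z u ∂ν = 0 := by
    intro p
    have h1 := integral_add_compl hA (hint (X * p))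
    rw [hpw, hm] at h1
    simp only [eval_mul, eval_X, zero_mul, mul_zero, zero_add] at h1
    rw [← h1]
    congr 1
    ext u
    have := hz0 u
    field_simp
  have hP : ∀ k : ℕ, ∀ p : ℂ[X], ∫ u, p.eval (z u) * ((z u)⁻¹ ^ k * deriv z u) ∂ν = 0 := by
    intro k
    induction k with
    | zero => simpa using hP0
    | succ k ih =>
      intro p
      have hb : ∃ C, ∀ u, ‖p.eval (z u) * ((z u)⁻¹ ^ (k + 1) * deriv z u)‖ ≤ C := by
        obtain ⟨C, hC⟩ := poly_bd h.lj.bdd p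
        refine ⟨C * (δ⁻¹ ^ (k+1) * K), fun u => ?_⟩
        rw [norm_mul, norm_mul, norm_pow]
        have hC0 : 0 ≤ C := (norm_nonneg _).trans (hC u)
        gcongr
        exacts [hC u, hzib u, hdb u]
      have hme : Measurable fun u => p.eval (z u) * ((z u)⁻¹ ^ (k + 1) * deriv z u) :=
        (p.continuous.comp h.lj.cont).measurable.mul ((hzic.measurable.pow_const _).mul (measurable_deriv z))
      have ht := hq _ hme hb
      refine tendsto_nhds_unique ht ?_
      have : ∀ n, ∫ u, (q n).eval (z u) * (p.eval (z u) * ((z u)⁻¹ ^ (k + 1) * deriv z u)) ∂ν = 0 := by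
        intro n
        obtain ⟨r, hr⟩ : X ∣ q n := by
          rw [X_dvd_iff, coeff_zero_eq_eval_zero, hq0]
        rw [← ih (r * p)]
        congr 1
        ext u
        have := hz0 u
        simp only [hr, eval_mul, eval_X]
        have e : z u * (z u)⁻¹ = 1 := mul_inv_cancel₀ this
        rw [pow_succ]
        linear_combination (eval (z u) r * eval (z u) p * deriv z u * (z u)⁻¹ ^ k) * e
      simp only [this]
      exact tendsto_const_nhds
  have hd : Integrable (deriv z) ν := h.lj.dint.restrict
  have hcW : ∀ w ∈ W, cau ν z (deriv z) w = 0 := by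
    intro w hw
    have := h.cau_W hd (c := 0) h.D0 (fun p => by rw [hP0, zero_mul]) hw
    simpa using this
  have hmi : ∀ p : ℂ[X], ∫ u, p.eval ((z u)⁻¹) * ((z u)⁻¹ * deriv z u) ∂ν = 0 * p.eval 0 := by
    intro p
    have hi : Integrable (fun u => (z u)⁻¹ * deriv z u) ν :=
      hd.bdd_mul (c := δ⁻¹) hzic.aestronglyMeasurable (Eventually.of_forall hzib)
    have hi2 : ∀ p : ℂ[X], Integrable (fun u => p.eval ((z u)⁻¹) * ((z u)⁻¹ * deriv z u)) ν := by
      intro p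
      obtain ⟨C, hC⟩ := poly_bd ⟨δ⁻¹, hzib⟩ p
      exact hi.bdd_mul (c := C) (p.continuous.comp hzic).aestronglyMeasurable (Eventually.of_forall hC)
    rw [zero_mul]
    induction p using Polynomial.induction_on' with
    | add p q hp hq =>
      simp only [eval_add, add_mul]
      rw [integral_add (hi2 p) (hi2 q), hp, hq, add_zero]
    | monomial n a =>
      rw [← hP (n + 1) (C a)]
      congr 1
      ext u
      simp only [eval_monomial, eval_C]
      ring
  have hi : Integrable (fun u => (z u)⁻¹ * deriv z u) ν :=
    hd.bdd_mul (c := δ⁻¹) hzic.aestronglyMeasurable (Eventually.of_forall hzib)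
  have hnear : ∀ᶠ w in 𝓝[≠] (0:ℂ), cau ν z (deriv z) w = 0 := by
    have h1 : ∀ᶠ w in 𝓝 (0:ℂ), ‖w‖ < δ := by
      filter_upwards [Metric.ball_mem_nhds (0:ℂ) hδ] with w hw
      simpa using hw
    filter_upwards [h1.filter_mono nhdsWithin_le_nhds, self_mem_nhdsWithin] with w hw hw0
    have hw0 : w ≠ 0 := hw0
    have hf := far hzic hzib hi (w := 0) (c := 0) (by simpa using hδ.le) hmi (w' := w⁻¹) (by
      rw [norm_inv]
      exact inv_strictAnti₀ (norm_pos_iff.2 hw0) hw)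
    rw [zero_div] at hf
    have e : cau ν z (deriv z) w = -w⁻¹ * cau ν (fun u => (z u)⁻¹) (fun u => (z u)⁻¹ * deriv z u) w⁻¹ := by
      rw [cau, cau, ← integral_const_mul]
      congr 1
      ext u
      have h2 := hz0 u
      have h3 : z u - w ≠ 0 := by
        intro h4
        rw [sub_eq_zero] at h4
        have := hl u
        rw [h4] at this
        linarith
      have h4 : (z u)⁻¹ - w⁻¹ ≠ 0 := by
        intro h5
        rw [sub_eq_zero, inv_inj] at h5
        exact h3 (sub_eq_zero.2 h5)
      rw [mul_div_assoc', div_eq_div_iff h3 h4]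
      field_simp
      ring
    rw [e, hf, mul_zero]
  have hcD : ∀ w ∈ D, cau ν z (deriv z) w = 0 := by
    intro w hw
    have := (cau_an h.lj hd h.Do h.DK).eqOn_of_preconnected_of_frequently_eq
      (g := fun _ => 0) analyticOnNhd_const h.Dc h.D0 hnear.frequently hw
    simpa using this
  have hce : ∀ w, cau nuI z (Aᶜ.indicator (deriv z)) w = cau ν z (deriv z) w := by
    intro w
    rw [cau, cau, hν, ← integral_indicator hA.compl]
    congr 1
    ext u
    by_cases hu : u ∈ Aᶜ <;> simp [indicator_of_mem, indicator_of_notMem, hu]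
  refine h.ae (h.lj.dint.indicator hA.compl) (fun w hw => ?_) fun w hw => ?_
  · rw [hce, hcD w hw]
  · rw [hce, hcW w hw]

lemma LJ.pow_deriv {z g : ℝ → ℂ} (h : LJ z) {ν : Measure ℝ} (hg : Integrable g ν) (k : ℕ) {w : ℂ}
    (hw : w ∉ z '' Icc 0 1) : HasDerivAt (fun w => ∫ u, g u * (z u - w)⁻¹ ^ (k + 1) ∂ν)
      (∫ u, (k + 1) * (g u * (z u - w)⁻¹ ^ (k + 2)) ∂ν) w := by
  obtain ⟨δ, hδ, hl⟩ := h.low hw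
  have hb : ∀ x ∈ Metric.ball w (δ / 2), ∀ u, δ / 2 ≤ ‖z u - x‖ := by
    intro x hx u
    have h1 := hl u
    have h2 : ‖x - w‖ < δ / 2 := by simpa [dist_eq_norm] using hx
    have h3 : ‖z u - w‖ ≤ ‖z u - x‖ + ‖x - w‖ := norm_sub_le_norm_sub_add_norm_sub _ _ _
    linarith
  have hbi : ∀ x ∈ Metric.ball w (δ / 2), ∀ u, ‖(z u - x)⁻¹‖ ≤ (δ / 2)⁻¹ := by
    intro x hx u
    rw [norm_inv]
    exact inv_anti₀ (by positivity) (hb x hx u)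
  have hm : ∀ (x : ℂ) (n : ℕ), AEStronglyMeasurable (fun u => (z u - x)⁻¹ ^ n) ν := fun x n =>
    ((h.cont.measurable.sub_const x).inv.pow_const n).aestronglyMeasurable
  refine (hasDerivAt_integral_of_dominated_loc_of_deriv_le
    (F := fun w u => g u * (z u - w)⁻¹ ^ (k + 1))
    (F' := fun w u => (k + 1) * (g u * (z u - w)⁻¹ ^ (k + 2)))
    (bound := fun u => (k + 1) * (‖g u‖ * (δ / 2)⁻¹ ^ (k + 2)))
    (Metric.ball_mem_nhds w (half_pos hδ)) ?_ ?_ ?_ ?_ ?_ ?_).2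
  · exact Eventually.of_forall fun x => hg.1.mul (hm x _)
  · refine hg.mul_bdd (c := (δ / 2)⁻¹ ^ (k + 1)) (hm w _) (Eventually.of_forall fun u => ?_)
    rw [norm_pow]
    exact pow_le_pow_left₀ (norm_nonneg _) (hbi w (Metric.mem_ball_self (half_pos hδ)) u) _
  · exact (hg.1.mul (hm w _)).const_mul _
  · refine Eventually.of_forall fun u x hx => ?_
    rw [norm_mul, norm_mul, norm_pow]
    have : ‖(k:ℂ) + 1‖ = k + 1 := by
      rw [← Nat.cast_succ, norm_natCast]; simp
    rw [this]
    gcongr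
    exact hbi x hx u
  · exact (hg.norm.mul_const _).const_mul _
  · refine Eventually.of_forall fun u x hx => ?_
    have hne : z u - x ≠ 0 := by
      rw [← norm_pos_iff]
      exact lt_of_lt_of_le (half_pos hδ) (hb x hx u)
    have h1 : HasDerivAt (fun x => (z u - x)⁻¹) ((z u - x)⁻¹ ^ 2) x := by
      have := ((hasDerivAt_id x).const_sub (z u)).inv hne
      refine HasDerivAt.congr_deriv (f := fun x => (z u - x)⁻¹) this ?_
      simp
    have := (h1.pow (k + 1)).const_mul (g u)
    refine this.congr_deriv ?_
    simp only [Nat.cast_add, Nat.cast_one, Nat.add_sub_cancel]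
    ring

lemma LJ.acr {z : ℝ → ℂ} (h : LJ z) {Om : Set ℂ} (ho : IsOpen Om) (hb : Bornology.IsBounded Om)
    (hfr : frontier Om = z '' Icc 0 1) (hne : Om.Nonempty) {A : Set ℝ} (hA : MeasurableSet A)
    (hw : ∀ w ∈ Om, ∫ u, deriv z u / (z u - w) ∂(nuI.restrict A) = 2 * π * I) :
    Aᶜ.indicator (deriv z) =ᵐ[nuI] 0 := by
  obtain ⟨a, ha⟩ := hne
  have hdk : Disjoint Om (z '' Icc 0 1) := by
    rw [← hfr, ho.frontier_eq]; exact disjoint_sdiff_right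
  have haK : a ∉ z '' Icc 0 1 := Set.disjoint_left.1 hdk ha
  obtain ⟨W, D, has⟩ := h.inv_as ho hb hfr ha
  have hd : Integrable (deriv z) (nuI.restrict A) := h.dint.restrict
  have hpow : ∀ k : ℕ, ∀ w ∈ Om, ∫ u, deriv z u * (z u - w)⁻¹ ^ (k + 2) ∂(nuI.restrict A) = 0 := by
    intro k
    have key : ∀ (k : ℕ) (c : ℂ), (∀ w ∈ Om, ∫ u, deriv z u * (z u - w)⁻¹ ^ (k + 1) ∂(nuI.restrict A) = c) →
        ∀ w ∈ Om, ∫ u, deriv z u * (z u - w)⁻¹ ^ (k + 2) ∂(nuI.restrict A) = 0 := by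
      intro k c hk w hwO
      have h1 := h.pow_deriv hd k (Set.disjoint_left.1 hdk hwO)
      have h2 := h1.congr_of_eventuallyEq (f₁ := fun _ => c) (by
        filter_upwards [ho.mem_nhds hwO] with x hx using (hk x hx).symm)
      have h3 := h2.unique (hasDerivAt_const w c)
      rw [integral_const_mul] at h3
      refine (mul_eq_zero.1 h3).resolve_left ?_
      exact_mod_cast k.succ_ne_zero
    induction k with
    | zero => exact key 0 _ (fun w hwO => by simpa [div_eq_mul_inv] using hw w hwO)
    | succ k ih => exact key (k + 1) 0 ih
  set ζ : ℝ → ℂ := fun u => (z u - a)⁻¹ with hζ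
  obtain ⟨K, hK⟩ := h.lip
  have hdz : ∀ᵐ u ∂nuI, deriv ζ u = -(ζ u) ^ 2 * deriv z u := by
    filter_upwards [ae_restrict_of_ae hK.ae_differentiableAt_real] with u hu
    have := ((hu.hasDerivAt.sub_const a).inv (h.ne haK u)).deriv
    change deriv ζ u = _ at this
    rw [this]
    simp only [hζ]
    have := h.ne haK u
    field_simp
  have hζ0 : ∀ u, ζ u ≠ 0 := fun u => inv_ne_zero (h.ne haK u)
  have hζi : ∀ p : ℂ[X], Integrable (fun u => p.eval (ζ u) * (ζ u * deriv z u)) (nuI.restrict A) := by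
    intro p
    obtain ⟨C, hC⟩ := poly_bd has.lj.bdd (p * X)
    have := hd.bdd_mul (c := C) ((p * X).continuous.comp has.lj.cont).aestronglyMeasurable (Eventually.of_forall hC)
    refine this.congr (Eventually.of_forall fun u => ?_)
    simp [hζ, mul_assoc]
  have hmom : ∀ p : ℂ[X], ∫ u, p.eval (ζ u) * (ζ u * deriv z u) ∂(nuI.restrict A) = (2 * π * I) * p.eval 0 := by
    intro p
    induction p using Polynomial.induction_on' with
    | add p q hp hq =>
      simp only [eval_add, add_mul]
      rw [integral_add (hζi p) (hζi q), hp, hq, mul_add]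
    | monomial n b =>
      rcases n with _ | n
      · rw [← hw a ha, mul_comm, eval_monomial, pow_zero, mul_one, ← integral_const_mul]
        congr 1
        ext u
        simp [hζ, div_eq_mul_inv, mul_comm]
      · have := hpow n a ha
        simp only [eval_monomial]
        rw [zero_pow n.succ_ne_zero, mul_zero, mul_zero, ← mul_zero b, ← this, ← integral_const_mul]
        congr 1
        ext u
        simp only [hζ]
        ring
  have hR := has.thmR hA (c := -(2 * π * I)) (neg_ne_zero.2 tpi) (by
    intro p
    rw [neg_mul, ← hmom p, ← integral_neg]
    apply integral_congr_ae
    filter_upwards [ae_restrict_of_ae hdz] with u hu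
    have := hζ0 u
    change p.eval (ζ u) * (deriv ζ u / ζ u) = _
    rw [hu]
    field_simp)
  filter_upwards [hR, hdz] with u hu hu2
  by_cases hA' : u ∈ Aᶜ
  · rw [indicator_of_mem hA'] at hu ⊢
    change deriv ζ u = 0 at hu
    rw [hu2] at hu
    simpa [hζ0 u] using hu
  · exact indicator_of_notMem hA' _

end ThmR2
end CD

set_option linter.unusedSectionVars false

namespace CD
section Reparam
open Set Topology Complex

lemma arclen {G : ℝ → ℂ} (hc : Continuous G) (hbv : BoundedVariationOn G univ) :
    ∃ V : ℝ → ℝ, Monotone V ∧ Continuous V ∧ V 0 = 0 ∧ ∀ x y, x ≤ y → dist (G x) (G y) ≤ V y - V x := by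
  have hl := hbv.locallyBoundedVariationOn
  refine ⟨variationOnFromTo G univ 0, ?_, ?_, variationOnFromTo.self _ _ _, ?_⟩
  · exact monotoneOn_univ.1 (variationOnFromTo.monotoneOn hl (mem_univ _))
  · rw [continuous_iff_continuousAt]
    intro b
    rw [continuousAt_iff_continuous_left'_right']
    have h1 := variationOnFromTo.tendsto_left (a := 0) (mem_univ _) (mem_univ b) hl (l := G b)
      (hc.continuousAt.mono_left nhdsWithin_le_nhds)
    have h2 := variationOnFromTo.tendsto_right (a := 0) (mem_univ _) (mem_univ b) hl (l := G b)
      (hc.continuousAt.mono_left nhdsWithin_le_nhds)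
    simp only [dist_self, sub_zero, add_zero, univ_inter] at h1 h2
    exact ⟨h1, h2⟩
  · intro x y hxy
    rw [variationOnFromTo.sub_right hl (mem_univ _) (mem_univ _) (mem_univ _),
      variationOnFromTo.eq_of_le _ _ hxy]
    exact (hbv.mono inter_subset_left).dist_le ⟨mem_univ _, le_rfl, hxy⟩ ⟨mem_univ _, hxy, le_rfl⟩

/-- reparametrisation data -/
structure RP (Γ γ : ℝ → ℂ) (A : Set ℝ) (s : ℝ → ℝ) (S : Set ℝ) : Prop where
  lj : LJ γ
  im : γ '' Icc 0 1 = Γ '' Icc 0 1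
  Am : MeasurableSet A
  Sm : MeasurableSet S
  S1 : S ⊆ Ioo 0 1
  S2 : volume (Ioo 0 1 \ S) = 0
  sA : s '' S = A
  A1 : A ⊆ Ioo 0 1
  inj : InjOn s S
  sd : ∀ t ∈ S, HasDerivAt s (deriv s t) t
  eq : ∀ t ∈ S, Γ t = γ (s t)
  eqd : ∀ᵐ t ∂(volume.restrict S), deriv Γ t = |deriv s t| • deriv γ (s t)

lemma RP.int {Γ γ : ℝ → ℂ} {A : Set ℝ} {s : ℝ → ℝ} {S : Set ℝ} (h : RP Γ γ A s S)
    {E : Type*} [NormedAddCommGroup E] [NormedSpace ℂ E] (f : ℂ → E) :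
    ∫ t in (0:ℝ)..1, deriv Γ t • f (Γ t) = ∫ u, deriv γ u • f (γ u) ∂(nuI.restrict A) := by
  let _ : NormedSpace ℝ E := NormedSpace.complexToReal
  have hA : A ∩ Ioc 0 1 = A := inter_eq_left.2 fun u hu => ⟨(h.A1 hu).1, (h.A1 hu).2.le⟩
  rw [nuI, Measure.restrict_restrict h.Am, hA, ← h.sA,
    integral_image_eq_integral_abs_deriv_smul h.Sm (fun t ht => (h.sd t ht).hasDerivWithinAt) h.inj]
  rw [intervalIntegral.integral_of_le zero_le_one, integral_Ioc_eq_integral_Ioo]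
  have : (Ioo (0:ℝ) 1 : Set ℝ) =ᵐ[volume] S := by
    have h1 := h.S2
    rw [measure_eq_zero_iff_ae_notMem] at h1
    filter_upwards [h1] with t ht
    apply propext
    constructor
    · intro h2
      by_contra h3
      exact ht ⟨h2, h3⟩
    · exact fun h2 => h.S1 h2
  rw [setIntegral_congr_set this]
  apply integral_congr_ae
  filter_upwards [h.eqd, ae_restrict_mem h.Sm] with t h1 h2
  rw [h1, h.eq t h2, smul_assoc]

lemma reparam {Γ : ℝ → ℂ} (hc : ContinuousOn Γ (Icc 0 1)) (hinj : InjOn Γ (Ico 0 1))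
    (hrect : eVariationOn Γ (Icc 0 1) ≠ ⊤) (hcl : Γ 0 = Γ 1) : ∃ γ A s S, RP Γ γ A s S := by
  let cl : ℝ → ℝ := fun t => max 0 (min 1 t)
  have clm : Monotone cl := fun x y h => max_le_max le_rfl (min_le_min le_rfl h)
  have clI : ∀ t, cl t ∈ Icc (0:ℝ) 1 := fun t => ⟨le_max_left _ _, max_le zero_le_one (min_le_left _ _)⟩
  have cle : ∀ t ∈ Icc (0:ℝ) 1, cl t = t := fun t ht => by simp [cl, ht.1, ht.2]
  have clc : Continuous cl := by fun_prop
  let G : ℝ → ℂ := Γ ∘ cl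
  have hG : Continuous G := hc.comp_continuous clc clI
  have hbv : BoundedVariationOn G univ :=
    ne_top_of_le_ne_top hrect (eVariationOn.comp_le_of_monotoneOn Γ cl (clm.monotoneOn _) fun t _ => clI t)
  obtain ⟨V, Vm, Vc, V0, Vd⟩ := arclen hG hbv
  let L := V 1 + 1
  have hL : 0 < L := by
    have := Vm (zero_le_one (α := ℝ))
    simp only [L]; linarith
  let s : ℝ → ℝ := fun t => (V t + t) / L
  have sm : StrictMono s := fun x y h => by
    have := Vm h.le
    exact div_lt_div_of_pos_right (by linarith) hL
  have sc : Continuous s := by fun_prop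
  have s0 : s 0 = 0 := by simp [s, V0]
  have s1 : s 1 = 1 := by simp only [s]; exact div_self hL.ne'
  have ss : Function.Surjective s := by
    apply sc.surjective
    · apply Tendsto.atTop_div_const hL
      refine tendsto_atTop_mono' _ ?_ tendsto_id
      filter_upwards [eventually_ge_atTop 0] with t ht
      have := Vm ht
      simp only [id]; linarith
    · apply Tendsto.atBot_div_const hL
      refine tendsto_atBot_mono' _ ?_ tendsto_id
      filter_upwards [eventually_le_atBot 0] with t ht
      have := Vm ht
      simp only [id]; linarith
  let e := sm.orderIsoOfSurjective s ss
  have es : ∀ t, e t = s t := fun t => rfl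
  let σ : ℝ → ℝ := e.symm
  have sσ : ∀ u, s (σ u) = u := fun u => e.apply_symm_apply u
  have σs : ∀ t, σ (s t) = t := fun t => e.symm_apply_apply t
  have σm : StrictMono σ := e.symm.strictMono
  have σ0 : σ 0 = 0 := by have := σs 0; rwa [s0] at this
  have σ1 : σ 1 = 1 := by have := σs 1; rwa [s1] at this
  let γ : ℝ → ℂ := G ∘ σ
  have γs : ∀ t, γ (s t) = G t := fun t => by simp only [γ, Function.comp, σs]
  have hGd : ∀ x y, dist (G x) (G y) ≤ L * dist (s x) (s y) := by
    intro x y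
    wlog hxy : x ≤ y generalizing x y
    · rw [dist_comm, dist_comm (s x)]
      exact this _ _ (le_of_not_ge hxy)
    rw [dist_comm (s x), Real.dist_eq, abs_of_nonneg (sub_nonneg.2 (sm.monotone hxy))]
    have : L * (s y - s x) = (V y - V x) + (y - x) := by
      simp only [s]; field_simp; ring
    rw [this]
    linarith [Vd x y hxy]
  have γl : LipschitzWith L.toNNReal γ := LipschitzWith.of_dist_le_mul fun u v => by
    have := hGd (σ u) (σ v)
    rwa [sσ, sσ, ← Real.coe_toNNReal L hL.le] at this
  have him : ∀ u, γ u ∈ Γ '' Icc 0 1 := fun u => ⟨_, clI _, rfl⟩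
  have σI : ∀ u ∈ Icc (0:ℝ) 1, σ u ∈ Icc (0:ℝ) 1 := fun u hu =>
    ⟨σ0 ▸ σm.monotone hu.1, σ1 ▸ σm.monotone hu.2⟩
  have sI : ∀ u ∈ Icc (0:ℝ) 1, s u ∈ Icc (0:ℝ) 1 := fun u hu =>
    ⟨s0 ▸ sm.monotone hu.1, s1 ▸ sm.monotone hu.2⟩
  have him2 : γ '' Icc 0 1 = Γ '' Icc 0 1 := by
    apply Subset.antisymm
    · rintro _ ⟨u, _, rfl⟩; exact him u
    · rintro _ ⟨t, ht, rfl⟩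
      exact ⟨s t, sI t ht, by rw [γs]; simp only [G, Function.comp, cle t ht]⟩
  have γeq : ∀ u ∈ Icc (0:ℝ) 1, γ u = Γ (σ u) := fun u hu => by
    simp only [γ, G, Function.comp, cle _ (σI u hu)]
  have hlj : LJ γ := by
    refine ⟨⟨_, γl⟩, ?_, ?_, fun u => by rw [him2]; exact him u⟩
    · rw [γeq 0 (by simp), γeq 1 (by simp), σ0, σ1, hcl]
    · intro u hu v hv huv
      rw [γeq u (Ico_subset_Icc_self hu), γeq v (Ico_subset_Icc_self hv)] at huv
      have h1 : ∀ u ∈ Ico (0:ℝ) 1, σ u ∈ Ico (0:ℝ) 1 := fun u hu =>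
        ⟨σ0 ▸ σm.monotone hu.1, σ1 ▸ σm hu.2⟩
      exact σm.injective (hinj (h1 u hu) (h1 v hv) huv)
  let S : Set ℝ := Ioo 0 1 ∩ {t | DifferentiableAt ℝ s t}
  have hSm : MeasurableSet S := measurableSet_Ioo.inter (measurableSet_of_differentiableAt ℝ s)
  have hsd : ∀ t ∈ S, HasDerivAt s (deriv s t) t := fun t ht => DifferentiableAt.hasDerivAt ht.2
  have hS2 : volume (Ioo 0 1 \ S) = 0 := by
    rw [measure_eq_zero_iff_ae_notMem]
    filter_upwards [sm.monotone.ae_differentiableAt] with t ht h1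
    exact h1.2 ⟨h1.1, ht⟩
  have hΓG : ∀ t ∈ Ioo (0:ℝ) 1, Γ =ᶠ[𝓝 t] G := by
    intro t ht
    filter_upwards [Ioo_mem_nhds ht.1 ht.2] with x hx
    simp only [G, Function.comp, cle x (Ioo_subset_Icc_self hx)]
  refine ⟨γ, s '' S, s, S, hlj, him2, ?_, hSm, inter_subset_left, hS2, rfl, ?_, sm.injective.injOn, hsd, ?_, ?_⟩
  · exact hSm.image_of_continuousOn_injOn sc.continuousOn sm.injective.injOn
  · rintro _ ⟨t, ht, rfl⟩
    exact ⟨s0 ▸ sm ht.1.1, s1 ▸ sm ht.1.2⟩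
  · intro t ht
    rw [γs]; exact (hΓG t ht.1).eq_of_nhds
  · let N : Set ℝ := {u | DifferentiableAt ℝ γ u}ᶜ
    have hN : MeasurableSet N := (measurableSet_of_differentiableAt ℝ γ).compl
    have hN0 : volume N = 0 := γl.ae_differentiableAt_real
    let T := S ∩ s ⁻¹' N
    have hT : MeasurableSet T := hSm.inter (sc.measurable hN)
    have h1 := lintegral_image_eq_lintegral_abs_deriv_mul hT
      (fun t ht => (hsd t ht.1).hasDerivWithinAt) sm.injective.injOn 1
    have h2 : volume (s '' T) = 0 := by
      refine measure_mono_null ?_ hN0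
      rintro _ ⟨t, ht, rfl⟩; exact ht.2
    simp only [Pi.one_apply, mul_one, lintegral_one, Measure.restrict_apply_univ] at h1
    rw [h2, eq_comm, lintegral_eq_zero_iff (by fun_prop)] at h1
    rw [EventuallyEq, ae_restrict_iff' hT] at h1
    rw [ae_restrict_iff' hSm]
    filter_upwards [h1] with t ht htS
    rw [(hΓG t htS.1).deriv_eq]
    have hs := hsd t htS
    have hs0 : 0 ≤ deriv s t := sm.monotone.deriv_nonneg
    rw [abs_of_nonneg hs0]
    by_cases htN : s t ∈ N
    · have h3 : deriv s t = 0 := by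
        have := ht ⟨htS, htN⟩
        simpa using this
      rw [h3] at hs ⊢
      rw [zero_smul]
      apply HasDerivAt.deriv
      rw [hasDerivAt_iff_isLittleO] at hs ⊢
      simp only [smul_zero, sub_zero] at hs ⊢
      refine Asymptotics.IsBigO.trans_isLittleO ?_ hs
      refine Asymptotics.IsBigO.of_bound L (Eventually.of_forall fun x => ?_)
      have := hGd x t
      rwa [dist_eq_norm, dist_eq_norm] at this
    · have h4 : DifferentiableAt ℝ γ (s t) := by
        by_contra h5; exact htN h5
      have h5 := h4.hasDerivAt.scomp t hs
      have h6 : γ ∘ s = G := funext γs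
      rw [h6] at h5
      exact h5.deriv

end Reparam
end CD

set_option linter.unusedSectionVars false

namespace CD
section Final
open Set Topology Complex

lemma cutoff (l : ℂ) : ∃ C : ℝ, 0 ≤ C ∧ ∀ r : ℝ, 0 < r → ∃ χ : ℂ → ℝ, ContDiff ℝ 1 χ ∧ (∀ w, χ w ∈ Icc (0:ℝ) 1) ∧
    (∀ w, ‖fderiv ℝ χ w‖ ≤ C / r) ∧ (∀ w, ‖w - l‖ ≤ r → χ w = 0) ∧ ∀ w, 2 * r ≤ ‖w - l‖ → χ w = 1 := by
  let b : ContDiffBump (0:ℂ) := ⟨1, 2, one_pos, one_lt_two⟩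
  have hbc : ContDiff ℝ 1 b := b.contDiff
  obtain ⟨C, hC⟩ := (hbc.continuous_fderiv (by norm_num)).bounded_above_of_compact_support
    (b.hasCompactSupport.fderiv (𝕜 := ℝ))
  have hC0 : 0 ≤ C := (norm_nonneg _).trans (hC 0)
  refine ⟨C, hC0, fun r hr => ⟨fun w => 1 - b (r⁻¹ • (w - l)), ?_, ?_, ?_, ?_, ?_⟩⟩
  · exact contDiff_const.sub (hbc.comp (by fun_prop))
  · intro w
    have h1 := b.nonneg' (r⁻¹ • (w - l))
    have h2 := b.le_one (x := r⁻¹ • (w - l))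
    constructor <;> linarith
  · intro w
    have hl : LipschitzWith C.toNNReal b := by
      refine lipschitzWith_of_nnnorm_fderiv_le (hbc.differentiable (by norm_num)) fun x => ?_
      rw [← NNReal.coe_le_coe, coe_nnnorm]
      exact (hC x).trans (Real.le_coe_toNNReal C)
    have hl2 : LipschitzWith (C / r).toNNReal fun w => 1 - b (r⁻¹ • (w - l)) := by
      refine LipschitzWith.of_dist_le_mul fun x y => ?_
      rw [dist_sub_left, Real.coe_toNNReal _ (by positivity)]
      refine (hl.dist_le_mul _ _).trans ?_
      rw [Real.coe_toNNReal _ hC0, dist_smul₀, dist_sub_right, Real.norm_of_nonneg (by positivity)]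
      apply le_of_eq
      field_simp
    have := norm_fderiv_le_of_lipschitz ℝ hl2 (x₀ := w)
    rwa [Real.coe_toNNReal _ (by positivity)] at this
  · intro w hw
    have : b (r⁻¹ • (w - l)) = 1 := by
      apply b.one_of_mem_closedBall
      rw [mem_closedBall_zero_iff, norm_smul, Real.norm_of_nonneg (by positivity)]
      change _ ≤ (1:ℝ)
      rw [inv_mul_le_iff₀ hr]; simpa using hw
    change 1 - b (r⁻¹ • (w - l)) = 0
    rw [this, sub_self]
  · intro w hw
    have : b (r⁻¹ • (w - l)) = 0 := by
      apply b.zero_of_le_dist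
      rw [dist_zero_right, norm_smul, Real.norm_of_nonneg (by positivity)]
      change (2:ℝ) ≤ _
      rw [le_inv_mul_iff₀ hr]; linarith
    change 1 - b (r⁻¹ • (w - l)) = 1
    rw [this, sub_zero]

lemma plateau {K U : Set ℂ} (hK : IsCompact K) (hU : IsOpen U) (hKU : K ⊆ U) :
    ∃ φ : ℂ → ℝ, ∃ t, IsCompact t ∧ t ⊆ U ∧ ContDiff ℝ 1 φ ∧ (∀ w ∈ K, ∀ᶠ x in 𝓝 w, φ x = 1) ∧
      (∀ x ∉ t, φ x = 0) ∧ ∀ w, φ w ∈ Icc (0:ℝ) 1 := by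
  obtain ⟨t, ht, h1, h2⟩ := exists_compact_between hK hU hKU
  obtain ⟨f, hf1, hf2, hf3⟩ := exists_contMDiffMap_one_nhds_of_subset_interior (n := 1)
    (modelWithCornersSelf ℝ ℂ) hK.isClosed h1
  refine ⟨f, t, ht, h2, f.contMDiff.contDiff, fun w hw => ?_, hf2, hf3⟩
  exact hf1.filter_mono (nhds_le_nhdsSet hw)

variable {E : Type*} [NormedAddCommGroup E] [NormedSpace ℂ E] [CompleteSpace E]

lemma dbar_mul {η : ℂ → ℝ} {F : ℂ → E} {w : ℂ} (hη : DifferentiableAt ℝ η w) (hF : DifferentiableAt ℂ F w) :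
    ‖dbar (fun x => η x • F x) w‖ ≤ ‖fderiv ℝ η w‖ * ‖F w‖ := by
  have hFr : HasFDerivAt F ((fderiv ℂ F w).restrictScalars ℝ) w := hF.hasFDerivAt.restrictScalars ℝ
  have h1 := hη.hasFDerivAt.smul hFr
  have h2 : fderiv ℝ (fun x => η x • F x) w = _ := h1.fderiv
  have h3 : fderiv ℂ F w I = I • fderiv ℂ F w 1 := by
    rw [← map_smul]; simp
  have h4 : dbar (fun x => η x • F x) w =
      (1/2 : ℂ) • ((fderiv ℝ η w 1) • F w + I • ((fderiv ℝ η w I) • F w)) := by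
    simp only [dbar, h2, add_apply, smul_apply,
      ContinuousLinearMap.coe_restrictScalars', ContinuousLinearMap.smulRight_apply, h3]
    congr 1
    rw [smul_add, smul_comm I (η w), smul_smul I I, I_mul_I]
    simp only [neg_smul, one_smul, smul_neg]
    abel
  rw [h4, norm_smul]
  have e1 : ‖fderiv ℝ η w 1‖ ≤ ‖fderiv ℝ η w‖ := by simpa using (fderiv ℝ η w).le_opNorm 1
  have e2 : ‖fderiv ℝ η w I‖ ≤ ‖fderiv ℝ η w‖ := by simpa using (fderiv ℝ η w).le_opNorm I
  have e3 := norm_add_le ((fderiv ℝ η w 1) • F w) (I • ((fderiv ℝ η w I) • F w))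
  rw [norm_smul, norm_smul, norm_smul, norm_I, one_mul] at e3
  have e4 := mul_le_mul_of_nonneg_right e1 (norm_nonneg (F w))
  have e5 := mul_le_mul_of_nonneg_right e2 (norm_nonneg (F w))
  have : ‖(1/2 : ℂ)‖ = 1/2 := by simp
  rw [this]
  linarith

lemma LJ.green {z : ℝ → ℂ} (h : LJ z) {Om : Set ℂ} (ho : IsOpen Om) (hb : Bornology.IsBounded Om)
    (hfr : frontier Om = z '' Icc 0 1) (hne : Om.Nonempty) (hwn : ∀ w ∈ Om, wn z w = 1) {ψ : ℂ → E}
    (hψ : ContDiff ℝ 1 ψ) (hc : HasCompactSupport ψ) :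
    (π : ℂ) • ∫ u, deriv z u • ψ (z u) ∂nuI = (2 * π * I) • ∫ w in Om, dbar ψ w := by
  rw [stokes nuI h.cont.measurable h.dint hψ hc, ← integral_smul, ← integral_indicator ho.measurableSet]
  apply integral_congr_ae
  have := h.area
  rw [measure_eq_zero_iff_ae_notMem] at this
  filter_upwards [this] with w hw
  have hcau : cau nuI z (deriv z) w = (2 * π * I) * wn z w := by
    rw [wn, mul_div_cancel₀ _ tpi]
  by_cases hwO : w ∈ Om
  · rw [indicator_of_mem hwO, hcau, hwn w hwO, mul_one]
  · rw [indicator_of_notMem hwO, hcau, h.wn_ext ho hb hfr hne, mul_zero, zero_smul]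
    rw [closure_eq_self_union_frontier, hfr]
    rintro (h1 | h1)
    exacts [hwO h1, hw h1]

lemma curve {Γ : ℝ → ℂ} {Ω : Set ℂ} (hc : ContinuousOn Γ (Icc 0 1)) (hinj : InjOn Γ (Ico 0 1))
    (hrect : eVariationOn Γ (Icc 0 1) ≠ ⊤) (hcl : Γ 0 = Γ 1)
    (ho : IsOpen Ω) (hb : Bornology.IsBounded Ω) (hfr : frontier Ω = Γ '' Icc 0 1) (hne : Ω.Nonempty)
    (hor : ∀ z ∈ Ω, (2 * π * I)⁻¹ * ∫ t in (0:ℝ)..1, deriv Γ t / (Γ t - z) = 1)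
    (F : ℂ → E) : ∃ z : ℝ → ℂ, LJ z ∧ frontier Ω = z '' Icc 0 1 ∧ (∀ w ∈ Ω, wn z w = 1) ∧
      ∫ t in (0:ℝ)..1, deriv Γ t • F (Γ t) = ∫ u, deriv z u • F (z u) ∂nuI := by
  obtain ⟨z, A, s, S, hR⟩ := reparam hc hinj hrect hcl
  have hfr' : frontier Ω = z '' Icc 0 1 := by rw [hR.im, hfr]
  have hAw : ∀ w ∈ Ω, ∫ u, deriv z u / (z u - w) ∂(nuI.restrict A) = 2 * π * I := by
    intro w hw
    have h1 := hR.int (fun x => (x - w)⁻¹)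
    simp only [smul_eq_mul, ← div_eq_mul_inv] at h1
    rw [← h1]
    have h2 := hor w hw
    rw [inv_mul_eq_iff_eq_mul₀ tpi, mul_one] at h2
    exact h2
  have h0 := hR.lj.acr ho hb hfr' hne hR.Am hAw
  have hfull : ∀ {E' : Type _} [NormedAddCommGroup E'] [NormedSpace ℂ E'] (f : ℂ → E'),
      ∫ u, deriv z u • f (z u) ∂(nuI.restrict A) = ∫ u, deriv z u • f (z u) ∂nuI := by
    intro E' _ _ f
    rw [← integral_indicator hR.Am]
    apply integral_congr_ae
    filter_upwards [h0] with u hu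
    by_cases hA : u ∈ A
    · rw [indicator_of_mem hA]
    · rw [indicator_of_notMem hA]
      rw [indicator_of_mem (by exact hA)] at hu
      rw [hu]; simp
  have hfullC : ∀ (f : ℂ → ℂ),
      ∫ u, deriv z u • f (z u) ∂(nuI.restrict A) = ∫ u, deriv z u • f (z u) ∂nuI := by
    intro f
    rw [← integral_indicator hR.Am]
    apply integral_congr_ae
    filter_upwards [h0] with u hu
    by_cases hA : u ∈ A
    · rw [indicator_of_mem hA]
    · rw [indicator_of_notMem hA]
      rw [indicator_of_mem (by exact hA)] at hu
      rw [hu]; simp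
  refine ⟨z, hR.lj, hfr', fun w hw => ?_, by rw [hR.int F, hfull F]⟩
  have h1 := hfullC (fun x => (x - w)⁻¹)
  simp only [smul_eq_mul, ← div_eq_mul_inv] at h1
  rw [hAw w hw] at h1
  rw [wn, cau, ← h1, div_self tpi]

lemma core {l : ℂ} {z z0 : ℝ → ℂ} {Om Om0 U : Set ℂ} (h : LJ z) (h0 : LJ z0)
    (ho : IsOpen Om) (hb : Bornology.IsBounded Om) (hfr : frontier Om = z '' Icc 0 1) (hne : Om.Nonempty)
    (hwn : ∀ w ∈ Om, wn z w = 1)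
    (ho0 : IsOpen Om0) (hb0 : Bornology.IsBounded Om0) (hfr0 : frontier Om0 = z0 '' Icc 0 1)
    (hne0 : Om0.Nonempty) (hwn0 : ∀ w ∈ Om0, wn z0 w = 1)
    (hl : l ∈ frontier Om) (hl0 : l ∈ frontier Om0) (hsub : closure Om \ {l} ⊆ Om0)
    (hU : IsOpen U) (hUs : closure Om0 \ {l} ⊆ U) {F : ℂ → E} (hF : DifferentiableOn ℂ F U) {M : ℝ}
    (hM0 : 0 ≤ M) (hM : ∀ w ∈ closure Om0 \ ({l} ∪ Om), ‖F w‖ ≤ M) :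
    ∫ u, deriv z u • F (z u) ∂nuI = ∫ u, deriv z0 u • F (z0 u) ∂nuI := by
  have hlO : l ∉ Om := fun h1 => by
    rw [ho.frontier_eq] at hl; exact hl.2 h1
  have hlO0 : l ∉ Om0 := fun h1 => by
    rw [ho0.frontier_eq] at hl0; exact hl0.2 h1
  have hOO : Om ⊆ Om0 := fun w hw => hsub ⟨subset_closure hw, fun e => hlO (e ▸ hw)⟩
  have hzm : ∀ u, z u ∈ closure Om0 \ Om := fun u => by
    have h1 := h.clamp u
    rw [← hfr, ho.frontier_eq] at h1
    exact ⟨closure_mono hOO h1.1, h1.2⟩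
  have hz0m : ∀ u, z0 u ∈ closure Om0 \ Om := fun u => by
    have h1 := h0.clamp u
    rw [← hfr0, ho0.frontier_eq] at h1
    exact ⟨h1.1, fun h2 => h1.2 (hOO h2)⟩
  obtain ⟨C, hC0, hC⟩ := cutoff l
  have hr : ∀ n : ℕ, (0:ℝ) < 1 / ((n:ℝ) + 1) := fun n => by positivity
  let r : ℕ → ℝ := fun n => 1 / ((n:ℝ) + 1)
  have hr0 : Tendsto r atTop (𝓝 0) := tendsto_one_div_add_atTop_nhds_zero_nat
  choose χ χc χI χd χ0 χ1 using fun n => hC (r n) (hr n)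
  have hKc : ∀ n, IsCompact (closure Om0 \ Metric.ball l (r n)) := fun n =>
    hb0.isCompact_closure.diff Metric.isOpen_ball
  have hKU : ∀ n, closure Om0 \ Metric.ball l (r n) ⊆ U := fun n w hw =>
    hUs ⟨hw.1, fun e => hw.2 (by rw [mem_singleton_iff.1 e]; exact Metric.mem_ball_self (hr n))⟩
  choose φ t ht htU φc φ1 φ0 φI using fun n => plateau (hKc n) hU (hKU n)
  let η : ℕ → ℂ → ℝ := fun n w => χ n w * φ n w
  let ψ : ℕ → ℂ → E := fun n w => η n w • F w
  have ηI : ∀ n w, η n w ∈ Icc (0:ℝ) 1 := fun n w =>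
    ⟨mul_nonneg (χI n w).1 (φI n w).1, mul_le_one₀ (χI n w).2 (φI n w).1 (φI n w).2⟩
  have hψs : ∀ n, HasCompactSupport (ψ n) := fun n => by
    refine HasCompactSupport.intro (ht n) fun w hw => ?_
    simp [ψ, η, φ0 n w hw]
  have hψc : ∀ n, ContDiff ℝ 1 (ψ n) := fun n => by
    rw [contDiff_iff_contDiffAt]
    intro w
    by_cases hw : w ∈ U
    · have h1 : ContDiffAt ℂ 1 F w := (hF.contDiffOn hU).contDiffAt (hU.mem_nhds hw)
      exact (((χc n).mul (φc n)).contDiffAt).smul (h1.restrict_scalars ℝ)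
    · have h1 : ψ n =ᶠ[𝓝 w] fun _ => 0 := by
        filter_upwards [(ht n).isClosed.isOpen_compl.mem_nhds fun h2 => hw (htU n h2)] with x hx
        simp [ψ, η, φ0 n x hx]
      exact contDiffAt_const.congr_of_eventuallyEq h1
  have hlim : ∀ y : ℝ → ℂ, LJ y → (∀ u, y u ∈ closure Om0 \ Om) →
      Tendsto (fun n => ∫ u, deriv y u • ψ n (y u) ∂nuI) atTop (𝓝 (∫ u, deriv y u • F (y u) ∂nuI)) := by
    intro y hy hym
    refine tendsto_integral_of_dominated_convergence (fun u => ‖deriv y u‖ * M) ?_ ?_ ?_ ?_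
    · intro n
      exact (measurable_deriv y).aestronglyMeasurable.smul ((hψc n).continuous.comp hy.cont).aestronglyMeasurable
    · exact hy.dint.norm.mul_const _
    · intro n
      filter_upwards [hy.fib l] with u hu
      rw [norm_smul]
      refine mul_le_mul_of_nonneg_left ?_ (norm_nonneg _)
      have h1 := hM (y u) ⟨(hym u).1, fun h2 => h2.elim hu (hym u).2⟩
      have h2 := ηI n (y u)
      change ‖η n (y u) • F (y u)‖ ≤ M
      rw [norm_smul, Real.norm_of_nonneg h2.1]
      exact (mul_le_of_le_one_left (norm_nonneg _) h2.2).trans h1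
    · filter_upwards [hy.fib l] with u hu
      have hpos : 0 < ‖y u - l‖ / 2 := half_pos (norm_pos_iff.2 (sub_ne_zero.2 hu))
      refine tendsto_const_nhds.congr' ?_
      filter_upwards [hr0.eventually (gt_mem_nhds hpos)] with n hn
      have e1 : χ n (y u) = 1 := χ1 n _ (by linarith)
      have e2 : φ n (y u) = 1 := by
        refine (φ1 n (y u) ⟨(hym u).1, fun h2 => ?_⟩).self_of_nhds
        rw [Metric.mem_ball, dist_eq_norm] at h2
        linarith
      simp [ψ, η, e1, e2]
  have hdb : ∀ n, ∀ w ∈ Om0 \ Om, ‖dbar (ψ n) w‖ ≤ (Metric.closedBall l (2 * r n)).indicator (fun _ => C / r n * M) w := by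
    intro n w hw
    have hwl : w ≠ l := fun e => hlO0 (e ▸ hw.1)
    have hwU : w ∈ U := hUs ⟨subset_closure hw.1, hwl⟩
    have hFw := hM w ⟨subset_closure hw.1, fun h2 => h2.elim hwl hw.2⟩
    have hFd : DifferentiableAt ℂ F w := hF.differentiableAt (hU.mem_nhds hwU)
    have key : ∀ ζ : ℂ → ℝ, ContDiff ℝ 1 ζ → (η n =ᶠ[𝓝 w] ζ) → ‖dbar (ψ n) w‖ ≤ ‖fderiv ℝ ζ w‖ * ‖F w‖ := by
      intro ζ hζ he
      have h1 := dbar_mul (hζ.differentiable (by norm_num) w) hFd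
      have h2 : ψ n =ᶠ[𝓝 w] fun x => ζ x • F x := by
        filter_upwards [he] with x hx
        simp only [ψ, hx]
      have h3 : dbar (ψ n) w = dbar (fun x => ζ x • F x) w := by
        rw [dbar, dbar, h2.fderiv_eq]
      rw [h3]; exact h1
    have hnn : 0 ≤ (Metric.closedBall l (2 * r n)).indicator (fun _ => C / r n * M) w :=
      indicator_nonneg (fun _ _ => mul_nonneg (div_nonneg hC0 (hr n).le) hM0) _
    rcases lt_or_ge ‖w - l‖ (r n) with h1 | h1
    · have h2 : η n =ᶠ[𝓝 w] fun _ => 0 := by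
        have : Metric.ball l (r n) ∈ 𝓝 w := Metric.isOpen_ball.mem_nhds (by rwa [Metric.mem_ball, dist_eq_norm])
        filter_upwards [this] with x hx
        rw [Metric.mem_ball, dist_eq_norm] at hx
        simp [η, χ0 n x hx.le]
      have h3 := key _ contDiff_const h2
      simp only [fderiv_fun_const, Pi.zero_apply, norm_zero, zero_mul] at h3
      exact h3.trans hnn
    · have h2 : ∀ᶠ x in 𝓝 w, φ n x = 1 := by
        apply φ1 n w
        refine ⟨subset_closure hw.1, fun h3 => ?_⟩
        rw [Metric.mem_ball, dist_eq_norm] at h3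
        linarith
      by_cases hw2 : w ∈ Metric.closedBall l (2 * r n)
      · rw [indicator_of_mem hw2]
        have h3 := key (χ n) (χc n) (by
          filter_upwards [h2] with x hx
          simp [η, hx])
        refine h3.trans ?_
        exact mul_le_mul (χd n w) hFw (norm_nonneg _) (div_nonneg hC0 (hr n).le)
      · have h3 : η n =ᶠ[𝓝 w] fun _ => 1 := by
          filter_upwards [h2, Metric.isClosed_closedBall.isOpen_compl.mem_nhds hw2] with x hx hx2
          rw [mem_compl_iff, Metric.mem_closedBall, dist_eq_norm, not_le] at hx2
          simp [η, hx, χ1 n x hx2.le]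
        have h4 := key _ contDiff_const h3
        simp only [fderiv_fun_const, Pi.zero_apply, norm_zero, zero_mul] at h4
        exact h4.trans hnn
  have hpi : (π : ℂ) ≠ 0 := by exact_mod_cast Real.pi_ne_zero
  have hdiff : ∀ n, (∫ u, deriv z0 u • ψ n (z0 u) ∂nuI) - ∫ u, deriv z u • ψ n (z u) ∂nuI =
      (2 * I) • ∫ w in Om0 \ Om, dbar (ψ n) w := by
    intro n
    have hint : Integrable (dbar (ψ n)) :=
      (dbar_cont (hψc n)).integrable_of_hasCompactSupport (dbar_supp (hψs n))
    have e1 := h.green ho hb hfr hne hwn (hψc n) (hψs n)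
    have e2 := h0.green ho0 hb0 hfr0 hne0 hwn0 (hψc n) (hψs n)
    have e3 := setIntegral_sdiff ho.measurableSet hint.integrableOn hOO (μ := volume) (s := Om0)
    apply smul_right_injective E hpi
    simp only
    rw [smul_sub, e1, e2, e3, smul_smul, smul_sub]
    congr 2 <;> ring
  have hbd : ∀ n, ‖(2 * I) • ∫ w in Om0 \ Om, dbar (ψ n) w‖ ≤ (8 * π * C * M) * r n := by
    intro n
    have hi : Integrable ((Metric.closedBall l (2 * r n)).indicator (fun _ => C / r n * M)) :=
      (integrable_indicator_iff Metric.isClosed_closedBall.measurableSet).2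
          (integrableOn_const (Metric.isBounded_closedBall.measure_lt_top.ne))
    have hrn : 0 < r n := hr n
    have h1 : ‖∫ w in Om0 \ Om, dbar (ψ n) w‖ ≤
        ∫ w in Om0 \ Om, (Metric.closedBall l (2 * r n)).indicator (fun _ => C / r n * M) w := by
      refine norm_integral_le_of_norm_le hi.integrableOn ?_
      · filter_upwards [ae_restrict_mem (ho0.measurableSet.diff ho.measurableSet)] with w hw using hdb n w hw
    have h2 := setIntegral_le_integral (s := Om0 \ Om) hi
      (Eventually.of_forall fun w => indicator_nonneg (fun _ _ => mul_nonneg (div_nonneg hC0 hrn.le) hM0) w)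
    have h3 : ∀ q c : ℝ, 0 < q → ∫ w, (Metric.closedBall l (2 * q)).indicator (fun _ => c) w =
        (2 * q) ^ 2 * π * c := by
      intro q c hq
      rw [integral_indicator Metric.isClosed_closedBall.measurableSet, setIntegral_const,
        measureReal_def, Complex.volume_closedBall, smul_eq_mul, ENNReal.toReal_mul,
        ENNReal.toReal_pow, ENNReal.toReal_ofReal (by positivity)]
      simp only [ENNReal.coe_toReal, NNReal.coe_real_pi]
    rw [h3 _ _ hrn] at h2
    rw [norm_smul]
    have e : ‖(2 * I : ℂ)‖ = 2 := by simp
    rw [e]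
    refine (mul_le_mul_of_nonneg_left (h1.trans h2) zero_le_two).trans (le_of_eq ?_)
    field_simp
    ring
  have hz := (hlim z0 h0 hz0m).sub (hlim z h hzm)
  simp only [hdiff] at hz
  have hz2 : Tendsto (fun n => (2 * I) • ∫ w in Om0 \ Om, dbar (ψ n) w) atTop (𝓝 0) := by
    refine squeeze_zero_norm hbd ?_
    simpa using hr0.const_mul (8 * π * C * M)
  have := tendsto_nhds_unique hz hz2
  exact (sub_eq_zero.1 this).symm

end Final
end CD

/-- Contour-deformation lemma: the integral of a bounded analytic operator-valued
function over two positively oriented rectifiable Jordan curves through a common point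
`λ₀`, connected by a family of shrinking rectifiable paths, coincide. Positive
orientation is encoded via the winding number of the curves around points of the
enclosed domains. -/
theorem stmt7 (lam₀ : ℂ) (Γ Γ₀ : ℝ → ℂ) (Ω Ω₀ : Set ℂ)
    (hΓc : ContinuousOn Γ (Set.Icc 0 1)) (hΓ0c : ContinuousOn Γ₀ (Set.Icc 0 1))
    (hΓinj : Set.InjOn Γ (Set.Ico 0 1)) (hΓ0inj : Set.InjOn Γ₀ (Set.Ico 0 1))
    (hΓrect : eVariationOn Γ (Set.Icc 0 1) ≠ ⊤)
    (hΓ0rect : eVariationOn Γ₀ (Set.Icc 0 1) ≠ ⊤)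
    (hends : Γ 0 = lam₀ ∧ Γ 1 = lam₀ ∧ Γ₀ 0 = lam₀ ∧ Γ₀ 1 = lam₀)
    (hΩo : IsOpen Ω) (hΩb : Bornology.IsBounded Ω) (hΩfr : frontier Ω = Γ '' Set.Icc 0 1)
    (hΩ0o : IsOpen Ω₀) (hΩ0b : Bornology.IsBounded Ω₀)
    (hΩ0fr : frontier Ω₀ = Γ₀ '' Set.Icc 0 1)
    (horient : ∀ z ∈ Ω, (2 * π * Complex.I)⁻¹ *
      ∫ t in (0:ℝ)..1, deriv Γ t / (Γ t - z) = 1)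
    (horient₀ : ∀ z ∈ Ω₀, (2 * π * Complex.I)⁻¹ *
      ∫ t in (0:ℝ)..1, deriv Γ₀ t / (Γ₀ t - z) = 1)
    (hsub : closure Ω \ {lam₀} ⊆ Ω₀)
    (t₀ t₁ : ℕ → ℝ) (γ₀ γ₁ : ℕ → ℝ → ℂ)
    (ht₀ : StrictAnti t₀) (ht₁ : StrictMono t₁)
    (htmem : ∀ n, t₀ n ∈ Set.Ioo (0:ℝ) 1 ∧ t₁ n ∈ Set.Ioo (0:ℝ) 1)
    (htord : t₀ 0 < t₁ 0)
    (ht₀lim : Tendsto t₀ atTop (nhds 0)) (ht₁lim : Tendsto t₁ atTop (nhds 1))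
    (hγc : ∀ n, ContinuousOn (γ₀ n) (Set.Icc 0 1) ∧ ContinuousOn (γ₁ n) (Set.Icc 0 1))
    (hγends : ∀ n, γ₀ n 0 = Γ (t₀ n) ∧ γ₀ n 1 = Γ₀ (t₀ n) ∧
      γ₁ n 0 = Γ₀ (t₁ n) ∧ γ₁ n 1 = Γ (t₁ n))
    (hγmem : ∀ n, γ₀ n '' Set.Icc 0 1 ⊆ closure Ω₀ \ Ω ∧
      γ₁ n '' Set.Icc 0 1 ⊆ closure Ω₀ \ Ω)
    (hγint : ∀ n, γ₀ n '' Set.Ioo 0 1 ⊆ Ω₀ \ closure Ω ∧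
      γ₁ n '' Set.Ioo 0 1 ⊆ Ω₀ \ closure Ω)
    (hγlen : Tendsto (fun n => eVariationOn (γ₀ n) (Set.Icc 0 1)) atTop (nhds 0) ∧
      Tendsto (fun n => eVariationOn (γ₁ n) (Set.Icc 0 1)) atTop (nhds 0))
    (hγdisj : ∀ (k l : Bool) (m n : ℕ), ∀ t ∈ Set.Icc (0:ℝ) 1, ∀ s ∈ Set.Icc (0:ℝ) 1,
      (if k then γ₁ m else γ₀ m) t = (if l then γ₁ n else γ₀ n) s →
      k = l ∧ m = n ∧ t = s)
    (U : Set ℂ) (hUo : IsOpen U) (hUsub : closure Ω₀ \ {lam₀} ⊆ U)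
    (F : ℂ → (H →L[ℂ] H)) (hF : DifferentiableOn ℂ F U)
    (hFbd : ∃ C : ℝ, ∀ z ∈ closure Ω₀ \ ({lam₀} ∪ Ω), ‖F z‖ ≤ C) :
    (∫ t in (0:ℝ)..1, deriv Γ t • F (Γ t)) =
      ∫ t in (0:ℝ)..1, deriv Γ₀ t • F (Γ₀ t) := by
  have hΩne : Ω.Nonempty := by
    rw [Set.nonempty_iff_ne_empty]
    rintro rfl
    have h1 : Γ 0 ∈ Γ '' Set.Icc 0 1 := ⟨0, by simp, rfl⟩
    rw [← hΩfr] at h1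
    simp at h1
  have hΩ0ne : Ω₀.Nonempty := by
    rw [Set.nonempty_iff_ne_empty]
    rintro rfl
    have h1 : Γ₀ 0 ∈ Γ₀ '' Set.Icc 0 1 := ⟨0, by simp, rfl⟩
    rw [← hΩ0fr] at h1
    simp at h1
  obtain ⟨C, hC⟩ := hFbd
  obtain ⟨z, hz, hzf, hzw, hzi⟩ := CD.curve hΓc hΓinj hΓrect (hends.1.trans hends.2.1.symm)
    hΩo hΩb hΩfr hΩne horient F
  obtain ⟨z0, hz0, hzf0, hzw0, hzi0⟩ := CD.curve hΓ0c hΓ0inj hΓ0rect (hends.2.2.1.trans hends.2.2.2.symm)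
    hΩ0o hΩ0b hΩ0fr hΩ0ne horient₀ F
  rw [hzi, hzi0]
  exact CD.core hz hz0 hΩo hΩb hzf hΩne hzw hΩ0o hΩ0b hzf0 hΩ0ne hzw0
    (hΩfr ▸ ⟨0, by simp, hends.1⟩) (hΩ0fr ▸ ⟨0, by simp, hends.2.2.1⟩) hsub hUo hUsub hF
    (le_max_right C 0) (fun w hw => (hC w hw).trans (le_max_left C 0))
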